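/- arXiv:2409.11082 — 5 statements merged into one kernel-verified Lean document; each statement's English description precedes it below -/
import Mathlib

section
/- Let K be a totally real field and let α ∈ O_K with 0 ≺ α ≺ 4, set β = 4 − α, and assume α ∉ K^{×2}. If β ∉ K^{×2}, then α·γ_K ∈ K^{×2} and β·γ_K ∈ K^{×2}. -/
open Polynomial

set_option synthInstance.maxHeartbeats 400000
set_option maxHeartbeats 400000

noncomputable section

/-- `z : ℂ` is a totally real algebraic number: it is algebraic over `ℚ` and all of its
conjugates over `ℚ` (i.e. the complex roots of its minimal polynomial over `ℚ`) are real. -/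
def IsTotallyRealNum (z : ℂ) : Prop :=
  IsAlgebraic ℚ z ∧ ∀ w : ℂ, aeval w (minpoly ℚ z) = 0 → w.im = 0

/-- `g a = e^{2πia} + e^{-2πia} = 2 cos (2πa)`. -/
def g (a : ℚ) : ℂ :=
  Complex.exp (2 * Real.pi * Complex.I * (a : ℂ)) +
    Complex.exp (-(2 * Real.pi * Complex.I * (a : ℂ)))

open Classical in
/-- `γ_K`: if there is an integer `m > 0` with `g(1/2^m)² ∈ K` and `g(1/2^m) ∉ K` (for a
totally real field `K` such an `m` is unique), then `γ_K = g(1/2^m)²`; otherwise `γ_K = −1`. -/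
def gammaK (K : Subfield ℂ) : ℂ :=
  if h : ∃ m : ℕ, 0 < m ∧ g (1 / 2 ^ m) ^ 2 ∈ K ∧ g (1 / 2 ^ m) ∉ K then
    g (1 / 2 ^ h.choose) ^ 2
  else -1

/-- The standard primitive `2 ^ m`-th root of unity `e^{2πi/2^m}`. -/
def rho (m : ℕ) : ℂ := Complex.exp (2 * Real.pi * Complex.I / ((2 ^ m : ℕ) : ℂ))

lemma rho_isPrimitiveRoot (m : ℕ) : IsPrimitiveRoot (rho m) (2 ^ m) :=
  Complex.isPrimitiveRoot_exp _ (by positivity)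

lemma rho_ne_zero (m : ℕ) : rho m ≠ 0 := Complex.exp_ne_zero _

lemma rho_succ_sq (m : ℕ) : rho (m + 1) ^ 2 = rho m := by
  rw [rho, rho, ← Complex.exp_nat_mul]
  congr 1
  push_cast
  field_simp
  ring

lemma g_one_div_two_pow (m : ℕ) : g (1 / 2 ^ m) = rho m + (rho m)⁻¹ := by
  rw [g, rho, Complex.exp_neg]
  have h : (2 * Real.pi * Complex.I * ((1 / 2 ^ m : ℚ) : ℂ)) =
      2 * Real.pi * Complex.I / ((2 ^ m : ℕ) : ℂ) := by
    push_cast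
    ring
  rw [h]

lemma g_succ_sq (m : ℕ) : g (1 / 2 ^ (m + 1)) ^ 2 = g (1 / 2 ^ m) + 2 := by
  rw [g_one_div_two_pow, g_one_div_two_pow, ← rho_succ_sq m]
  have := rho_ne_zero (m + 1)
  field_simp
  ring

lemma g_ne_zero {m : ℕ} (hm : 3 ≤ m) : g (1 / 2 ^ m) ≠ 0 := by
  intro h
  rw [g_one_div_two_pow] at h
  have h0 := rho_ne_zero m
  field_simp at h
  have h4 : rho m ^ 4 = 1 := by linear_combination (rho m ^ 2 - 1) * h
  have h1 := Nat.le_of_dvd (by norm_num) ((rho_isPrimitiveRoot m).dvd_of_pow_eq_one 4 h4)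
  have h2 : 2 ^ 3 ≤ 2 ^ m := Nat.pow_le_pow_right (by norm_num) hm
  omega

lemma g_mem_of_le {K : Subfield ℂ} {m k : ℕ} (hmk : m ≤ k) (hk : g (1 / 2 ^ k) ∈ K) :
    g (1 / 2 ^ m) ∈ K := by
  induction k, hmk using Nat.le_induction with
  | base => exact hk
  | succ k _ ih =>
    refine ih ?_
    have h : g (1 / 2 ^ k) = g (1 / 2 ^ (k + 1)) ^ 2 - 2 := by rw [g_succ_sq]; ring
    rw [h]
    exact K.sub_mem (K.pow_mem hk 2) (ofNat_mem K 2)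

lemma gammaK_eq {K : Subfield ℂ} {m : ℕ} (hm : g (1 / 2 ^ m) ∈ K)
    (hm' : g (1 / 2 ^ (m + 1)) ∉ K) : gammaK K = g (1 / 2 ^ (m + 1)) ^ 2 := by
  have h : ∃ m : ℕ, 0 < m ∧ g (1 / 2 ^ m) ^ 2 ∈ K ∧ g (1 / 2 ^ m) ∉ K :=
    ⟨m + 1, m.succ_pos, by rw [g_succ_sq]; exact K.add_mem hm (ofNat_mem K 2), hm'⟩
  rw [gammaK, dif_pos h]
  obtain ⟨h0, h1, h2⟩ := h.choose_spec
  generalize h.choose = k at h0 h1 h2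
  obtain ⟨k, rfl⟩ : ∃ j, k = j + 1 := ⟨k - 1, by omega⟩
  have h3 : g (1 / 2 ^ k) ∈ K := by
    have h : g (1 / 2 ^ k) = g (1 / 2 ^ (k + 1)) ^ 2 - 2 := by rw [g_succ_sq]; ring
    rw [h]
    exact K.sub_mem h1 (ofNat_mem K 2)
  have h4 : ¬ k + 1 ≤ m := fun hle => h2 (g_mem_of_le hle hm)
  have h5 : ¬ m + 1 ≤ k := fun hle => hm' (g_mem_of_le hle h3)
  rw [show k = m by omega]

lemma pow_add_inv_mem {K : Subfield ℂ} {z : ℂ} (hz : z ≠ 0) (h : z + z⁻¹ ∈ K) (n : ℕ) :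
    z ^ n + (z ^ n)⁻¹ ∈ K := by
  induction n using Nat.twoStepInduction with
  | zero => simpa using K.add_mem K.one_mem K.one_mem
  | one => simpa using h
  | more n h0 h1 =>
    have e : z ^ (n + 2) + (z ^ (n + 2))⁻¹ =
        (z ^ (n + 1) + (z ^ (n + 1))⁻¹) * (z + z⁻¹) - (z ^ n + (z ^ n)⁻¹) := by
      field_simp
      ring
    rw [e]
    exact K.sub_mem (K.mul_mem h1 h) h0

lemma zpow_add_inv_mem {K : Subfield ℂ} {z : ℂ} (hz : z ≠ 0) (h : z + z⁻¹ ∈ K) (n : ℤ) :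
    z ^ n + (z ^ n)⁻¹ ∈ K := by
  obtain ⟨k, rfl | rfl⟩ := n.eq_nat_or_neg
  · simpa using pow_add_inv_mem hz h k
  · simpa [add_comm] using pow_add_inv_mem hz h k

lemma add_inv_mem_of_sq_eq {K : Subfield ℂ} {z y : ℂ} (hz : z ≠ 0) (h : z + z⁻¹ ∈ K) {n : ℤ}
    (hn : Even n) (hy : y ^ 2 = z ^ n) : y + y⁻¹ ∈ K := by
  obtain ⟨k, rfl⟩ := hn
  rw [zpow_add₀ hz, ← sq] at hy
  rcases sq_eq_sq_iff_eq_or_eq_neg.mp hy with rfl | rfl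
  · exact zpow_add_inv_mem hz h k
  · have := K.neg_mem (zpow_add_inv_mem hz h k)
    rwa [neg_add, ← inv_neg] at this

lemma exists_sq_of_odd_pow_eq_one {K : Subfield ℂ} {z : ℂ} (h : z + z⁻¹ ∈ K) {n : ℕ}
    (hn : Odd n) (hzn : z ^ n = 1) : ∃ x ∈ K, 2 + (z + z⁻¹) = x ^ 2 := by
  have hz : z ≠ 0 := by
    rintro rfl
    simp [hn.pos.ne'] at hzn
  obtain ⟨k, rfl⟩ := hn
  refine ⟨_, pow_add_inv_mem hz h (k + 1), ?_⟩
  have e : (z ^ (k + 1)) ^ 2 = z := by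
    rw [← pow_mul, show (k + 1) * 2 = 2 * k + 1 + 1 by ring, pow_succ, hzn, one_mul]
  have hz' : z ^ (k + 1) ≠ 0 := pow_ne_zero _ hz
  rw [add_sq, mul_assoc, mul_inv_cancel₀ hz', inv_pow, e]
  ring

lemma exists_sq_of_sq_eq_odd_zpow {K : Subfield ℂ} {z r : ℂ} (hz : z ≠ 0) (hr : r ≠ 0)
    (h : z + z⁻¹ ∈ K) {l : ℤ} (hl : Odd l) (hrl : r ^ 2 = z ^ l) :
    ∃ x ∈ K, (2 + (z + z⁻¹)) * (r + r⁻¹) ^ 2 = x ^ 2 := by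
  obtain ⟨w, rfl⟩ : ∃ w, z = w ^ 2 := by
    obtain ⟨w, hw⟩ := IsAlgClosed.exists_pow_nat_eq z (n := 2) (by norm_num)
    exact ⟨w, hw.symm⟩
  have hw : w ≠ 0 := by
    rintro rfl
    simp at hz
  have h1 : w * r + (w * r)⁻¹ ∈ K := by
    refine add_inv_mem_of_sq_eq hz h (n := 1 + l) (odd_one.add_odd hl) ?_
    rw [mul_pow, hrl, zpow_add₀ hz, zpow_one]
  have h2 : w / r + (w / r)⁻¹ ∈ K := by
    refine add_inv_mem_of_sq_eq hz h (n := 1 - l) (odd_one.sub_odd hl) ?_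
    rw [div_pow, hrl, zpow_sub₀ hz, zpow_one]
  refine ⟨_, K.add_mem h1 h2, ?_⟩
  field_simp
  ring

/-- Kronecker: an algebraic integer all of whose conjugates are real and in `(0, 4)` is of the form
`2 + (z + z⁻¹)` with `z` a root of unity. -/
lemma exists_eq_two_add_root_of_unity_add_inv {α : ℂ} (hint : IsIntegral ℤ α)
    (him : ∀ w : ℂ, aeval w (minpoly ℚ α) = 0 → w.im = 0)
    (hre : ∀ w : ℂ, aeval w (minpoly ℚ α) = 0 → 0 < w.re ∧ w.re < 4) :
    ∃ z : ℂ, ∃ n : ℕ, 0 < n ∧ z ^ n = 1 ∧ α = 2 + (z + z⁻¹) := by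
  obtain ⟨s, hs⟩ := IsAlgClosed.exists_pow_nat_eq ((α - 2) ^ 2 - 4) (n := 2) (by norm_num)
  set z : ℂ := ((α - 2) + s) / 2 with hz
  have hq : z ^ 2 - (α - 2) * z + 1 = 0 := by
    rw [hz]
    linear_combination hs / 4
  have hz0 : z ≠ 0 := by
    intro h
    rw [h] at hq
    norm_num at hq
  have hα : α = 2 + (z + z⁻¹) := by
    field_simp
    linear_combination -hq
  have hzint : IsIntegral ℤ z := by
    have hα2 : IsIntegral ℤ (α - 2) :=
      hint.sub (by simpa using isIntegral_algebraMap (R := ℤ) (A := ℂ) (x := 2))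
    let A := integralClosure ℤ ℂ
    let a : A := ⟨α - 2, hα2⟩
    refine isIntegral_trans (R := ℤ) (A := A) z ⟨X ^ 2 - C a * X + 1, by monicity!, ?_⟩
    have ha : algebraMap A ℂ a = α - 2 := rfl
    simp [ha, hq]
  let F := IntermediateField.adjoin ℚ {z}
  have hzQ : IsIntegral ℚ z := hzint.tower_top
  have : FiniteDimensional ℚ F := IntermediateField.adjoin.finiteDimensional hzQ
  have : NumberField F := { }
  let x : F := IntermediateField.AdjoinSimple.gen ℚ z
  have hx : algebraMap F ℂ x = z := IntermediateField.AdjoinSimple.algebraMap_gen ℚ z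
  have hxint : IsIntegral ℤ x := by
    rw [← isIntegral_algebraMap_iff (algebraMap F ℂ).injective, hx]
    exact hzint
  have hxα : algebraMap F ℂ (2 + (x + x⁻¹)) = α := by
    rw [hα, map_add, map_add, map_inv₀, hx, map_ofNat]
  obtain ⟨n, hn, hxn⟩ := NumberField.Embeddings.pow_eq_one_of_norm_eq_one F ℂ hxint (by
    intro φ
    have hx0 : φ x ≠ 0 := by
      intro h
      apply hz0
      rw [← hx, (map_eq_zero φ).mp h, map_zero]
    set u := φ x with hu
    have hroot : aeval (2 + (u + u⁻¹)) (minpoly ℚ α) = 0 := by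
      have h1 : minpoly ℚ α = minpoly ℚ (2 + (x + x⁻¹)) := by
        rw [← hxα, minpoly.algebraMap_eq (algebraMap F ℂ).injective]
      have h2 : 2 + (u + u⁻¹) = φ.toRatAlgHom (2 + (x + x⁻¹)) := by
        rw [map_add, map_add, map_inv₀, map_ofNat]
        rfl
      rw [h1, h2, aeval_algHom_apply, minpoly.aeval, map_zero]
    have h1 := him _ hroot
    have h2 := hre _ hroot
    generalize hv : u + u⁻¹ = v at h1 h2
    have hv' : u ^ 2 - v * u + 1 = 0 := by
      rw [← hv]
      field_simp
      ring
    simp only [Complex.add_im, Complex.add_re, Complex.im_ofNat, Complex.re_ofNat,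
      zero_add] at h1 h2
    have e1 := congrArg Complex.re hv'
    have e2 := congrArg Complex.im hv'
    simp [sq, h1] at e1 e2
    have hnorm : u.re * u.re + u.im * u.im = 1 := by
      rcases mul_eq_zero.mp (show u.im * (2 * u.re - v.re) = 0 by linarith) with h | h
      · rw [h] at e1
        nlinarith [sq_nonneg (2 * u.re - v.re)]
      · nlinarith
    rw [← sq_eq_sq₀ (norm_nonneg _) zero_le_one, Complex.sq_norm, Complex.normSq_apply, hnorm]
    norm_num)
  refine ⟨z, n, hn, ?_, hα⟩
  rw [← hx, ← map_pow, hxn, map_one]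

lemma exists_odd_pow_eq_rho {z : ℂ} {m n : ℕ} (hm : m ≠ 0) (hn : Odd n)
    (hz : IsPrimitiveRoot z (2 ^ m * n)) : ∃ l : ℕ, Odd l ∧ rho m = z ^ l := by
  have hp : IsPrimitiveRoot (z ^ n) (2 ^ m) :=
    hz.pow (Nat.mul_pos (by positivity) hn.pos) (mul_comm _ _)
  obtain ⟨i, -, hi, h⟩ := (hp.isPrimitiveRoot_iff).mp (rho_isPrimitiveRoot m)
  refine ⟨n * i, hn.mul ?_, by rw [pow_mul, h]⟩
  exact Nat.Coprime.odd_of_right (hi.coprime_dvd_right (dvd_pow_self 2 hm))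

lemma exists_sq_mul_gammaK {K : Subfield ℂ} {z : ℂ} {m : ℕ} {l : ℤ} (hm : 2 ≤ m) (hz : z ≠ 0)
    (h : z + z⁻¹ ∈ K) (hl : Odd l) (hrho : rho m = z ^ l) (h0 : 2 + (z + z⁻¹) ≠ 0)
    (hsq : ¬ ∃ x ∈ K, x ≠ 0 ∧ 2 + (z + z⁻¹) = x ^ 2) :
    ∃ x ∈ K, x ≠ 0 ∧ (2 + (z + z⁻¹)) * gammaK K = x ^ 2 := by
  have hg0 := g_ne_zero (m := m + 1) (by omega)
  obtain ⟨x, hxK, hx⟩ := exists_sq_of_sq_eq_odd_zpow hz (rho_ne_zero (m + 1)) h hl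
    ((rho_succ_sq m).trans hrho)
  rw [← g_one_div_two_pow] at hx
  have hx0 : x ≠ 0 := by
    rintro rfl
    exact mul_ne_zero h0 (pow_ne_zero 2 hg0) (by simpa using hx)
  have hg : g (1 / 2 ^ m) ∈ K := by
    rw [g_one_div_two_pow, hrho]
    exact zpow_add_inv_mem hz h l
  have hg' : g (1 / 2 ^ (m + 1)) ∉ K := by
    intro hmem
    refine hsq ⟨x / g (1 / 2 ^ (m + 1)), K.div_mem hxK hmem, div_ne_zero hx0 hg0, ?_⟩
    rw [div_pow, ← hx]
    field_simp
  exact ⟨x, hxK, hx0, by rw [gammaK_eq hg hg', hx]⟩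

/-- Let `K` be a totally real field, `α ∈ O_K` with `0 ≺ α ≺ 4`, and `β = 4 − α`.
If `α ∉ K^{×2}` and `β ∉ K^{×2}`, then `α·γ_K ∈ K^{×2}` and `β·γ_K ∈ K^{×2}`. -/
theorem stmt_6 (K : Subfield ℂ) (hK : ∀ x : ↥K, IsTotallyRealNum ↑x)
    (α : ℂ) (hαK : α ∈ K) (hint : IsIntegral ℤ α)
    (hconj : ∀ w : ℂ, aeval w (minpoly ℚ α) = 0 → 0 < w.re ∧ w.re < 4)
    (hα : ¬ ∃ x ∈ K, x ≠ 0 ∧ α = x ^ 2)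
    (hβ : ¬ ∃ x ∈ K, x ≠ 0 ∧ 4 - α = x ^ 2) :
    (∃ x ∈ K, x ≠ 0 ∧ α * gammaK K = x ^ 2) ∧
      (∃ x ∈ K, x ≠ 0 ∧ (4 - α) * gammaK K = x ^ 2) := by
  have hmin : aeval α (minpoly ℚ α) = 0 := minpoly.aeval ℚ α
  obtain ⟨z, k, hk, hzk, hαz⟩ :=
    exists_eq_two_add_root_of_unity_add_inv hint (hK ⟨α, hαK⟩).2 hconj
  have hz : z ≠ 0 := by
    rintro rfl
    simp [hk.ne'] at hzk
  have hα0 : α ≠ 0 := by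
    intro h
    simpa [h] using (hconj α hmin).1
  have hβ0 : 4 - α ≠ 0 := by
    intro h
    simpa [← sub_eq_zero.mp h] using (hconj α hmin).2
  have hβz : 4 - α = 2 + (-z + (-z)⁻¹) := by
    rw [hαz, inv_neg]
    ring
  have hzK : z + z⁻¹ ∈ K := by
    rw [show z + z⁻¹ = α - 2 by rw [hαz]; ring]
    exact K.sub_mem hαK (ofNat_mem K 2)
  have hzK' : -z + (-z)⁻¹ ∈ K := by
    rw [show -z + (-z)⁻¹ = -(z + z⁻¹) by rw [inv_neg]; ring]
    exact K.neg_mem hzK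
  have hN : orderOf z ≠ 0 :=
    (orderOf_pos_iff.mpr (isOfFinOrder_iff_pow_eq_one.mpr ⟨k, hk, hzk⟩)).ne'
  obtain ⟨m, n, hn, hmn⟩ := Nat.exists_eq_two_pow_mul_odd hN
  have hprim := IsPrimitiveRoot.orderOf z
  rw [hmn] at hprim
  have hm : 2 ≤ m := by
    by_contra! hlt
    interval_cases m
    · obtain ⟨x, hx, hx2⟩ := exists_sq_of_odd_pow_eq_one hzK hn (by simpa using hprim.pow_eq_one)
      rw [← hαz] at hx2
      exact hα ⟨x, hx, fun h => hα0 (by simp [hx2, h]), hx2⟩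
    · have hneg : z ^ n = -1 := by
        have h2 := hprim.pow (Nat.mul_pos (by norm_num) hn.pos) (mul_comm _ n)
        exact IsPrimitiveRoot.eq_neg_one_of_two_right (by simpa using h2)
      obtain ⟨x, hx, hx2⟩ := exists_sq_of_odd_pow_eq_one hzK' hn (by rw [hn.neg_pow, hneg, neg_neg])
      rw [← hβz] at hx2
      exact hβ ⟨x, hx, fun h => hβ0 (by simp [hx2, h]), hx2⟩
  obtain ⟨l, hl, hrho⟩ := exists_odd_pow_eq_rho (by omega) hn hprim
  obtain ⟨j, rfl⟩ : ∃ j, m = j + 2 := ⟨m - 2, by omega⟩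
  have hneg : z ^ (2 ^ (j + 1) * n) = -1 := by
    have h2 := hprim.pow (b := 2) (a := 2 ^ (j + 1) * n)
      (Nat.mul_pos (by positivity) hn.pos) (by ring)
    exact h2.eq_neg_one_of_two_right
  have hl' : Odd (l + 2 ^ (j + 1) * n) :=
    hl.add_even ((even_two.pow_of_ne_zero j.succ_ne_zero).mul_right n)
  have hrho' : rho (j + 2) = (-z) ^ (l + 2 ^ (j + 1) * n) := by
    rw [hl'.neg_pow, pow_add, hneg, hrho]
    ring
  constructor
  · rw [hαz] at hα hα0 ⊢
    exact exists_sq_mul_gammaK (l := (l : ℤ)) hm hz hzK (by exact_mod_cast hl)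
      (by rw [zpow_natCast, hrho]) hα0 hα
  · rw [hβz] at hβ hβ0 ⊢
    exact exists_sq_mul_gammaK (l := ((l + 2 ^ (j + 1) * n : ℕ) : ℤ)) hm (neg_ne_zero.mpr hz) hzK'
      (by exact_mod_cast hl') (by rw [zpow_natCast, hrho']) hβ0 hβ

end
end

section
/- Let K be a totally real field and let (L, Q) be a positive definite quadratic lattice over K of rank n ≥ 2. Then (L, Q) represents at most 2n − 2 classes of O_K^{×,+}/O_K^{×2}. -/
open Polynomial NumberField

set_option synthInstance.maxHeartbeats 400000
set_option maxHeartbeats 400000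

noncomputable section

/-- `z : ℂ` is a totally positive algebraic number: it is algebraic over `ℚ` and all of its
conjugates over `ℚ` are positive real numbers. -/
def IsTotallyPositive (z : ℂ) : Prop :=
  IsAlgebraic ℚ z ∧ ∀ w : ℂ, aeval w (minpoly ℚ z) = 0 → 0 < w.re ∧ w.im = 0

namespace QuadraticMap

section Ordered

variable {R L : Type*} [CommRing R] [AddCommGroup L] [Module R L] (Q : QuadraticMap R L R)

/-- The Cauchy–Schwarz inequality for a quadratic map that is positive at a real place. -/
lemma polar_sq_le (σ : R →+* ℝ) (hpos : ∀ v : L, v ≠ 0 → 0 < σ (Q v)) (x y : L) :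
    σ (polar Q x y) ^ 2 ≤ 4 * σ (Q x) * σ (Q y) := by
  rcases eq_or_ne x 0 with rfl | hx
  · simp
  have hx' := hpos x hx
  have h0 : ∀ v : L, 0 ≤ σ (Q v) := fun v => by
    rcases eq_or_ne v 0 with rfl | hv
    · simp
    · exact (hpos v hv).le
  have h := h0 ((2 * Q x) • y - polar Q x y • x)
  have e : Q ((2 * Q x) • y - polar Q x y • x)
      = Q x * (4 * Q x * Q y - polar Q x y ^ 2) := by
    rw [sub_eq_add_neg, QuadraticMap.map_add Q, ← neg_smul, Q.map_smul, Q.map_smul,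
      polar_smul_left, polar_smul_right, polar_comm Q y x]
    simp only [smul_eq_mul]
    ring
  rw [e, map_mul, map_sub, map_mul, map_mul, map_pow, map_ofNat] at h
  linarith [nonneg_of_mul_nonneg_right h hx']

/-- A positive definite quadratic map admits a vector not orthogonal to any of finitely many
prescribed nonzero vectors. -/
lemma exists_forall_polar_ne_zero (σ : R →+* ℝ) (hpos : ∀ v : L, v ≠ 0 → 0 < σ (Q v))
    {S : Set L} (hS : S.Finite) (h0 : ∀ x ∈ S, x ≠ 0) : ∃ w, ∀ x ∈ S, σ (polar Q x w) ≠ 0 := by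
  induction S, hS using Set.Finite.induction_on with
  | empty => exact ⟨0, by simp⟩
  | @insert y S _ hS ih =>
    obtain ⟨w, hw⟩ := ih fun x hx => h0 x (Set.mem_insert_of_mem _ hx)
    by_cases hy : σ (polar Q y w) = 0
    · have hbad : {N : ℕ | ∃ x ∈ S, N * σ (polar Q x w) + σ (polar Q x y) = 0}.Finite := by
        have : {N : ℕ | ∃ x ∈ S, N * σ (polar Q x w) + σ (polar Q x y) = 0} ⊆
            ⋃ x ∈ S, {N : ℕ | N * σ (polar Q x w) + σ (polar Q x y) = 0} := by
          rintro N ⟨x, hx, h⟩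
          exact Set.mem_biUnion hx h
        refine (hS.biUnion fun x hx => Set.Subsingleton.finite fun a ha b hb => ?_).subset this
        have hab : ((a : ℝ) - b) * σ (polar Q x w) = 0 := by
          simp only [Set.mem_ofPred_eq] at ha hb
          linarith
        have := (mul_eq_zero.1 hab).resolve_right (hw x hx)
        exact_mod_cast sub_eq_zero.1 this
      obtain ⟨N, hN⟩ := hbad.exists_notMem
      refine ⟨(N : R) • w + y, ?_⟩
      rintro x (rfl | hx)
      · have := hpos x (h0 x (Set.mem_insert _ _))
        rw [polar_add_right, polar_smul_right, polar_self, two_nsmul]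
        simp only [smul_eq_mul, map_add, map_mul, hy]
        linarith
      · intro h
        refine hN ⟨x, hx, ?_⟩
        simpa using h
    · refine ⟨w, ?_⟩
      rintro x (rfl | hx)
      exacts [hy, hw x hx]

/-- Vectors in an open half-space whose mutual inner products are nonpositive are linearly
independent. -/
lemma linearIndependent_of_polar_nonpos (σ : R →+* ℝ) (hσ : Function.Injective σ)
    (hpos : ∀ v : L, v ≠ 0 → 0 < σ (Q v)) {ι : Type*} [Fintype ι] (v : ι → L) (w : L)
    (hw : ∀ i, 0 < σ (polar Q (v i) w)) (hv : ∀ i j, i ≠ j → σ (polar Q (v i) (v j)) ≤ 0) :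
    LinearIndependent R v := by
  classical
  have key : ∀ g : ι → R, ∑ i, g i • v i = 0 → ∀ i, σ (g i) ≤ 0 := by
    intro g hg
    set P := Finset.univ.filter fun i => 0 < σ (g i) with hP
    set x := ∑ i ∈ P, g i • v i with hx
    set y := ∑ i ∈ Finset.univ.filter (fun i => ¬ 0 < σ (g i)), g i • v i with hy
    have hxy : y = -x := by
      rw [eq_neg_iff_add_eq_zero, add_comm, hx, hy, hP, Finset.sum_filter_add_sum_filter_not, hg]
    have h1 : 0 ≤ σ (polar Q x y) := by
      rw [← polarBilin_apply_apply, hx, hy]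
      simp only [map_sum, LinearMap.sum_apply, map_smul, LinearMap.smul_apply,
        polarBilin_apply_apply, smul_eq_mul, map_mul, Finset.mul_sum]
      refine Finset.sum_nonneg fun i hi => Finset.sum_nonneg fun j hj => ?_
      simp only [hP, Finset.mem_filter, Finset.mem_univ, true_and, not_lt] at hi hj
      have hij := hv j i (by rintro rfl; linarith)
      exact mul_nonneg_of_nonpos_of_nonpos hi (mul_nonpos_of_nonneg_of_nonpos hj.le hij)
    have hx0 : x = 0 := by
      by_contra hne
      have := hpos x hne
      rw [hxy, polar_neg_right, polar_self, two_nsmul, map_neg, map_add] at h1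
      linarith
    have h2 : ∑ i ∈ P, σ (g i) * σ (polar Q (v i) w) = 0 := by
      have : σ (polar Q x w) = 0 := by simp [hx0]
      rw [← this, ← polarBilin_apply_apply, hx]
      simp
    intro i
    by_contra! hi
    have h3 := (Finset.sum_eq_zero_iff_of_nonneg (fun j hj => by
      simp only [hP, Finset.mem_filter, Finset.mem_univ, true_and] at hj
      exact (mul_pos hj (hw j)).le)).1 h2 i (by simp [hP, hi])
    exact (mul_pos hi (hw i)).ne' h3
  rw [Fintype.linearIndependent_iff]
  intro g hg i
  have h1 := key g hg i
  have h2 := key (-g) (by simp [hg]) i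
  simp only [Pi.neg_apply, map_neg] at h2
  exact (map_eq_zero_iff σ hσ).1 (by linarith)

/-- Finite sets of vectors of prescribed norms, stable under the reflections in each other's
elements, contain linearly independent representatives as soon as the norms lie in distinct
square classes. -/
lemma exists_linearIndependent_of_reflection_stable (σ : R →+* ℝ) (hσ : Function.Injective σ)
    (hpos : ∀ v : L, v ≠ 0 → 0 < σ (Q v)) {ι : Type*} [Fintype ι] (Φ : ι → Set L) (ε : ι → R)
    (hfin : ∀ i, (Φ i).Finite) (hnonempty : ∀ i, (Φ i).Nonempty)
    (hQ : ∀ i, ∀ x ∈ Φ i, Q x = ε i) (hε : ∀ i, 0 < σ (ε i))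
    (hneg : ∀ i, ∀ x ∈ Φ i, -x ∈ Φ i)
    (hrefl : ∀ i j, ∀ x ∈ Φ i, ∀ y ∈ Φ j, ∃ c, c * ε i = polar Q x y ∧ y - c • x ∈ Φ j)
    (hne : ∀ i j, i ≠ j → ∀ p : R, p ^ 2 ≠ 4 * ε i * ε j) :
    ∃ v : ι → L, LinearIndependent R v := by
  obtain ⟨w, hw⟩ := exists_forall_polar_ne_zero Q σ hpos (S := ⋃ i, Φ i)
    (Set.finite_iUnion hfin) (by
      rintro x hx rfl
      obtain ⟨i, hi⟩ := Set.mem_iUnion.1 hx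
      have h1 := hε i
      rw [← hQ i 0 hi] at h1
      simp at h1)
  replace hw : ∀ i, ∀ x ∈ Φ i, σ (polar Q x w) ≠ 0 := fun i x hx =>
    hw x (Set.mem_iUnion.2 ⟨i, hx⟩)
  have hmin : ∀ i, ∃ v ∈ {x ∈ Φ i | 0 < σ (polar Q x w)},
      ∀ y ∈ {x ∈ Φ i | 0 < σ (polar Q x w)}, σ (polar Q v w) ≤ σ (polar Q y w) := by
    intro i
    refine Set.exists_min_image _ (fun x => σ (polar Q x w)) ((hfin i).subset (Set.sep_subset _ _)) ?_
    obtain ⟨x, hx⟩ := hnonempty i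
    rcases (hw i x hx).lt_or_gt with h | h
    · exact ⟨-x, hneg i x hx, by simpa using h⟩
    · exact ⟨x, hx, h⟩
  choose v hv hvmin using hmin
  refine ⟨v, linearIndependent_of_polar_nonpos Q σ hσ hpos v w (fun i => (hv i).2) ?_⟩
  have key : ∀ i j, 0 < σ (polar Q (v i) (v j)) →
      2 * σ (polar Q (v j) w) * σ (ε i) ≤ σ (polar Q (v i) (v j)) * σ (polar Q (v i) w) := by
    intro i j hij
    obtain ⟨c, hc, hmem⟩ := hrefl i j (v i) (hv i).1 (v j) (hv j).1
    have hc' : σ c * σ (ε i) = σ (polar Q (v i) (v j)) := by rw [← map_mul, hc]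
    have hcpos : 0 < σ c := pos_of_mul_pos_left (hc' ▸ hij) (hε i).le
    have hval : σ (polar Q (v j - c • v i) w)
        = σ (polar Q (v j) w) - σ c * σ (polar Q (v i) w) := by simp
    have hfi := mul_pos hcpos (hv i).2
    rcases (hw j _ hmem).lt_or_gt with h | h
    · have := hvmin j (-(v j - c • v i)) ⟨hneg j _ hmem, by
        rw [polar_neg_left, map_neg]; linarith⟩
      rw [polar_neg_left, map_neg, hval] at this
      have h2 : 2 * σ (polar Q (v j) w) ≤ σ c * σ (polar Q (v i) w) := by linarith
      calc _ ≤ σ c * σ (polar Q (v i) w) * σ (ε i) := mul_le_mul_of_nonneg_right h2 (hε i).le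
        _ = _ := by rw [← hc']; ring
    · have := hvmin j _ ⟨hmem, h⟩
      linarith
  intro i j hij
  by_contra! hp
  have h1 := key i j hp
  have h2 := key j i (by rwa [polar_comm Q])
  rw [polar_comm Q (v j) (v i)] at h2
  have hcs := polar_sq_le Q σ hpos (v i) (v j)
  rw [hQ i _ (hv i).1, hQ j _ (hv j).1] at hcs
  have hlt : σ (polar Q (v i) (v j)) ^ 2 < 4 * σ (ε i) * σ (ε j) := by
    refine lt_of_le_of_ne hcs fun h => hne i j hij (polar Q (v i) (v j)) (hσ ?_)
    rw [map_pow, h, map_mul, map_mul, map_ofNat]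
  have hfi := (hv i).2
  have hfj := (hv j).2
  have h3 := mul_le_mul h1 h2 (by have := hε j; positivity) (by positivity)
  have h4 := mul_lt_mul_of_pos_right hlt (mul_pos hfi hfj)
  linarith

end Ordered

section Span

variable {R L : Type*} [CommRing R] [AddCommGroup L] [Module R L] (Q : QuadraticMap R L R)
  (A : Subring R) {ι : Type*} (v : ι → L)

lemma polar_mem_subring_of_mem_span (hA : ∀ i j, polar Q (v i) (v j) ∈ A) {x y : L}
    (hx : x ∈ Submodule.span A (Set.range v)) (hy : y ∈ Submodule.span A (Set.range v)) :
    polar Q x y ∈ A := by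
  induction hx using Submodule.span_induction with
  | mem x hx =>
    obtain ⟨i, rfl⟩ := hx
    induction hy using Submodule.span_induction with
    | mem y hy => obtain ⟨j, rfl⟩ := hy; exact hA i j
    | zero => simp
    | add y z _ _ h1 h2 => rw [polar_add_right]; exact add_mem h1 h2
    | smul a y _ h =>
      rw [Subring.smul_def, polar_smul_right]; exact mul_mem a.2 h
  | zero => simp
  | add y z _ _ h1 h2 => rw [polar_add_left]; exact add_mem h1 h2
  | smul a y _ h => rw [Subring.smul_def, polar_smul_left]; exact mul_mem a.2 h

lemma polar_eq_zero_of_mem_span {x y : L} (hx : ∀ i, polar Q x (v i) = 0)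
    (hy : y ∈ Submodule.span A (Set.range v)) : polar Q x y = 0 := by
  induction hy using Submodule.span_induction with
  | mem y hy => obtain ⟨j, rfl⟩ := hy; exact hx j
  | zero => simp
  | add y z _ _ h1 h2 => rw [polar_add_right, h1, h2, add_zero]
  | smul a y _ h => rw [Subring.smul_def, polar_smul_right, h, smul_zero]

end Span

section Northcott

variable {K : Type*} [Field K] [CharZero K] [Algebra.IsAlgebraic ℚ K]
  {L : Type*} [AddCommGroup L] [Module (𝓞 K) L] (Q : QuadraticMap (𝓞 K) L (𝓞 K))

/-- The elements of the ring of integers lying in a given intermediate field. -/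
def integersIn (F : IntermediateField ℚ K) : Subring (𝓞 K) :=
  F.toSubring.comap (algebraMap (𝓞 K) K)

/-- In the span of finitely many vectors with Gram matrix over a number field, a totally positive
definite form takes each value finitely often. -/
lemma finite_setOf_mem_span_eq (hreal : ∀ φ : K →+* ℂ, ComplexEmbedding.IsReal φ)
    (hpos : ∀ σ : K →+* ℝ, ∀ v : L, v ≠ 0 → 0 < σ (Q v : K))
    (F : IntermediateField ℚ K) [FiniteDimensional ℚ F] {ι : Type*} [Finite ι] (v : ι → L)
    (hF : ∀ i j, polar Q (v i) (v j) ∈ integersIn F) (e : 𝓞 K) :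
    {x | x ∈ Submodule.span (integersIn F) (Set.range v) ∧ Q x = e}.Finite := by
  have : NumberField F := ⟨⟩
  have hτ : ∀ φ : F →+* ℂ, ∃ σ : K →+* ℝ, ∀ x : F, ‖φ x‖ = |σ (x : K)| := by
    intro φ
    refine ⟨(hreal (ComplexEmbedding.lift K φ)).embedding, fun x => ?_⟩
    rw [← ComplexEmbedding.lift_algebraMap_apply K φ x, ← Real.norm_eq_abs,
      ← Complex.norm_real, ComplexEmbedding.IsReal.coe_embedding_apply]
    rfl
  choose τ hτ using hτ
  obtain ⟨B, hB⟩ := (Set.finite_range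
    fun q : (F →+* ℂ) × ι => 4 * τ q.1 (e : K) * τ q.1 (Q (v q.2) : K)).bddAbove
  have hfin := Embeddings.finite_of_norm_le F ℂ (Real.sqrt B)
  refine Set.Finite.of_finite_image (f := fun x i => ((polar Q x (v i) : 𝓞 K) : K)) ?_ ?_
  · refine (Set.Finite.pi' fun _ : ι => hfin.image (fun x : F => (x : K))).subset ?_
    rintro _ ⟨x, ⟨hx, rfl⟩, rfl⟩ i
    have hmem : ((polar Q x (v i) : 𝓞 K) : K) ∈ F := polar_mem_subring_of_mem_span Q _ v hF hx
      (Submodule.subset_span (Set.mem_range_self i))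
    refine ⟨⟨_, hmem⟩, ⟨?_, fun φ => ?_⟩, rfl⟩
    · have hi : IsIntegral ℤ ((polar Q x (v i) : 𝓞 K) : K) := (polar Q x (v i)).isIntegral_coe
      exact (isIntegral_algHom_iff (F.val.restrictScalars ℤ) F.val.injective).1 hi
    · rw [hτ]
      refine Real.le_sqrt_of_sq_le ?_
      rw [sq_abs]
      exact (polar_sq_le Q ((τ φ).comp (algebraMap (𝓞 K) K)) (hpos (τ φ)) x (v i)).trans
        (hB ⟨(φ, i), rfl⟩)
  · rintro x ⟨hx, -⟩ y ⟨hy, -⟩ hxy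
    have h0 : ∀ i, polar Q (x - y) (v i) = 0 := fun i => by
      rw [polar_sub_left, sub_eq_zero]
      exact RingOfIntegers.coe_injective (congrFun hxy i)
    have h1 := polar_eq_zero_of_mem_span Q _ v h0 (sub_mem hx hy)
    by_contra hne
    let σ := (hreal (IsAlgClosed.lift (R := ℚ) (S := K) (M := ℂ)).toRingHom).embedding
    have h2 := hpos σ (x - y) (sub_ne_zero.2 hne)
    rw [polar_self] at h1
    have h3 : Q (x - y) = 0 := by simpa using h1
    rw [h3] at h2
    simp at h2

/-- Represented units in distinct square classes are at most as many as the rank. -/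
lemma card_le_finrank_of_represents_units (hreal : ∀ φ : K →+* ℂ, ComplexEmbedding.IsReal φ)
    (hpos : ∀ σ : K →+* ℝ, ∀ v : L, v ≠ 0 → 0 < σ (Q v : K)) [Module.Finite (𝓞 K) L]
    (T : Finset (𝓞 K)) (hunit : ∀ e ∈ T, IsUnit e) (hrep : ∀ e ∈ T, ∃ v, Q v = e)
    (hne : ∀ e ∈ T, ∀ c ∈ T, e ≠ c → ¬ ∃ u, IsUnit u ∧ e = c * u ^ 2) :
    T.card ≤ Module.finrank (𝓞 K) L := by
  choose! w hw using hrep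
  choose! d hd using fun e (he : e ∈ T) => (hunit e he).exists_left_inv
  let v : T → L := fun e => w e
  have hv : ∀ e : T, Q (v e) = e := fun e => hw e e.2
  let S : Set K := Set.range (fun q : T × T => ((polar Q (v q.1) (v q.2) : 𝓞 K) : K)) ∪
    Set.range fun e : T => ((d e : 𝓞 K) : K)
  have hS : S.Finite := (Set.finite_range _).union (Set.finite_range _)
  let F := IntermediateField.adjoin ℚ S
  have : Finite S := hS
  have : FiniteDimensional ℚ F := IntermediateField.finiteDimensional_adjoin
    fun x _ => Algebra.IsIntegral.isIntegral x
  have hF : ∀ i j, polar Q (v i) (v j) ∈ integersIn F := fun i j =>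
    IntermediateField.subset_adjoin ℚ S (Or.inl ⟨(i, j), rfl⟩)
  have hdF : ∀ e : T, d e ∈ integersIn F := fun e =>
    IntermediateField.subset_adjoin ℚ S (Or.inr ⟨e, rfl⟩)
  let σ := (hreal (IsAlgClosed.lift (R := ℚ) (S := K) (M := ℂ)).toRingHom).embedding
  obtain ⟨z, hz⟩ := exists_linearIndependent_of_reflection_stable Q
    (σ.comp (algebraMap (𝓞 K) K))
    (σ.injective.comp RingOfIntegers.coe_injective) (hpos σ)
    (fun e : T => {x | x ∈ Submodule.span (integersIn F) (Set.range v) ∧ Q x = e})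
    (fun e => e) (fun e => finite_setOf_mem_span_eq Q hreal hpos F v hF e)
    (fun e => ⟨v e, Submodule.subset_span (Set.mem_range_self e), hv e⟩)
    (fun e x hx => hx.2)
    (fun e => by
      have h : v e ≠ 0 := fun h => by
        have h1 := hunit e e.2
        rw [← hv e, h] at h1
        simp at h1
      have := hpos σ (v e) h
      rwa [hv] at this)
    (fun e x hx => ⟨neg_mem hx.1, by rw [Q.map_neg]; exact hx.2⟩)
    (fun i j x hx y hy => by
      have hp : polar Q x y ∈ integersIn F := polar_mem_subring_of_mem_span Q _ v hF hx.1 hy.1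
      have hdi := hd i i.2
      refine ⟨polar Q x y * d i, by rw [mul_assoc, hdi, mul_one], ?_, ?_⟩
      · exact sub_mem hy.1 (Submodule.smul_mem _
          (⟨polar Q x y * d i, mul_mem hp (hdF i)⟩ : integersIn F) hx.1)
      · rw [sub_eq_add_neg, ← neg_smul, QuadraticMap.map_add Q, Q.map_smul, polar_smul_right,
          polar_comm Q y x, hx.2, hy.2]
        simp only [smul_eq_mul]
        linear_combination (polar Q x y ^ 2 * d i) * hdi)
    (fun i j hij p hp => by
      have hdj := hd j j.2
      have hdi := hd i i.2
      have h2 : ((p : K) / 2) ^ 2 = (i : 𝓞 K) * (j : 𝓞 K) := by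
        have : (p : K) ^ 2 = 4 * (i : 𝓞 K) * (j : 𝓞 K) := by
          have := congrArg (algebraMap (𝓞 K) K) hp
          rwa [map_pow, map_mul, map_mul, map_ofNat] at this
        rw [div_pow, this]; ring
      have hint : IsIntegral ℤ ((p : K) / 2) := by
        refine IsIntegral.of_pow (n := 2) (by norm_num) ?_
        rw [h2]
        exact (i : 𝓞 K).isIntegral_coe.mul (j : 𝓞 K).isIntegral_coe
      let q : 𝓞 K := ⟨(p : K) / 2, hint⟩
      have hq : q ^ 2 = i * j := by
        apply RingOfIntegers.coe_injective
        rw [map_pow, map_mul]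
        exact h2
      refine hne i i.2 j j.2 (fun h => hij (Subtype.ext h)) ⟨q * d j, ?_, ?_⟩
      · refine IsUnit.mul ?_ (IsUnit.of_mul_eq_one _ hdj)
        have : IsUnit (q ^ 2) := by rw [hq]; exact (hunit i i.2).mul (hunit j j.2)
        exact (isUnit_pow_iff two_ne_zero).1 this
      · linear_combination (-(j : 𝓞 K) * d j ^ 2) * hq - (i * (1 + j * d j) : 𝓞 K) * hdj)
  simpa using hz.fintype_card_le_finrank

end Northcott

end QuadraticMap

/-- A ring homomorphism to `ℂ` sends an element of a subfield of `ℂ` to one of its conjugates. -/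
lemma aeval_minpoly_ringHom_apply (K : Subfield ℂ) (φ : K →+* ℂ) (x : K) :
    aeval (φ x) (minpoly ℚ (x : ℂ)) = 0 := by
  have h : minpoly ℚ (x : ℂ) = minpoly ℚ x :=
    minpoly.algHom_eq (K.subtype.toRatAlgHom) K.subtype.injective x
  rw [h]
  have := congrArg φ.toRatAlgHom (minpoly.aeval ℚ x)
  rwa [← aeval_algHom_apply, map_zero] at this

/-- A positive definite quadratic lattice `(L, Q)` of rank `n ≥ 2` over a totally real field
`K` (i.e. a torsion-free finitely generated module `L` over the ring of integers `𝓞 K`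
together with an `𝓞 K`-valued quadratic map `Q` with `dim_K (K ⊗ L) = n` and `Q v` totally
positive for `v ≠ 0`) represents at most `2n − 2` classes of `𝓞_K^{×,+}/𝓞_K^{×2}`: there are
at most `2n − 2` square classes of totally positive units containing a represented element. -/
theorem stmt_7 (K : Subfield ℂ) (hK : ∀ x : ↥K, IsTotallyRealNum ↑x)
    (L : Type) [AddCommGroup L] [Module (𝓞 ↥K) L] [Module.Finite (𝓞 ↥K) L]
    [NoZeroSMulDivisors (𝓞 ↥K) L]
    (Q : QuadraticMap (𝓞 ↥K) L (𝓞 ↥K))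
    (hpos : ∀ v : L, v ≠ 0 → IsTotallyPositive ((Q v : ↥K) : ℂ))
    (n : ℕ) (hn : 2 ≤ n)
    (hrank : Module.finrank ↥K (TensorProduct (𝓞 ↥K) ↥K L) = n) :
    ∃ T : Finset (𝓞 ↥K), T.card ≤ 2 * n - 2 ∧
      ∀ ε : 𝓞 ↥K, IsUnit ε → IsTotallyPositive ((ε : ↥K) : ℂ) → (∃ v : L, Q v = ε) →
        ∃ c ∈ T, ∃ u : 𝓞 ↥K, IsUnit u ∧ ε = c * u ^ 2 := by
  have hreal : ∀ φ : K →+* ℂ, ComplexEmbedding.IsReal φ := fun φ => by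
    rw [ComplexEmbedding.isReal_iff]
    ext x
    exact Complex.conj_eq_iff_im.2 ((hK x).2 _ (aeval_minpoly_ringHom_apply K φ x))
  have hpos' : ∀ σ : K →+* ℝ, ∀ v : L, v ≠ 0 → 0 < σ (Q v : K) := fun σ v hv =>
    ((hpos v hv).2 _ (aeval_minpoly_ringHom_apply K (Complex.ofRealHom.comp σ) (Q v : K))).1
  have : Algebra.IsAlgebraic ℚ K := ⟨fun x =>
    (isAlgebraic_algHom_iff K.subtype.toRatAlgHom K.subtype.injective).1 (hK x).1⟩
  rw [(TensorProduct.isBaseChange (𝓞 K) L K).finrank_eq] at hrank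
  let P : Finset (𝓞 K) → Prop := fun T => (∀ e ∈ T, IsUnit e) ∧ (∀ e ∈ T, ∃ v, Q v = e) ∧
    ∀ e ∈ T, ∀ c ∈ T, e ≠ c → ¬ ∃ u, IsUnit u ∧ e = c * u ^ 2
  have hcard : ∀ T, P T → T.card ≤ n := fun T hT => hrank ▸
    Q.card_le_finrank_of_represents_units hreal hpos' T hT.1 hT.2.1 hT.2.2
  obtain ⟨T, hT, hmax⟩ : ∃ T, P T ∧ ∀ T', P T' → T'.card ≤ T.card := by
    have hb : BddAbove (Finset.card '' {T | P T}) := ⟨n, by rintro _ ⟨T, hT, rfl⟩; exact hcard T hT⟩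
    have hne : (Finset.card '' {T | P T}).Nonempty := ⟨_, ∅, by simp [P], rfl⟩
    obtain ⟨T, hT, h⟩ := Nat.sSup_mem hne hb
    exact ⟨T, hT, fun T' hT' => h ▸ le_csSup hb ⟨T', hT', rfl⟩⟩
  refine ⟨T, (hcard T hT).trans (by omega), fun ε hε _ hrep => ?_⟩
  classical
  by_contra! hno
  have hεT : ε ∉ T := fun h => hno ε h 1 isUnit_one (by ring)
  refine absurd (hmax (insert ε T) ⟨?_, ?_, ?_⟩) (by simp [Finset.card_insert_of_notMem hεT])
  · simpa [hε] using hT.1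
  · simpa [hrep] using hT.2.1
  · intro e he c hc hec
    rintro ⟨u, hu, h⟩
    rcases Finset.mem_insert.1 he with rfl | heT
    · rcases Finset.mem_insert.1 hc with rfl | hcT
      · exact hec rfl
      · exact hno c hcT u hu h
    · rcases Finset.mem_insert.1 hc with rfl | hcT
      · obtain ⟨d, hd⟩ := hu.exists_left_inv
        exact hno e heT d (IsUnit.of_mul_eq_one _ hd)
          (by linear_combination (-d ^ 2) * h - c * (1 + d * u) * hd)
      · exact hT.2.2 e heT c hcT hec ⟨u, hu, h⟩


end
end

section
/- Let K be a totally real field with γ_K·K^{×2} ∩ O_K^{×,+} = ∅, and let (L, Q) be a positive definite quadratic lattice over K of rank n ≥ 2. Then (L, Q) represents at most n classes of O_K^{×,+}/O_K^{×2}. -/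
open Polynomial NumberField

set_option synthInstance.maxHeartbeats 400000
set_option maxHeartbeats 400000

noncomputable section

namespace TotallyRealLattice

/-! ### Embeddings of totally real fields -/

section Embeddings

variable {K : Subfield ℂ}

lemma algebra_isAlgebraic (hK : ∀ x : K, IsTotallyRealNum (x : ℂ)) : Algebra.IsAlgebraic ℚ K :=
  ⟨fun x => (isAlgebraic_algebraMap_iff (A := ℂ) (R := ℚ) (S := K)
    (algebraMap K ℂ).injective).1 (hK x).1⟩

lemma minpoly_coe (x : K) : minpoly ℚ (x : ℂ) = minpoly ℚ x :=
  minpoly.algebraMap_eq (A := ℚ) (B := K) (B' := ℂ) (algebraMap K ℂ).injective x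

lemma aeval_minpoly_ringHom {E : Type*} [Field E] [Algebra ℚ E] (φ : E →+* ℂ) (e : E) :
    aeval (φ e) (minpoly ℚ e) = 0 := by
  have h := Polynomial.aeval_algHom_apply φ.toRatAlgHom e (minpoly ℚ e)
  rw [minpoly.aeval, map_zero] at h
  exact h

/-- A complex embedding of a totally real field factors through the real numbers. -/
lemma exists_real_ringHom (hK : ∀ x : K, IsTotallyRealNum (x : ℂ)) (σ : K →+* ℂ) :
    ∃ ρ : K →+* ℝ, ∀ x, ((ρ x : ℝ) : ℂ) = σ x := by
  have him : ∀ x, (σ x).im = 0 := fun x => (hK x).2 _ (by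
    rw [minpoly_coe]; exact aeval_minpoly_ringHom σ x)
  refine ⟨{ toFun := fun x => (σ x).re, map_one' := by simp, map_mul' := fun x y => ?_,
            map_zero' := by simp, map_add' := fun x y => by simp }, fun x => ?_⟩
  · simp [him]
  · apply Complex.ext <;> simp [him]

lemma exists_real_ringHom_of_aeval (hK : ∀ x : K, IsTotallyRealNum (x : ℂ)) (x : K) (w : ℂ)
    (hw : aeval w (minpoly ℚ (x : ℂ)) = 0) : ∃ ρ : K →+* ℝ, ((ρ x : ℝ) : ℂ) = w := by
  have := algebra_isAlgebraic hK
  have hmem : w ∈ (minpoly ℚ x).rootSet ℂ := by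
    rw [mem_rootSet_of_ne (minpoly.ne_zero (Algebra.IsIntegral.isIntegral x)), ← minpoly_coe]
    exact hw
  rw [← Algebra.IsAlgebraic.range_eval_eq_rootSet_minpoly] at hmem
  obtain ⟨σ, hσ⟩ := hmem
  obtain ⟨ρ, hρ⟩ := exists_real_ringHom hK σ.toRingHom
  exact ⟨ρ, (hρ x).trans hσ⟩

/-- If `x ∈ K` also lies in a field `E`, every embedding of `E` acts on `x` like a real embedding
of `K`. -/
lemma exists_real_ringHom_eq (hK : ∀ x : K, IsTotallyRealNum (x : ℂ))
    {E : Type*} [Field E] [Algebra ℚ E] (φ₀ : E →+* ℂ) (x : K) (e : E) (he : φ₀ e = x)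
    (φ : E →+* ℂ) : ∃ ρ : K →+* ℝ, ((ρ x : ℝ) : ℂ) = φ e := by
  refine exists_real_ringHom_of_aeval hK x _ ?_
  have : minpoly ℚ (φ₀ e) = minpoly ℚ e := minpoly.algHom_eq φ₀.toRatAlgHom φ₀.injective e
  rw [← he, this]
  exact aeval_minpoly_ringHom φ e

lemma ringHom_pos_of_isTotallyPositive {x : K} (hx : IsTotallyPositive (x : ℂ)) (ρ : K →+* ℝ) :
    0 < ρ x := by
  have := (hx.2 (((algebraMap ℝ ℂ).comp ρ) x) (by
    rw [minpoly_coe]; exact aeval_minpoly_ringHom _ x)).1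
  simpa using this

lemma isTotallyPositive_of_ringHom_pos (hK : ∀ x : K, IsTotallyRealNum (x : ℂ)) {x : K}
    (hx : ∀ ρ : K →+* ℝ, 0 < ρ x) : IsTotallyPositive (x : ℂ) := by
  refine ⟨(hK x).1, fun w hw => ?_⟩
  obtain ⟨ρ, rfl⟩ := exists_real_ringHom_of_aeval hK x w hw
  simpa using hx ρ

end Embeddings

/-! ### Integers all of whose conjugates lie in `[-2, 2]` -/

lemma norm_eq_one_of_add_inv {w : ℂ} (hw : w ≠ 0) {t : ℝ} (ht : |t| ≤ 2)
    (h : (t : ℂ) = w + w⁻¹) : ‖w‖ = 1 := by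
  have hq : w ^ 2 - t * w + 1 = 0 := by rw [h]; field_simp; ring
  have hre := congrArg Complex.re hq
  have him := congrArg Complex.im hq
  simp [pow_two] at hre him
  have hs : w.re * w.re + w.im * w.im = 1 := by
    obtain ⟨h1, h2⟩ := abs_le.1 ht
    have : w.im * (2 * w.re - t) = 0 := by linarith
    rcases mul_eq_zero.1 this with h0 | h0
    · rw [h0] at hre ⊢
      have ht2 : t ^ 2 ≤ 4 := by nlinarith
      have : (w.re - t / 2) ^ 2 = t ^ 2 / 4 - 1 := by nlinarith
      have h3 : (w.re - t / 2) ^ 2 = 0 := by nlinarith [sq_nonneg (w.re - t / 2)]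
      have h4 : w.re = t / 2 := by
        have := pow_eq_zero_iff (two_ne_zero) |>.1 h3
        linarith
      rw [h4]; nlinarith
    · nlinarith
  have : ‖w‖ ^ 2 = 1 := by
    rw [← Complex.normSq_eq_norm_sq, Complex.normSq_apply, hs]
  nlinarith [norm_nonneg w]

/-- A totally real algebraic integer with all conjugates in `[-2, 2]` is the sum of a root of unity
and its inverse. -/
lemma exists_root_of_unity_add_inv {K : Subfield ℂ} (hK : ∀ x : K, IsTotallyRealNum (x : ℂ))
    (β : K) (hβ : IsIntegral ℤ β) (hb : ∀ ρ : K →+* ℝ, |ρ β| ≤ 2) :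
    ∃ (y : ℂ) (n : ℕ), 0 < n ∧ y ^ n = 1 ∧ (β : ℂ) = y + y⁻¹ := by
  obtain ⟨y, hy⟩ : ∃ y : ℂ, y ^ 2 - β * y + 1 = 0 := by
    have hd : (X ^ 2 - C (β : ℂ) * X + C 1 : ℂ[X]).degree = 2 := by
      compute_degree!
    obtain ⟨y, hy⟩ := IsAlgClosed.exists_root (X ^ 2 - C (β : ℂ) * X + C 1 : ℂ[X])
      (by rw [hd]; decide)
    exact ⟨y, by simpa [IsRoot] using hy⟩
  have hy0 : y ≠ 0 := by rintro rfl; simp at hy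
  have hβy : (β : ℂ) = y + y⁻¹ := by field_simp; linear_combination -hy
  have hβint : IsIntegral ℤ (β : ℂ) := hβ.map (algebraMap K ℂ).toIntAlgHom
  have hyint : IsIntegral ℤ y := by
    have hβ' : IsIntegral (integralClosure ℤ ℂ) y := by
      refine ⟨X ^ 2 - C ⟨β, hβint⟩ * X + C 1, by monicity!, ?_⟩
      rw [← hy]
      simp [eval₂_sub, eval₂_add, eval₂_mul, eval₂_pow]
    exact isIntegral_trans _ hβ'
  let E := IntermediateField.adjoin ℚ {y}
  have : FiniteDimensional ℚ E :=
    IntermediateField.adjoin.finiteDimensional (hyint.tower_top)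
  have : NumberField E := { to_charZero := inferInstance, to_finiteDimensional := this }
  let y' : E := ⟨y, IntermediateField.mem_adjoin_simple_self ℚ y⟩
  have hy'0 : y' ≠ 0 := fun h => hy0 (congrArg Subtype.val h)
  have hy'int : IsIntegral ℤ y' :=
    (isIntegral_algHom_iff (algebraMap E ℂ).toIntAlgHom (algebraMap E ℂ).injective).1 hyint
  obtain ⟨n, hn, h1⟩ := NumberField.Embeddings.pow_eq_one_of_norm_eq_one E ℂ hy'int (by
    intro φ
    obtain ⟨ρ, hρ⟩ := exists_real_ringHom_eq hK (algebraMap E ℂ) β (y' + y'⁻¹)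
      (by simpa using hβy.symm) φ
    refine norm_eq_one_of_add_inv ((map_ne_zero φ).2 hy'0) (hb ρ) ?_
    rw [hρ, map_add, map_inv₀])
  exact ⟨y, n, hn, by simpa using congrArg Subtype.val h1, hβy⟩

/-! ### Square classes of totally real cyclotomic integers -/

section SquareClasses

variable {K : Subfield ℂ}

lemma pow_add_inv_mem {y : ℂ} (hy : y ≠ 0) (h : y + y⁻¹ ∈ K) (m : ℕ) :
    y ^ m + (y ^ m)⁻¹ ∈ K := by
  induction m using Nat.strong_induction_on with
  | _ m ih =>
    match m with
    | 0 => simpa using K.add_mem K.one_mem K.one_mem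
    | 1 => simpa using h
    | m + 2 =>
      have e : y ^ (m + 2) + (y ^ (m + 2))⁻¹ =
          (y + y⁻¹) * (y ^ (m + 1) + (y ^ (m + 1))⁻¹) - (y ^ m + (y ^ m)⁻¹) := by
        field_simp
        ring
      rw [e]
      exact K.sub_mem (K.mul_mem h (ih (m + 1) (by omega))) (ih m (by omega))

lemma g_sq (a : ℚ) : g a ^ 2 = 2 + g (2 * a) := by
  have h1 : (2 * Real.pi * Complex.I * ((2 * a : ℚ) : ℂ)) =
      2 * Real.pi * Complex.I * (a : ℂ) + 2 * Real.pi * Complex.I * (a : ℂ) := by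
    push_cast; ring
  unfold g
  rw [h1, neg_add, Complex.exp_add, Complex.exp_add, Complex.exp_neg]
  have := Complex.exp_ne_zero (2 * Real.pi * Complex.I * (a : ℂ))
  field_simp
  ring

lemma g_one_div_two_pow_mem {m j : ℕ} (h : g (1 / 2 ^ m) ∈ K) (hj : j ≤ m) :
    g (1 / 2 ^ j) ∈ K := by
  induction m, hj using Nat.le_induction with
  | base => exact h
  | succ m hm ih =>
    refine ih ?_
    have e := g_sq (1 / 2 ^ (m + 1))
    rw [show (2 * (1 / 2 ^ (m + 1)) : ℚ) = 1 / 2 ^ m by field_simp; ring] at e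
    rw [← sub_eq_iff_eq_add'.2 e]
    exact K.sub_mem (K.pow_mem h 2) (ofNat_mem K 2)

lemma le_of_g_sq_mem {m m' : ℕ} (h : g (1 / 2 ^ m) ^ 2 ∈ K) (h' : g (1 / 2 ^ m') ∉ K) :
    m ≤ m' := by
  by_contra! hlt
  obtain ⟨k, rfl⟩ : ∃ k, m = k + 1 := ⟨m - 1, by omega⟩
  refine h' (g_one_div_two_pow_mem (m := k) ?_ (by omega))
  have e := g_sq (1 / 2 ^ (k + 1))
  rw [show (2 * (1 / 2 ^ (k + 1)) : ℚ) = 1 / 2 ^ k by field_simp; ring] at e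
  rw [← sub_eq_iff_eq_add'.2 e]
  exact K.sub_mem h (ofNat_mem K 2)

lemma gammaK_eq {m : ℕ} (hm : 0 < m) (h : g (1 / 2 ^ m) ^ 2 ∈ K) (h' : g (1 / 2 ^ m) ∉ K) :
    gammaK K = g (1 / 2 ^ m) ^ 2 := by
  have hex : ∃ m : ℕ, 0 < m ∧ g (1 / 2 ^ m) ^ 2 ∈ K ∧ g (1 / 2 ^ m) ∉ K := ⟨m, hm, h, h'⟩
  unfold gammaK
  rw [dif_pos hex]
  have hs := hex.choose_spec
  rw [le_antisymm (le_of_g_sq_mem hs.2.1 h') (le_of_g_sq_mem h hs.2.2)]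

/-- The square class in `K` of `2 + y + y⁻¹` for a root of unity `y`: it is trivial, or the class
of `γ_K`, unless `-y` has odd order. -/
lemma square_class_two_add {y : ℂ} {n : ℕ} (hn : 0 < n) (hyn : y ^ n = 1) (hy : y + y⁻¹ ∈ K)
    (hne : 2 + (y + y⁻¹) ≠ 0) :
    (∃ x ∈ K, 2 + (y + y⁻¹) = x ^ 2) ∨ (∃ x ∈ K, 2 + (y + y⁻¹) = gammaK K * x ^ 2) ∨
      ∃ N, Odd N ∧ (-y) ^ N = 1 := by
  have hy0 : y ≠ 0 := by rintro rfl; simp [hn.ne'] at hyn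
  have ho : 0 < orderOf y := orderOf_pos_iff.2 (isOfFinOrder_iff_pow_eq_one.2 ⟨n, hn, hyn⟩)
  obtain ⟨j, M, hM, hjM⟩ := Nat.exists_eq_two_pow_mul_odd ho.ne'
  have hprim := IsPrimitiveRoot.orderOf y
  have hM0 : 0 < M := hM.pos
  match j, hjM with
  | 0, hjM =>
    left
    obtain ⟨r, hr⟩ := hM
    refine ⟨_, pow_add_inv_mem hy0 hy (r + 1), ?_⟩
    have h1 : (y ^ (r + 1)) ^ 2 = y := by
      rw [← pow_mul, show (r + 1) * 2 = orderOf y + 1 by rw [hjM, hr]; ring, pow_succ,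
        pow_orderOf_eq_one, one_mul]
    have h2 : y ^ (r + 1) ≠ 0 := pow_ne_zero _ hy0
    conv_lhs => rw [← h1]
    field_simp
    ring
  | 1, hjM =>
    right; right
    refine ⟨M, hM, ?_⟩
    have h1 : y ^ M ≠ 1 := hprim.pow_ne_one_of_pos_of_lt hM0.ne' (by omega)
    have h2 : (y ^ M) ^ 2 = 1 := by
      rw [← pow_mul, show M * 2 = orderOf y by rw [hjM]; ring, pow_orderOf_eq_one]
    rw [hM.neg_pow, (sq_eq_one_iff.1 h2).resolve_left h1, neg_neg]
  | k + 2, hjM =>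
    set e : ℂ := Complex.exp (2 * Real.pi * Complex.I / (2 ^ (k + 2) : ℕ)) with he
    have hep : IsPrimitiveRoot e (2 ^ (k + 2)) :=
      Complex.isPrimitiveRoot_exp _ (by positivity)
    have hyM : IsPrimitiveRoot (y ^ M) (2 ^ (k + 2)) :=
      hprim.pow ho (by rw [hjM]; ring)
    obtain ⟨i, -, hi⟩ := hyM.eq_pow_of_pow_eq_one hep.pow_eq_one
    have hiodd : Odd i := by
      by_contra hcon
      obtain ⟨i', rfl⟩ := Nat.not_odd_iff_even.1 hcon
      refine hep.pow_ne_one_of_pos_of_lt (l := 2 ^ (k + 1)) (by positivity)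
        (Nat.pow_lt_pow_right (by norm_num) (by omega)) ?_
      rw [← hi, ← pow_mul, show (i' + i') * 2 ^ (k + 1) = 2 ^ (k + 2) * i' by ring, pow_mul,
        hyM.pow_eq_one, one_pow]
    obtain ⟨r, hr⟩ := hM.mul hiodd
    have hes : e = y * (y ^ r) ^ 2 := by
      rw [← hi, ← pow_mul, hr, ← pow_mul]; ring
    set h := g (1 / 2 ^ (k + 3)) with hh
    have hsq : h ^ 2 = 2 + (e + e⁻¹) := by
      rw [hh, g_sq, he, ← Complex.exp_neg]
      unfold g
      have : (2 * Real.pi * Complex.I * ((2 * (1 / 2 ^ (k + 3)) : ℚ) : ℂ)) =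
          2 * Real.pi * Complex.I / (2 ^ (k + 2) : ℕ) := by
        push_cast; field_simp; ring
      rw [this]
    have he0 : e ≠ 0 := Complex.exp_ne_zero _
    have hh0 : h ≠ 0 := by
      intro h0
      have : e = -1 := by
        have h3 : (e + 1) ^ 2 = 0 := by
          rw [h0] at hsq
          field_simp at hsq
          linear_combination -hsq
        have := pow_eq_zero_iff (two_ne_zero) |>.1 h3
        linear_combination this
      refine hep.pow_ne_one_of_pos_of_lt (l := 2) (by norm_num) ?_ (by rw [this]; norm_num)
      calc 2 = 2 ^ 1 := by norm_num
        _ < 2 ^ (k + 2) := Nat.pow_lt_pow_right (by norm_num) (by omega)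
    set x := (y ^ (r + 1) + (y ^ (r + 1))⁻¹) + (y ^ r + (y ^ r)⁻¹) with hx
    have hxK : x ∈ K := K.add_mem (pow_add_inv_mem hy0 hy _) (pow_add_inv_mem hy0 hy _)
    have hxx : x ^ 2 = (2 + (y + y⁻¹)) * h ^ 2 := by
      have hw : y ^ r ≠ 0 := pow_ne_zero _ hy0
      rw [hsq, hes, hx, pow_succ y r]
      generalize y ^ r = w at hw ⊢
      field_simp
      ring
    have heK : h ^ 2 ∈ K := by
      have : h ^ 2 = x ^ 2 / (2 + (y + y⁻¹)) := by rw [hxx, mul_div_cancel_left₀ _ hne]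
      rw [this]
      exact K.div_mem (K.pow_mem hxK 2) (K.add_mem (ofNat_mem K 2) hy)
    by_cases hhK : h ∈ K
    · left
      exact ⟨x / h, K.div_mem hxK hhK, by rw [div_pow, hxx]; field_simp⟩
    · right; left
      refine ⟨x / h ^ 2, K.div_mem hxK heK, ?_⟩
      rw [gammaK_eq (by omega) heK hhK, div_pow, hxx, ← hh]
      field_simp

end SquareClasses

/-! ### Positivity of ternary Gram determinants -/

section Cyclotomic

lemma isIntegral_inv_of_pow_eq_one {E : Type*} [Field E] {w : E} {N : ℕ} (hN : 0 < N)
    (hw : w ^ N = 1) : IsIntegral ℤ w ∧ IsIntegral ℤ w⁻¹ := by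
  have h : ∀ v : E, v ^ N = 1 → IsIntegral ℤ v := fun v hv =>
    IsIntegral.of_pow hN (by rw [hv]; exact isIntegral_one)
  exact ⟨h w hw, h _ (by rw [inv_pow, hw, inv_one])⟩

/-- If `w ≠ 1` is a root of unity of odd order, then `1 + w` is a unit. -/
lemma isIntegral_one_add_inv {E : Type*} [Field E] {w : E} {N : ℕ} (hN : Odd N) (hw : w ^ N = 1)
    (hw1 : w ≠ 1) : 1 + w ≠ 0 ∧ IsIntegral ℤ (1 + w)⁻¹ := by
  obtain ⟨r, rfl⟩ := hN
  have h1 : (1 + w) * ∑ k ∈ Finset.range (r + 1), (w ^ 2) ^ k = 1 := by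
    have h2 : (w ^ 2 - 1) * ∑ k ∈ Finset.range (r + 1), (w ^ 2) ^ k = w - 1 := by
      rw [mul_geom_sum, ← pow_mul, show 2 * (r + 1) = 2 * r + 1 + 1 by ring, pow_succ, hw, one_mul]
    apply mul_left_cancel₀ (sub_ne_zero.2 hw1)
    linear_combination h2
  refine ⟨left_ne_zero_of_mul_eq_one h1, ?_⟩
  rw [inv_eq_of_mul_eq_one_right h1]
  exact IsIntegral.sum _ fun k _ =>
    (((isIntegral_inv_of_pow_eq_one (by omega) hw).1.pow 2).pow k)

/-- Over the field of `4N`-th roots of unity, `N` odd, every complex embedding can be modified to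
change the sign of the fourth root of unity `ζ ^ N` and to agree on `N`-th roots of unity. -/
lemma exists_ringHom_neg {E : Type*} [Field E] [NumberField E] {N : ℕ} (hN : Odd N)
    [NeZero (4 * N)] [IsCyclotomicExtension {4 * N} ℚ E] {ζ : E} (hζ : IsPrimitiveRoot ζ (4 * N))
    (φ : E →+* ℂ) :
    ∃ φ' : E →+* ℂ, φ' (ζ ^ N) = -φ (ζ ^ N) ∧ ∀ W : E, W ^ N = 1 → φ' W = φ W := by
  have hN0 : 0 < N := hN.pos
  have : NeZero N := ⟨hN0.ne'⟩
  have hirr : Irreducible (cyclotomic (4 * N) ℚ) := cyclotomic.irreducible_rat (by omega)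
  have hφ : IsPrimitiveRoot (φ ζ) (4 * N) := hζ.map_of_injective φ.injective
  have hneg : IsPrimitiveRoot (-φ ζ) (4 * N) := by
    have h2N : IsPrimitiveRoot (φ ζ ^ (2 * N)) 2 := hφ.pow (by omega) (by ring)
    have hm1 : φ ζ ^ (2 * N) = -1 := h2N.eq_neg_one_of_two_right
    have : -φ ζ = φ ζ ^ (2 * N + 1) := by rw [pow_succ, hm1]; ring
    rw [this]
    refine hφ.pow_of_coprime _ ?_
    have h2 : Nat.Coprime (2 * N + 1) 2 := by simp
    have hN' : Nat.Coprime (2 * N + 1) N := by simp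
    simpa using (h2.mul_right h2).mul_right hN'
  let φ' : E →ₐ[ℚ] ℂ := (hζ.embeddingsEquivPrimitiveRoots ℂ hirr).symm
    ⟨-φ ζ, (mem_primitiveRoots (by omega)).2 hneg⟩
  have hφ' : φ' ζ = -φ ζ := by
    rw [← hζ.embeddingsEquivPrimitiveRoots_apply_coe ℂ hirr φ', Equiv.apply_symm_apply]
  refine ⟨φ'.toRingHom, ?_, fun W hW => ?_⟩
  · change φ' (ζ ^ N) = _
    rw [map_pow, hφ', hN.neg_pow, map_pow]
  · have hζ4 : IsPrimitiveRoot (ζ ^ 4) N := hζ.pow (by omega) rfl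
    obtain ⟨m, -, rfl⟩ := hζ4.eq_pow_of_pow_eq_one hW
    change φ' ((ζ ^ 4) ^ m) = _
    rw [map_pow, map_pow, hφ', map_pow, map_pow, Even.neg_pow (by decide)]

/-- Let `αᵢ = 2 - Wᵢ - Wᵢ⁻¹` with `Wᵢ` of odd order. If all conjugates of `4 - α₁ - α₂ - α₃` are
nonnegative, then `α₁` or `α₂` vanishes. -/
lemma eq_one_of_re_nonneg {E : Type*} [Field E] [NumberField E] {N : ℕ} (hN : Odd N)
    {W₁ W₂ W₃ : E} (h₁ : W₁ ^ N = 1) (h₂ : W₂ ^ N = 1) (h₃ : W₃ ^ N = 1)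
    (hA : ∀ φ : E →+* ℂ,
      0 ≤ (φ (4 - (2 - W₁ - W₁⁻¹) - (2 - W₂ - W₂⁻¹) - (2 - W₃ - W₃⁻¹))).re) :
    W₁ = 1 ∨ W₂ = 1 := by
  by_contra! hne
  obtain ⟨hW₁1, hW₂1⟩ := hne
  have hN0 : 0 < N := hN.pos
  obtain ⟨φ₀⟩ : Nonempty (E →+* ℂ) := inferInstance
  have hW₁0 : W₁ ≠ 0 := by rintro rfl; simp [hN0.ne'] at h₁
  have hW₂0 : W₂ ≠ 0 := by rintro rfl; simp [hN0.ne'] at h₂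
  have hre : ∀ (φ : E →+* ℂ) (W : E), W ^ N = 1 →
      φ (2 - W - W⁻¹) = ((2 - 2 * (φ W).re : ℝ) : ℂ) ∧ |(φ W).re| ≤ 1 := fun φ W hW => by
    have hn : ‖φ W‖ = 1 := by
      refine Complex.norm_eq_one_of_pow_eq_one (n := N) ?_ hN0.ne'
      rw [← map_pow, hW, map_one]
    refine ⟨?_, hn ▸ Complex.abs_re_le_norm _⟩
    simp only [map_sub, map_inv₀, map_ofNat]
    rw [Complex.inv_eq_conj hn, sub_sub, Complex.add_conj]
    push_cast; ring
  obtain ⟨hu0, hu⟩ := isIntegral_one_add_inv hN h₁ hW₁1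
  have hden : 4 - (2 - W₁ - W₁⁻¹) = (1 + W₁) * (1 + W₁) * W₁⁻¹ := by
    field_simp
    ring
  have hden0 : 4 - (2 - W₁ - W₁⁻¹) ≠ 0 := by
    rw [hden]
    exact mul_ne_zero (mul_ne_zero hu0 hu0) (inv_ne_zero hW₁0)
  set R := (2 - W₂ - W₂⁻¹) / (4 - (2 - W₁ - W₁⁻¹)) with hR
  have hnum0 : 2 - W₂ - W₂⁻¹ ≠ 0 := by
    have : 2 - W₂ - W₂⁻¹ = -(W₂ - 1) ^ 2 * W₂⁻¹ := by field_simp; ring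
    rw [this]
    exact mul_ne_zero (neg_ne_zero.2 (pow_ne_zero _ (sub_ne_zero.2 hW₂1))) (inv_ne_zero hW₂0)
  have hRint : IsIntegral ℤ R := by
    have h2 : IsIntegral ℤ (2 : E) := by
      rw [← one_add_one_eq_two]
      exact isIntegral_one.add isIntegral_one
    have e : R = (2 - W₂ - W₂⁻¹) * ((1 + W₁)⁻¹ * (1 + W₁)⁻¹ * W₁) := by
      rw [hR, hden]; field_simp
    rw [e]
    have i₂ := isIntegral_inv_of_pow_eq_one hN0 h₂
    exact ((h2.sub i₂.1).sub i₂.2).mul ((hu.mul hu).mul (isIntegral_inv_of_pow_eq_one hN0 h₁).1)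
  have hRφ : ∀ φ : E →+* ℂ,
      φ R = (((2 - 2 * (φ W₂).re) / (2 + 2 * (φ W₁).re) : ℝ) : ℂ) := fun φ => by
    rw [hR, map_div₀, map_sub φ 4, (hre φ _ h₁).1, (hre φ _ h₂).1, map_ofNat]
    push_cast; congr 1; ring
  have hle : ∀ φ : E →+* ℂ, 0 ≤ (2 - 2 * (φ W₂).re) / (2 + 2 * (φ W₁).re) ∧
      (2 - 2 * (φ W₂).re) / (2 + 2 * (φ W₁).re) ≤ 1 := fun φ => by
    have a₁ := abs_le.1 (hre φ _ h₁).2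
    have a₂ := abs_le.1 (hre φ _ h₂).2
    have a₃ := abs_le.1 (hre φ _ h₃).2
    have hA := hA φ
    rw [map_sub, map_sub, map_sub, (hre φ _ h₁).1, (hre φ _ h₂).1,
      (hre φ _ h₃).1, map_ofNat] at hA
    simp only [Complex.sub_re, Complex.ofReal_re, Complex.re_ofNat] at hA
    refine ⟨div_nonneg (by linarith) (by linarith), div_le_one_of_le₀ (by linarith) (by linarith)⟩
  obtain ⟨k, hk, hRk⟩ := NumberField.Embeddings.pow_eq_one_of_norm_le_one E ℂ
    (div_ne_zero hnum0 hden0) hRint (fun φ => by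
      rw [hRφ, Complex.norm_real, Real.norm_of_nonneg (hle φ).1]
      exact (hle φ).2)
  have hR1 : R = 1 := by
    apply φ₀.injective
    have h := congrArg φ₀ hRk
    rw [map_pow, map_one, hRφ] at h
    rw [map_one, hRφ]
    have h' : ((2 - 2 * (φ₀ W₂).re) / (2 + 2 * (φ₀ W₁).re)) ^ k = 1 := by exact_mod_cast h
    rw [(pow_eq_one_iff_of_nonneg (hle φ₀).1 hk.ne').1 h', Complex.ofReal_one]
  rw [hR, div_eq_one_iff_eq hden0] at hR1
  have hfac : (W₁ + W₂) * (W₁ * W₂ + 1) = 0 := by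
    field_simp at hR1
    linear_combination -hR1
  have h2 : (2 : E) ≠ 0 := two_ne_zero
  apply h2
  rcases mul_eq_zero.1 hfac with h | h
  · have := congrArg (· ^ N) (eq_neg_of_add_eq_zero_left h)
    simp only [hN.neg_pow, h₁, h₂] at this
    linear_combination this
  · have := congrArg (· ^ N) (eq_neg_of_add_eq_zero_left h)
    simp only [hN.neg_pow, mul_pow, h₁, h₂] at this
    linear_combination this

variable {K : Subfield ℂ}

lemma eq_one_of_gram_nonneg_aux (hK : ∀ x : K, IsTotallyRealNum (x : ℂ)) {E : Type*} [Field E]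
    [NumberField E] {N : ℕ} (hN : Odd N) [NeZero (4 * N)] [IsCyclotomicExtension {4 * N} ℚ E]
    {ζ : E} (hζ : IsPrimitiveRoot ζ (4 * N))
    {ω₁ ω₂ ω₃ p : ℂ} (h₁ : ω₁ ^ N = 1) (h₂ : ω₂ ^ N = 1) (h₃ : ω₃ ^ N = 1)
    (hp : p ^ 2 = (2 - ω₁ - ω₁⁻¹) * (2 - ω₂ - ω₂⁻¹) * (2 - ω₃ - ω₃⁻¹)) (δ : K)
    (hδ : (δ : ℂ) = 4 + p - (2 - ω₁ - ω₁⁻¹) - (2 - ω₂ - ω₂⁻¹) - (2 - ω₃ - ω₃⁻¹))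
    (hpos : ∀ ρ : K →+* ℝ, 0 ≤ ρ δ) : ω₁ = 1 ∨ ω₂ = 1 := by
  have hN0 : 0 < N := hN.pos
  have : NeZero N := ⟨hN0.ne'⟩
  obtain ⟨φ₀⟩ : Nonempty (E →+* ℂ) := inferInstance
  have hz4 : IsPrimitiveRoot (φ₀ (ζ ^ 4)) N :=
    (hζ.pow (by omega) rfl : IsPrimitiveRoot (ζ ^ 4) N).map_of_injective φ₀.injective
  have lift : ∀ ω : ℂ, ω ^ N = 1 → ∃ W : E, W ^ N = 1 ∧ φ₀ W = ω := fun ω hω => by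
    obtain ⟨m, -, hm⟩ := hz4.eq_pow_of_pow_eq_one hω
    have h : φ₀ ((ζ ^ 4) ^ m) = ω := by rw [map_pow, hm]
    exact ⟨_, φ₀.injective (by rw [map_pow, h, hω, map_one]), h⟩
  obtain ⟨W₁, hW₁, rfl⟩ := lift _ h₁
  obtain ⟨W₂, hW₂, rfl⟩ := lift _ h₂
  obtain ⟨W₃, hW₃, rfl⟩ := lift _ h₃
  obtain ⟨r, hr⟩ := id hN
  have hJ : (ζ ^ N) ^ 2 = -1 := by
    rw [← pow_mul]
    exact (hζ.pow (by omega) (by ring) : IsPrimitiveRoot (ζ ^ (N * 2)) 2).eq_neg_one_of_two_right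
  have aux : ∀ W : E, W ^ N = 1 →
      (W ^ (r + 1) - (W ^ (r + 1))⁻¹) ^ 2 = -(2 - W - W⁻¹) := fun W hW => by
    have hW0 : W ≠ 0 := by rintro rfl; simp [hN0.ne'] at hW
    have hU : (W ^ (r + 1)) ^ 2 = W := by
      rw [← pow_mul, show (r + 1) * 2 = N + 1 by rw [hr]; ring, pow_succ, hW, one_mul]
    rw [sub_sq, inv_pow, hU, mul_assoc, mul_inv_cancel₀ (pow_ne_zero _ hW0)]
    ring
  obtain ⟨P, hP⟩ : ∃ P, P = ζ ^ N * ((W₁ ^ (r + 1) - (W₁ ^ (r + 1))⁻¹) *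
    (W₂ ^ (r + 1) - (W₂ ^ (r + 1))⁻¹) * (W₃ ^ (r + 1) - (W₃ ^ (r + 1))⁻¹)) := ⟨_, rfl⟩
  have hPsq : P ^ 2 = (2 - W₁ - W₁⁻¹) * (2 - W₂ - W₂⁻¹) * (2 - W₃ - W₃⁻¹) := by
    rw [hP, mul_pow, mul_pow, mul_pow, hJ, aux _ hW₁, aux _ hW₂, aux _ hW₃]
    ring
  obtain ⟨s, hs, hsp⟩ : ∃ s : E, (s = 1 ∨ s = -1) ∧ φ₀ (s * P) = p := by
    have : p ^ 2 = (φ₀ P) ^ 2 := by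
      rw [hp, ← map_pow, hPsq]
      simp only [map_mul, map_sub, map_inv₀, map_ofNat]
    rcases sq_eq_sq_iff_eq_or_eq_neg.1 this with h | h
    · exact ⟨1, Or.inl rfl, by rw [one_mul, h]⟩
    · exact ⟨-1, Or.inr rfl, by rw [neg_one_mul, map_neg, h]⟩
  have hD : ∀ φ : E →+* ℂ,
      0 ≤ (φ (4 - (2 - W₁ - W₁⁻¹) - (2 - W₂ - W₂⁻¹) - (2 - W₃ - W₃⁻¹) + s * P)).re := fun φ => by
    obtain ⟨ρ, hρ⟩ := exists_real_ringHom_eq hK φ₀ δ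
      (4 - (2 - W₁ - W₁⁻¹) - (2 - W₂ - W₂⁻¹) - (2 - W₃ - W₃⁻¹) + s * P) (by
        rw [hδ, map_add, hsp]
        simp only [map_sub, map_inv₀, map_ofNat]
        ring) φ
    rw [← hρ, Complex.ofReal_re]
    exact hpos ρ
  refine (eq_one_of_re_nonneg hN hW₁ hW₂ hW₃ fun φ => ?_).imp (fun h => by rw [h, map_one])
    (fun h => by rw [h, map_one])
  obtain ⟨φ', hφ', hW⟩ := exists_ringHom_neg hN hζ φ
  have hA' : φ' (4 - (2 - W₁ - W₁⁻¹) - (2 - W₂ - W₂⁻¹) - (2 - W₃ - W₃⁻¹)) =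
      φ (4 - (2 - W₁ - W₁⁻¹) - (2 - W₂ - W₂⁻¹) - (2 - W₃ - W₃⁻¹)) := by
    simp only [map_sub, map_inv₀, map_ofNat, hW _ hW₁, hW _ hW₂, hW _ hW₃]
  have hP' : φ' (s * P) = -φ (s * P) := by
    rw [hP, ← mul_neg_one, mul_left_comm, map_mul φ', map_mul φ, hφ']
    rcases hs with rfl | rfl <;>
      simp only [map_sub, map_inv₀, map_mul, map_pow, map_neg, map_one, hW _ hW₁, hW _ hW₂,
        hW _ hW₃] <;> ring
  have e1 := hD φ
  have e2 := hD φ'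
  rw [map_add, hA', hP', Complex.add_re, Complex.neg_re] at e2
  rw [map_add, Complex.add_re] at e1
  linarith

/-- Let `αᵢ = 2 - ωᵢ - ωᵢ⁻¹` with `ωᵢ` of odd order. If `4 + p - α₁ - α₂ - α₃` with
`p² = α₁α₂α₃` lies in a totally real field and all its conjugates are nonnegative, then `α₁` or
`α₂` vanishes. -/
lemma eq_one_of_gram_nonneg (hK : ∀ x : K, IsTotallyRealNum (x : ℂ)) {N : ℕ} (hN : Odd N)
    {ω₁ ω₂ ω₃ p : ℂ} (h₁ : ω₁ ^ N = 1) (h₂ : ω₂ ^ N = 1) (h₃ : ω₃ ^ N = 1)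
    (hp : p ^ 2 = (2 - ω₁ - ω₁⁻¹) * (2 - ω₂ - ω₂⁻¹) * (2 - ω₃ - ω₃⁻¹)) (δ : K)
    (hδ : (δ : ℂ) = 4 + p - (2 - ω₁ - ω₁⁻¹) - (2 - ω₂ - ω₂⁻¹) - (2 - ω₃ - ω₃⁻¹))
    (hpos : ∀ ρ : K →+* ℝ, 0 ≤ ρ δ) : ω₁ = 1 ∨ ω₂ = 1 := by
  have hN0 : 0 < N := hN.pos
  have : NeZero (4 * N) := ⟨by omega⟩
  have : IsCyclotomicExtension {4 * N} ℚ (CyclotomicField (4 * N) ℚ) := by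
    convert CyclotomicField.isCyclotomicExtension (4 * N) ℚ
    · rfl
    · exact Subsingleton.elim _ _
  have hζ := IsCyclotomicExtension.zeta_spec (4 * N) ℚ (CyclotomicField (4 * N) ℚ)
  exact eq_one_of_gram_nonneg_aux hK hN hζ h₁ h₂ h₃ hp δ hδ hpos

end Cyclotomic

/-! ### Units represented by a positive definite quadratic lattice -/

section Units

variable {K : Subfield ℂ}

@[simp, norm_cast]
lemma coe_one : ((1 : 𝓞 K) : K) = 1 := map_one _

@[simp, norm_cast]
lemma coe_mul (a b : 𝓞 K) : ((a * b : 𝓞 K) : K) = a * b := map_mul _ a b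

@[simp, norm_cast]
lemma coe_pow (a : 𝓞 K) (n : ℕ) : ((a ^ n : 𝓞 K) : K) = (a : K) ^ n := map_pow _ a n

@[simp]
lemma coe_ofNat (n : ℕ) [n.AtLeastTwo] :
    ((OfNat.ofNat n : 𝓞 K) : K) = OfNat.ofNat n := map_ofNat _ n

@[simp]
lemma subfield_coe_ofNat (n : ℕ) [n.AtLeastTwo] :
    ((OfNat.ofNat n : K) : ℂ) = OfNat.ofNat n := map_ofNat K.subtype n

lemma exists_isUnit_sq_mul {ε η : 𝓞 K} (hε : IsUnit ε) (hη : IsUnit η) {s : K}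
    (h : (ε : K) * η = s ^ 2) : ∃ u : 𝓞 K, IsUnit u ∧ ε = η * u ^ 2 := by
  obtain ⟨j, hj⟩ := hη.exists_right_inv
  have hj' : (η : K) * j = 1 := by rw [← coe_mul, hj, coe_one]
  have hu2 : (s * j) ^ 2 = ((ε * j : 𝓞 K) : K) := by
    rw [mul_pow, ← h, coe_mul]
    linear_combination (ε : K) * j * hj'
  obtain ⟨u, hu⟩ : ∃ u : 𝓞 K, (u : K) = s * j :=
    ⟨⟨s * j, IsIntegral.of_pow two_pos (by rw [hu2]; exact RingOfIntegers.isIntegral_coe _)⟩, rfl⟩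
  have hu' : u ^ 2 = ε * j := by
    apply RingOfIntegers.coe_injective
    change ((u ^ 2 : 𝓞 K) : K) = _
    rw [coe_pow, hu, hu2]
  refine ⟨u, ?_, ?_⟩
  · rw [← isUnit_pow_iff two_ne_zero, hu']
    exact hε.mul (IsUnit.of_mul_eq_one η (by rw [mul_comm, hj]))
  · rw [hu', mul_left_comm, hj, mul_one]

lemma exists_isUnit_sq_mul_symm {R : Type*} [CommRing R] {ε η : R}
    (h : ∃ u : R, IsUnit u ∧ ε = η * u ^ 2) : ∃ u : R, IsUnit u ∧ η = ε * u ^ 2 := by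
  obtain ⟨u, hu, rfl⟩ := h
  obtain ⟨w, hw⟩ := hu.exists_right_inv
  refine ⟨w, IsUnit.of_mul_eq_one u (by rw [mul_comm, hw]), ?_⟩
  rw [mul_assoc, ← mul_pow, hw, one_pow, mul_one]

end Units

section Lattice

variable {K : Subfield ℂ} {L : Type*} [AddCommGroup L] [Module (𝓞 K) L]
  {Q : QuadraticMap (𝓞 K) L (𝓞 K)}

lemma ringHom_map_nonneg (hpos : ∀ v : L, v ≠ 0 → IsTotallyPositive ((Q v : K) : ℂ)) (v : L)
    (ρ : K →+* ℝ) : 0 ≤ ρ (Q v) := by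
  by_cases hv : v = 0
  · simp [hv]
  · exact (ringHom_pos_of_isTotallyPositive (hpos v hv) ρ).le

lemma map_smul_add_smul (Q : QuadraticMap (𝓞 K) L (𝓞 K)) (a b : 𝓞 K) (v w : L) :
    Q (a • v + b • w) =
      a ^ 2 * Q v + b ^ 2 * Q w + a * b * QuadraticMap.polar Q v w := by
  rw [QuadraticMap.map_add (⇑Q), QuadraticMap.map_smul, QuadraticMap.map_smul,
    QuadraticMap.polar_smul_left, QuadraticMap.polar_smul_right]
  simp only [smul_eq_mul]
  ring

lemma map_smul_add_smul_add_smul (Q : QuadraticMap (𝓞 K) L (𝓞 K)) (a b c : 𝓞 K) (v w x : L) :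
    Q (a • v + b • w + c • x) =
      a ^ 2 * Q v + b ^ 2 * Q w + c ^ 2 * Q x + a * b * QuadraticMap.polar Q v w +
        a * c * QuadraticMap.polar Q v x + b * c * QuadraticMap.polar Q w x := by
  rw [QuadraticMap.map_add (⇑Q), map_smul_add_smul, QuadraticMap.map_smul,
    QuadraticMap.polar_add_left, QuadraticMap.polar_smul_left, QuadraticMap.polar_smul_right,
    QuadraticMap.polar_smul_left, QuadraticMap.polar_smul_right]
  simp only [smul_eq_mul]
  ring

lemma polar_sq_le (hpos : ∀ v : L, v ≠ 0 → IsTotallyPositive ((Q v : K) : ℂ)) {v w : L}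
    (hv : IsTotallyPositive ((Q v : K) : ℂ)) (ρ : K →+* ℝ) :
    ρ (QuadraticMap.polar Q v w : 𝓞 K) ^ 2 ≤ 4 * ρ (Q v) * ρ (Q w) := by
  have h := ringHom_map_nonneg hpos ((-QuadraticMap.polar Q v w) • v + (2 * Q v) • w) ρ
  rw [map_smul_add_smul] at h
  have hv' := ringHom_pos_of_isTotallyPositive hv ρ
  push_cast at h
  simp only [map_add, map_mul, map_pow, map_neg, map_ofNat] at h
  have : 0 ≤ ρ (Q v) * (4 * ρ (Q v) * ρ (Q w) - ρ (QuadraticMap.polar Q v w : 𝓞 K) ^ 2) := by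
    linarith
  linarith [nonneg_of_mul_nonneg_right this hv']

lemma polar_sq_ne {v w : L} (hv : IsUnit (Q v)) (hw : IsUnit (Q w))
    (hne : ¬ ∃ u : 𝓞 K, IsUnit u ∧ Q v = Q w * u ^ 2) :
    QuadraticMap.polar Q v w ^ 2 ≠ 4 * Q v * Q w := fun h => by
  refine hne (exists_isUnit_sq_mul hv hw (s := (QuadraticMap.polar Q v w : 𝓞 K) / 2) ?_)
  have h' : ((QuadraticMap.polar Q v w : 𝓞 K) : K) ^ 2 = 4 * (Q v) * (Q w) := by
    rw [← coe_pow, h, coe_mul, coe_mul, coe_ofNat]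
  linear_combination -(1 / 4 : K) * h'

/-- The normalized square of the polar form between vectors representing inequivalent totally
positive units comes from a root of unity of odd order. -/
lemma exists_odd_root_of_unity (hK : ∀ x : K, IsTotallyRealNum (x : ℂ))
    (hgamma : ¬ ∃ ε : 𝓞 K, IsUnit ε ∧ IsTotallyPositive ((ε : K) : ℂ) ∧
      ∃ x : K, x ≠ 0 ∧ ((ε : K) : ℂ) = gammaK K * (x : ℂ) ^ 2)
    (hpos : ∀ v : L, v ≠ 0 → IsTotallyPositive ((Q v : K) : ℂ)) {v w : L}
    (hv : IsUnit (Q v)) (hw : IsUnit (Q w)) (hv' : IsTotallyPositive ((Q v : K) : ℂ))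
    (hw' : IsTotallyPositive ((Q w : K) : ℂ))
    (hne : ¬ ∃ u : 𝓞 K, IsUnit u ∧ Q v = Q w * u ^ 2) {i j : 𝓞 K} (hi : Q v * i = 1)
    (hj : Q w * j = 1) :
    ∃ (ω : ℂ) (N : ℕ), Odd N ∧ ω ^ N = 1 ∧
      (((QuadraticMap.polar Q v w ^ 2 * i * j : 𝓞 K) : K) : ℂ) = 2 - ω - ω⁻¹ := by
  by_cases hb : QuadraticMap.polar Q v w = 0
  · exact ⟨1, 1, odd_one, one_pow _, by simp [hb]; norm_num⟩
  obtain ⟨b, hbdef⟩ : ∃ b, b = QuadraticMap.polar Q v w := ⟨_, rfl⟩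
  rw [← hbdef] at hb ⊢
  obtain ⟨a, ha⟩ : ∃ a, a = b ^ 2 * i * j := ⟨_, rfl⟩
  rw [← ha]
  have hab : a * (Q v * Q w) = b ^ 2 := by
    rw [ha]; linear_combination b ^ 2 * j * Q w * hi + b ^ 2 * hj
  have ha0 : a ≠ 0 := by
    rintro rfl
    rw [zero_mul] at hab
    exact hb (pow_eq_zero_iff two_ne_zero |>.1 hab.symm)
  have habK : (a : K) * ((Q v : K) * (Q w : K)) = (b : K) ^ 2 := by
    rw [← coe_mul, ← coe_mul, hab, coe_pow]
  have hbK : (b : K) ≠ 0 := RingOfIntegers.coe_ne_zero_iff.2 hb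
  have haK : (a : K) ≠ 0 := RingOfIntegers.coe_ne_zero_iff.2 ha0
  have haint : IsIntegral ℤ ((a : K) - 2) := by
    have : (a : K) - 2 = ((a - 2 : 𝓞 K) : K) := by push_cast; rfl
    rw [this]
    exact RingOfIntegers.isIntegral_coe _
  obtain ⟨y, n, hn, hyn, hy⟩ := exists_root_of_unity_add_inv hK ((a : K) - 2) haint fun ρ => by
    have e := congrArg ρ habK
    simp only [map_mul, map_pow] at e
    have hle := polar_sq_le hpos (w := w) hv' ρ
    have p1 := ringHom_pos_of_isTotallyPositive hv' ρ
    have p2 := ringHom_pos_of_isTotallyPositive hw' ρ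
    have p12 := mul_pos p1 p2
    rw [← hbdef, ← e] at hle
    rw [map_sub, map_ofNat, abs_le]
    have h0 : 0 ≤ ρ a := nonneg_of_mul_nonneg_left (e ▸ sq_nonneg _) p12
    have h4 : ρ a ≤ 4 := le_of_mul_le_mul_right (by linarith) p12
    constructor <;> linarith
  have hay : ((a : K) : ℂ) = 2 + (y + y⁻¹) := by
    rw [← hy, Subfield.coe_sub, subfield_coe_ofNat]; ring
  have hymem : y + y⁻¹ ∈ K := hy ▸ ((a : K) - 2).2
  rcases square_class_two_add hn hyn hymem (by rw [← hay]; exact_mod_cast haK) with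
    ⟨x, hx, hax⟩ | ⟨x, hx, hax⟩ | ⟨N, hN, hyN⟩
  · exfalso
    have hax' : (a : K) = (⟨x, hx⟩ : K) ^ 2 := Subtype.ext (hay.trans hax)
    have hx0 : (⟨x, hx⟩ : K) ≠ 0 := fun h => haK (by rw [hax', h]; ring)
    refine hne (exists_isUnit_sq_mul hv hw (s := (b : K) / ⟨x, hx⟩) ?_)
    rw [div_pow, ← hax', eq_div_iff haK, mul_comm, habK]
  · exfalso
    refine hgamma ⟨Q v * Q w, hv.mul hw, ?_, (b : K) * ⟨x, hx⟩ / a, ?_, ?_⟩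
    · refine isTotallyPositive_of_ringHom_pos hK fun ρ => ?_
      rw [coe_mul, map_mul]
      exact mul_pos (ringHom_pos_of_isTotallyPositive hv' ρ)
        (ringHom_pos_of_isTotallyPositive hw' ρ)
    · refine div_ne_zero (mul_ne_zero hbK fun h => haK ?_) haK
      have hx0 : x = 0 := congrArg Subtype.val h
      refine Subtype.ext (hay.trans (hax.trans ?_))
      rw [hx0]; simp
    · have haC : ((a : K) : ℂ) ≠ 0 := by exact_mod_cast haK
      have habC : ((a : K) : ℂ) * (((Q v * Q w : 𝓞 K) : K) : ℂ) = ((b : K) : ℂ) ^ 2 := by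
        rw [coe_mul]; exact_mod_cast congrArg Subtype.val habK
      have hax' := hay.trans hax
      push_cast
      rw [div_pow, mul_pow, mul_div_assoc', eq_div_iff (pow_ne_zero 2 haC)]
      push_cast at habC
      linear_combination ((a : K) : ℂ) * habC + ((b : K) : ℂ) ^ 2 * hax'
  · refine ⟨-y, N, hN, hyN, ?_⟩
    rw [hay, inv_neg]
    ring

/-- Among three vectors representing pairwise inequivalent totally positive units, each one is
orthogonal to one of the other two. -/
lemma polar_eq_zero_or (hK : ∀ x : K, IsTotallyRealNum (x : ℂ))
    (hgamma : ¬ ∃ ε : 𝓞 K, IsUnit ε ∧ IsTotallyPositive ((ε : K) : ℂ) ∧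
      ∃ x : K, x ≠ 0 ∧ ((ε : K) : ℂ) = gammaK K * (x : ℂ) ^ 2)
    (hpos : ∀ v : L, v ≠ 0 → IsTotallyPositive ((Q v : K) : ℂ)) {v₁ v₂ v₃ : L}
    (h₁ : IsUnit (Q v₁)) (h₂ : IsUnit (Q v₂)) (h₃ : IsUnit (Q v₃))
    (h₁' : IsTotallyPositive ((Q v₁ : K) : ℂ)) (h₂' : IsTotallyPositive ((Q v₂ : K) : ℂ))
    (h₃' : IsTotallyPositive ((Q v₃ : K) : ℂ))
    (h₁₂ : ¬ ∃ u : 𝓞 K, IsUnit u ∧ Q v₁ = Q v₂ * u ^ 2)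
    (h₁₃ : ¬ ∃ u : 𝓞 K, IsUnit u ∧ Q v₁ = Q v₃ * u ^ 2)
    (h₂₃ : ¬ ∃ u : 𝓞 K, IsUnit u ∧ Q v₂ = Q v₃ * u ^ 2) :
    QuadraticMap.polar Q v₁ v₂ = 0 ∨ QuadraticMap.polar Q v₁ v₃ = 0 := by
  obtain ⟨i₁, hi₁⟩ := h₁.exists_right_inv
  obtain ⟨i₂, hi₂⟩ := h₂.exists_right_inv
  obtain ⟨i₃, hi₃⟩ := h₃.exists_right_inv
  obtain ⟨ω₃, N₃, hN₃, hω₃, e₃⟩ :=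
    exists_odd_root_of_unity hK hgamma hpos h₁ h₂ h₁' h₂' h₁₂ hi₁ hi₂
  obtain ⟨ω₂, N₂, hN₂, hω₂, e₂⟩ :=
    exists_odd_root_of_unity hK hgamma hpos h₁ h₃ h₁' h₃' h₁₃ hi₁ hi₃
  obtain ⟨ω₁, N₁, hN₁, hω₁, e₁⟩ :=
    exists_odd_root_of_unity hK hgamma hpos h₂ h₃ h₂' h₃' h₂₃ hi₂ hi₃
  have hle := polar_sq_le hpos (w := v₃) h₂'
  have hne := polar_sq_ne h₂ h₃ h₂₃
  have hQ := map_smul_add_smul_add_smul Q (4 * Q v₂ * Q v₃ - QuadraticMap.polar Q v₂ v₃ ^ 2)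
    (QuadraticMap.polar Q v₁ v₃ * QuadraticMap.polar Q v₂ v₃ -
      2 * Q v₃ * QuadraticMap.polar Q v₁ v₂)
    (QuadraticMap.polar Q v₁ v₂ * QuadraticMap.polar Q v₂ v₃ -
      2 * Q v₂ * QuadraticMap.polar Q v₁ v₃)
    v₁ v₂ v₃
  have hQ0 := ringHom_map_nonneg hpos
    ((4 * Q v₂ * Q v₃ - QuadraticMap.polar Q v₂ v₃ ^ 2) • v₁ +
    (QuadraticMap.polar Q v₁ v₃ * QuadraticMap.polar Q v₂ v₃ -
      2 * Q v₃ * QuadraticMap.polar Q v₁ v₂) • v₂ +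
    (QuadraticMap.polar Q v₁ v₂ * QuadraticMap.polar Q v₂ v₃ -
      2 * Q v₂ * QuadraticMap.polar Q v₁ v₃) • v₃)
  rw [hQ] at hQ0
  have hzero : ∀ {b i j ε η : 𝓞 K} {ω : ℂ}, ε * i = 1 → η * j = 1 →
      (((b ^ 2 * i * j : 𝓞 K) : K) : ℂ) = 2 - ω - ω⁻¹ → ω = 1 → b = 0 := by
    rintro b i j ε η ω hi hj e rfl
    have h0 : (((b ^ 2 * i * j : 𝓞 K) : K) : ℂ) = ((0 : K) : ℂ) := by
      rw [e]; push_cast; norm_num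
    have h0' : b ^ 2 * i * j = 0 := RingOfIntegers.coe_injective
      ((Subtype.ext h0).trans (map_zero _).symm)
    have : b ^ 2 = 0 := by
      linear_combination ε * η * h0' - b ^ 2 * j * η * hi - b ^ 2 * hj
    exact pow_eq_zero_iff two_ne_zero |>.1 this
  have hz₃ := hzero hi₁ hi₂ e₃
  have hz₂ := hzero hi₁ hi₃ e₂
  clear hzero hQ h₁₂ h₁₃ h₂₃
  generalize QuadraticMap.polar Q v₁ v₂ = b₃ at *
  generalize QuadraticMap.polar Q v₁ v₃ = b₂ at *
  generalize QuadraticMap.polar Q v₂ v₃ = b₁ at *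
  have p₁ := ringHom_pos_of_isTotallyPositive h₁'
  have p₂ := ringHom_pos_of_isTotallyPositive h₂'
  have p₃ := ringHom_pos_of_isTotallyPositive h₃'
  generalize Q v₁ = ε₁ at *
  generalize Q v₂ = ε₂ at *
  generalize Q v₃ = ε₃ at *
  have key := eq_one_of_gram_nonneg hK (hN₃.mul (hN₂.mul hN₁)) (ω₁ := ω₃) (ω₂ := ω₂) (ω₃ := ω₁)
    (p := (((b₁ * b₂ * b₃ * i₁ * i₂ * i₃ : 𝓞 K) : K) : ℂ))
    (by rw [pow_mul, hω₃, one_pow])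
    (by rw [pow_mul', pow_mul, hω₂, one_pow, one_pow])
    (by rw [← mul_assoc, pow_mul', hω₁, one_pow])
    (by rw [← e₁, ← e₂, ← e₃]; push_cast; ring)
    (((4 * ε₁ * ε₂ * ε₃ + b₁ * b₂ * b₃ - ε₁ * b₁ ^ 2 - ε₂ * b₂ ^ 2 - ε₃ * b₃ ^ 2) *
      (i₁ * i₂ * i₃) : 𝓞 K) : K)
    (by
      have hδ : (4 * ε₁ * ε₂ * ε₃ + b₁ * b₂ * b₃ - ε₁ * b₁ ^ 2 - ε₂ * b₂ ^ 2 - ε₃ * b₃ ^ 2) *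
          (i₁ * i₂ * i₃) = 4 + b₁ * b₂ * b₃ * i₁ * i₂ * i₃ - b₃ ^ 2 * i₁ * i₂ - b₂ ^ 2 * i₁ * i₃ -
            b₁ ^ 2 * i₂ * i₃ := by
        linear_combination (4 * ε₂ * ε₃ * i₂ * i₃ - b₁ ^ 2 * i₂ * i₃) * hi₁ +
          (4 * ε₃ * i₃ - b₂ ^ 2 * i₁ * i₃) * hi₂ + (4 - b₃ ^ 2 * i₁ * i₂) * hi₃
      rw [← e₁, ← e₂, ← e₃]
      have h := congrArg (K.subtype.comp (algebraMap (𝓞 K) K)) hδ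
      rw [map_sub, map_sub, map_sub, map_add, map_ofNat] at h
      exact h)
    (fun ρ => by
      have q₁ : ρ ε₁ * ρ i₁ = 1 := by rw [← map_mul, ← coe_mul, hi₁, coe_one, map_one]
      have q₂ : ρ ε₂ * ρ i₂ = 1 := by rw [← map_mul, ← coe_mul, hi₂, coe_one, map_one]
      have q₃ : ρ ε₃ * ρ i₃ = 1 := by rw [← map_mul, ← coe_mul, hi₃, coe_one, map_one]
      have r₁ : 0 < ρ i₁ := pos_of_mul_pos_right (q₁ ▸ one_pos) (p₁ ρ).le
      have r₂ : 0 < ρ i₂ := pos_of_mul_pos_right (q₂ ▸ one_pos) (p₂ ρ).le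
      have r₃ : 0 < ρ i₃ := pos_of_mul_pos_right (q₃ ▸ one_pos) (p₃ ρ).le
      have hA : 0 < 4 * ρ ε₂ * ρ ε₃ - ρ b₁ ^ 2 := by
        refine sub_pos.2 (lt_of_le_of_ne (hle ρ) fun h => hne ?_)
        apply RingOfIntegers.coe_injective
        apply ρ.injective
        let φ := ρ.comp (algebraMap (𝓞 K) K)
        have e : φ (4 * ε₂ * ε₃) = 4 * φ ε₂ * φ ε₃ := by rw [map_mul, map_mul, map_ofNat]
        exact (map_pow φ b₁ 2).trans (h.trans e.symm)
      have h := hQ0 ρ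
      simp only [map_add, map_sub, map_mul, map_pow, map_ofNat] at h ⊢
      refine mul_nonneg ?_ (by positivity)
      refine nonneg_of_mul_nonneg_right (a := 4 * ρ ε₂ * ρ ε₃ - ρ b₁ ^ 2) ?_ hA
      refine h.trans_eq ?_
      ring)
  exact key.imp hz₃ hz₂

/-- Vectors representing pairwise inequivalent totally positive units are linearly independent. -/
lemma linearIndependent_of_inequivalent (hK : ∀ x : K, IsTotallyRealNum (x : ℂ))
    (hgamma : ¬ ∃ ε : 𝓞 K, IsUnit ε ∧ IsTotallyPositive ((ε : K) : ℂ) ∧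
      ∃ x : K, x ≠ 0 ∧ ((ε : K) : ℂ) = gammaK K * (x : ℂ) ^ 2)
    (hpos : ∀ v : L, v ≠ 0 → IsTotallyPositive ((Q v : K) : ℂ)) {ι : Type*} {v : ι → L}
    (hv : ∀ i, IsUnit (Q (v i))) (hv' : ∀ i, IsTotallyPositive ((Q (v i) : K) : ℂ))
    (hne : ∀ i j, i ≠ j → ¬ ∃ u : 𝓞 K, IsUnit u ∧ Q (v i) = Q (v j) * u ^ 2) :
    LinearIndependent (𝓞 K) v := by
  rw [linearIndependent_iff']
  intro s x hx i hi
  have hsum : ∀ k, ∑ j ∈ s, x j * QuadraticMap.polar Q (v k) (v j) = 0 := fun k => by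
    have h := congrArg (Q.polarBilin (v k)) hx
    simpa using h
  have hself : ∀ k, QuadraticMap.polar Q (v k) (v k) = 2 * Q (v k) := fun k => by
    rw [QuadraticMap.polar_self, nsmul_eq_mul, Nat.cast_ofNat]
  have hor : ∀ k l m, k ≠ l → k ≠ m → l ≠ m →
      QuadraticMap.polar Q (v k) (v l) = 0 ∨ QuadraticMap.polar Q (v k) (v m) = 0 :=
    fun k l m hkl hkm hlm => polar_eq_zero_or hK hgamma hpos (hv k) (hv l) (hv m) (hv' k) (hv' l)
      (hv' m) (hne _ _ hkl) (hne _ _ hkm) (hne _ _ hlm)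
  by_cases hj : ∃ j ∈ s, j ≠ i ∧ QuadraticMap.polar Q (v i) (v j) ≠ 0
  · obtain ⟨j, hjs, hji, hb⟩ := hj
    have hi0 := hsum i
    have hj0 := hsum j
    rw [Finset.sum_eq_add_of_mem i j hi hjs hji.symm fun l _ hl => by
      rw [(hor i j l hji.symm hl.1.symm hl.2.symm).resolve_left hb, mul_zero], hself] at hi0
    rw [Finset.sum_eq_add_of_mem i j hi hjs hji.symm fun l _ hl => by
      rw [(hor j i l hji hl.2.symm hl.1.symm).resolve_left
        (by rwa [QuadraticMap.polar_comm]), mul_zero], hself,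
      QuadraticMap.polar_comm Q (v j)] at hj0
    have hdet : x i * (4 * Q (v i) * Q (v j) - QuadraticMap.polar Q (v i) (v j) ^ 2) = 0 := by
      linear_combination 2 * Q (v j) * hi0 - QuadraticMap.polar Q (v i) (v j) * hj0
    exact (mul_eq_zero.1 hdet).resolve_right
      (sub_ne_zero.2 (polar_sq_ne (hv i) (hv j) (hne i j hji.symm)).symm)
  · push Not at hj
    have hi0 := hsum i
    rw [Finset.sum_eq_single_of_mem i hi fun l hl hli => by rw [hj l hl hli, mul_zero],
      hself] at hi0
    exact (mul_eq_zero.1 hi0).resolve_right (mul_ne_zero two_ne_zero (hv i).ne_zero)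

/-- A linearly independent family in a lattice has at most as many elements as the rank. -/
lemma card_le_finrank_tensorProduct [Algebra.IsAlgebraic ℚ K] [Module.Finite (𝓞 K) L]
    {ι : Type*} [Fintype ι] {v : ι → L} (hv : LinearIndependent (𝓞 K) v) :
    Fintype.card ι ≤ Module.finrank K (TensorProduct (𝓞 K) K L) := by
  have : Algebra.IsAlgebraic ℤ K := (IsFractionRing.comap_isAlgebraic_iff (K := ℚ)).2 inferInstance
  have : IsFractionRing (𝓞 K) K := IsIntegralClosure.isFractionRing_of_algebraic ℤ (𝓞 K)
    fun x hx => by simpa using hx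
  exact (hv.of_isLocalizedModule K (nonZeroDivisors (𝓞 K))
    (TensorProduct.mk (𝓞 K) K L 1)).fintype_card_le_finrank

end Lattice

end TotallyRealLattice

/-- Let `K` be a totally real field with `γ_K·K^{×2} ∩ 𝓞_K^{×,+} = ∅`. Then a positive
definite quadratic lattice `(L, Q)` of rank `n ≥ 2` over `K` represents at most `n` classes
of `𝓞_K^{×,+}/𝓞_K^{×2}`. -/
theorem stmt_8 (K : Subfield ℂ) (hK : ∀ x : ↥K, IsTotallyRealNum ↑x)
    (hgamma : ¬ ∃ ε : 𝓞 ↥K, IsUnit ε ∧ IsTotallyPositive ((ε : ↥K) : ℂ) ∧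
      ∃ x : ↥K, x ≠ 0 ∧ ((ε : ↥K) : ℂ) = gammaK K * (x : ℂ) ^ 2)
    (L : Type) [AddCommGroup L] [Module (𝓞 ↥K) L] [Module.Finite (𝓞 ↥K) L]
    [NoZeroSMulDivisors (𝓞 ↥K) L]
    (Q : QuadraticMap (𝓞 ↥K) L (𝓞 ↥K))
    (hpos : ∀ v : L, v ≠ 0 → IsTotallyPositive ((Q v : ↥K) : ℂ))
    (n : ℕ) (hn : 2 ≤ n)
    (hrank : Module.finrank ↥K (TensorProduct (𝓞 ↥K) ↥K L) = n) :
    ∃ T : Finset (𝓞 ↥K), T.card ≤ n ∧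
      ∀ ε : 𝓞 ↥K, IsUnit ε → IsTotallyPositive ((ε : ↥K) : ℂ) → (∃ v : L, Q v = ε) →
        ∃ c ∈ T, ∃ u : 𝓞 ↥K, IsUnit u ∧ ε = c * u ^ 2 := by
  classical
  have := TotallyRealLattice.algebra_isAlgebraic hK
  let P : ℕ → Prop := fun m => ∃ T : Finset (𝓞 K), T.card = m ∧
    (∀ c ∈ T, IsUnit c ∧ IsTotallyPositive ((c : K) : ℂ) ∧ ∃ v : L, Q v = c) ∧
    ∀ c ∈ T, ∀ d ∈ T, c ≠ d → ¬ ∃ u : 𝓞 K, IsUnit u ∧ c = d * u ^ 2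
  have hP : ∀ m, P m → m ≤ n := by
    rintro m ⟨T, rfl, hT, hne⟩
    choose v hv using fun c : T => (hT c c.2).2.2
    have hli : LinearIndependent (𝓞 K) v :=
      TotallyRealLattice.linearIndependent_of_inequivalent hK hgamma hpos
        (fun c => by rw [hv]; exact (hT c c.2).1) (fun c => by rw [hv]; exact (hT c c.2).2.1)
        (fun c d hcd => by
          rw [hv, hv]; exact hne c c.2 d d.2 fun h => hcd (Subtype.ext h))
    have h := TotallyRealLattice.card_le_finrank_tensorProduct hli
    rwa [hrank, Fintype.card_coe] at h
  have h0 : P 0 := ⟨∅, by simp⟩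
  obtain ⟨T, hcard, hT, hne⟩ := Nat.findGreatest_spec (Nat.zero_le n) h0
  refine ⟨T, hcard ▸ Nat.findGreatest_le n, fun ε hε hεpos hεrep => ?_⟩
  by_contra! hno
  have hεT : ε ∉ T := fun h => hno ε h 1 isUnit_one (by ring)
  have hins : P (T.card + 1) := by
    refine ⟨insert ε T, Finset.card_insert_of_notMem hεT, fun c hc => ?_, fun c hc d hd hcd => ?_⟩
    · rcases Finset.mem_insert.1 hc with rfl | hc
      exacts [⟨hε, hεpos, hεrep⟩, hT c hc]
    · have hno' : ∀ c ∈ T, ¬ ∃ u : 𝓞 K, IsUnit u ∧ ε = c * u ^ 2 :=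
        fun c hc ⟨u, hu, h⟩ => hno c hc u hu h
      rcases Finset.mem_insert.1 hc with rfl | hc' <;> rcases Finset.mem_insert.1 hd with rfl | hd'
      · exact absurd rfl hcd
      · exact hno' d hd'
      · exact fun h => hno' c hc' (TotallyRealLattice.exists_isUnit_sq_mul_symm h)
      · exact hne c hc' d hd' hcd
  have hle := Nat.le_findGreatest (hP _ hins) hins
  omega

end
end

section
/- Let K be a totally real number field (a totally real field of finite degree over ℚ) such that the group O_K^{×,+}/O_K^{×2} has more than 4 elements. Then there is no universal quadratic form in 3 variables over K. -/
open Polynomial NumberField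

set_option synthInstance.maxHeartbeats 400000
set_option maxHeartbeats 400000

noncomputable section

/-- A homogeneous polynomial of degree `2` induces a quadratic form. -/
theorem MvPolynomial.IsHomogeneous.exists_quadraticForm {R σ : Type*} [CommRing R] [Fintype σ]
    {P : MvPolynomial σ R} (hP : P.IsHomogeneous 2) :
    ∃ q : QuadraticForm R (σ → R), ∀ x, q x = MvPolynomial.eval x P := by
  classical
  have hsplit : ∀ (d : σ →₀ ℕ) (k : ℕ), d.degree = k + 1 →
      ∃ i, ∃ e : σ →₀ ℕ, d = Finsupp.single i 1 + e ∧ e.degree = k := by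
    intro d k hd
    obtain ⟨i, hi⟩ : ∃ i, d i ≠ 0 := by
      by_contra! h
      have : d = 0 := Finsupp.ext h
      simp [this] at hd
    obtain ⟨e, rfl⟩ := exists_add_of_le (Finsupp.single_le_iff.2 (Nat.one_le_iff_ne_zero.2 hi))
    rw [map_add, Finsupp.degree_single] at hd
    exact ⟨i, e, rfl, by omega⟩
  have hmon : ∀ d : σ →₀ ℕ, d ∈ P.support →
      ∃ q : QuadraticForm R (σ → R), ∀ x, q x = ∏ i ∈ d.support, x i ^ d i := by
    intro d hd
    obtain ⟨i, e, rfl, he⟩ := hsplit d 1 (hP.degree_eq_sum_deg_support hd).symm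
    obtain ⟨j, e, rfl, he0⟩ := hsplit e 0 he
    obtain rfl := (Finsupp.degree_eq_zero_iff e).1 he0
    rw [add_zero]
    refine ⟨QuadraticMap.linMulLin (LinearMap.proj i) (LinearMap.proj j), fun x => ?_⟩
    change _ = (Finsupp.single i 1 + Finsupp.single j 1 : σ →₀ ℕ).prod fun k n => x k ^ n
    rw [Finsupp.prod_add_index' (by simp) (by intros; rw [pow_add])]
    simp
  choose! q hq using hmon
  refine ⟨∑ d ∈ P.support, P.coeff d • q d, fun x => ?_⟩
  rw [MvPolynomial.eval_eq, sum_apply]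
  exact Finset.sum_congr rfl fun d hd => by rw [smul_apply, hq d hd, smul_eq_mul]

section Obtuse

variable {R M : Type*} [CommRing R] [AddCommGroup M] [Module R M] {τ : R →+* ℝ}
  {q : QuadraticForm R M} {f : M →ₛₗ[τ] ℝ}

open QuadraticMap

/-- Pairwise non-acute vectors in an open half space are linearly independent. -/
theorem linearIndependent_of_polar_nonpos {ι : Type*} [Fintype ι] (hτ : Function.Injective τ)
    (hq : ∀ x, x ≠ 0 → 0 < τ (q x)) {v : ι → M} (hv : ∀ i, 0 < f (v i))
    (hobt : ∀ i j, i ≠ j → τ (polar q (v i) (v j)) ≤ 0) : LinearIndependent R v := by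
  classical
  rw [Fintype.linearIndependent_iff]
  have coeff_nonpos : ∀ g : ι → R, ∑ i, g i • v i = 0 → ∀ i, τ (g i) ≤ 0 := by
    intro g hg i
    by_contra! hi
    set x := ∑ i with 0 < τ (g i), g i • v i with hx
    set y := ∑ i with ¬ 0 < τ (g i), g i • v i with hy
    have hxy : x + y = 0 := by
      rw [hx, hy, Finset.sum_filter_add_sum_filter_not, hg]
    have hle : 0 ≤ τ (polar q x y) := by
      have hexp : polar q x y = ∑ i with 0 < τ (g i), ∑ j with ¬ 0 < τ (g j),
          g i * (g j * polar q (v i) (v j)) := by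
        change q.polarBilin x y = _
        simp only [hx, hy, map_sum, map_smul, LinearMap.sum_apply, LinearMap.smul_apply,
          smul_eq_mul, Finset.mul_sum, polarBilin_apply_apply]
        rw [Finset.sum_comm]
        exact Finset.sum_congr rfl fun _ _ => Finset.sum_congr rfl fun _ _ => mul_left_comm _ _ _
      rw [hexp, map_sum]
      refine Finset.sum_nonneg fun i hi => ?_
      rw [map_sum]
      refine Finset.sum_nonneg fun j hj => ?_
      rw [Finset.mem_filter] at hi hj
      rw [map_mul, map_mul]
      refine mul_nonneg hi.2.le (mul_nonneg_of_nonpos_of_nonpos (not_lt.1 hj.2) (hobt i j ?_))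
      rintro rfl
      exact hj.2 hi.2
    have hx0 : x = 0 := by
      by_contra hne
      have h1 := hq x hne
      rw [eq_neg_of_add_eq_zero_right hxy, polar_neg_right, polar_self] at hle
      simp only [map_neg, two_nsmul, map_add] at hle
      linarith
    have hpos : 0 < f x := by
      rw [hx, map_sum]
      refine Finset.sum_pos (fun j hj => ?_) ⟨i, by simpa using hi⟩
      rw [LinearMap.map_smulₛₗ]
      exact mul_pos (Finset.mem_filter.1 hj).2 (hv j)
    rw [hx0, map_zero] at hpos
    exact hpos.false
  intro g hg i
  have h1 := coeff_nonpos g hg i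
  have h2 := coeff_nonpos (-g) (by simpa using hg) i
  rw [Pi.neg_apply, map_neg] at h2
  exact hτ (by rw [map_zero]; linarith)

/-- The reflection in a vector whose norm is a unit preserves the quadratic form. -/
theorem QuadraticMap.map_sub_inv_smul {u v : M} {ε : Rˣ} (hu : q u = ε) :
    q (v - (polar q u v * ↑ε⁻¹) • u) = q v := by
  have h := QuadraticMap.map_add q v (-((polar q u v * ↑ε⁻¹) • u))
  rw [← sub_eq_add_neg, QuadraticMap.map_neg, QuadraticMap.map_smul, hu, polar_neg_right,
    polar_smul_right, polar_comm _ v u] at h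
  rw [h]
  simp only [smul_eq_mul]
  linear_combination (polar q u v ^ 2 * ↑ε⁻¹) * ε.inv_mul

/-- If a vector of norm `ε i` is of minimal positive height among all vectors of this norm, for
each `i`, then these vectors are pairwise non-acute. -/
theorem polar_nonpos_of_minimal {u v : M} {ε δ : Rˣ} (hτ : Function.Injective τ)
    (hq : ∀ x, x ≠ 0 → 0 < τ (q x)) (hf : ∀ x, x ≠ 0 → f x ≠ 0)
    (hε : 0 < τ ε) (hδ : 0 < τ δ) (hu : q u = ε) (hv : q v = δ) (hfu : 0 < f u) (hfv : 0 < f v)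
    (hminu : ∀ x, q x = ε → 0 < f x → f u ≤ f x) (hminv : ∀ x, q x = δ → 0 < f x → f v ≤ f x)
    (hne : polar q u v ^ 2 ≠ 4 * ε * δ) : τ (polar q u v) ≤ 0 := by
  by_contra! hb
  have two_mul_height_le : ∀ {u v : M} {ε δ : Rˣ}, 0 < τ ε → 0 < τ δ → q u = ε → q v = δ → 0 < f u →
      (∀ x, q x = δ → 0 < f x → f v ≤ f x) → 0 < τ (polar q u v) →
      2 * f v * τ ε ≤ τ (polar q u v) * f u := by
    intro u v ε δ hε hδ hu hv hfu hmin hb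
    set w := v - (polar q u v * ↑ε⁻¹) • u with hw
    have hqw : q w = δ := by rw [hw, map_sub_inv_smul hu, hv]
    have hw0 : w ≠ 0 := by
      intro h
      rw [h, map_zero] at hqw
      rw [← hqw, map_zero] at hδ
      exact hδ.false
    have hinv : τ ↑ε⁻¹ * τ ε = 1 := by rw [← map_mul, Units.inv_mul, map_one]
    have hfw : f w * τ ε = f v * τ ε - τ (polar q u v) * f u := by
      rw [hw, map_sub, LinearMap.map_smulₛₗ, map_mul, smul_eq_mul]
      linear_combination (-(τ (polar q u v) * f u)) * hinv
    have hbu := mul_pos hb hfu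
    rcases lt_or_gt_of_ne (hf w hw0) with h | h
    · have := hmin (-w) (by rw [QuadraticMap.map_neg, hqw]) (by rw [map_neg]; linarith)
      rw [map_neg] at this
      nlinarith
    · have := hmin w hqw h
      nlinarith
  have h1 := two_mul_height_le hε hδ hu hv hfu hminv hb
  have h2 := two_mul_height_le hδ hε hv hu hfv hminu (by rwa [polar_comm])
  rw [polar_comm] at h2
  set b := polar q u v
  have h3 : 4 * τ ε * τ δ ≤ τ b ^ 2 := by
    have := mul_le_mul h1 h2 (by positivity) (by positivity)
    have hpos : 0 < f u * f v := by positivity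
    nlinarith
  have h4 : 0 ≤ τ (q (b • u - (2 * (ε : R)) • v)) := by
    by_cases h : b • u - (2 * (ε : R)) • v = 0
    · simp [h]
    · exact (hq _ h).le
  have h5 : q (b • u - (2 * (ε : R)) • v) = ε * (4 * ε * δ - b ^ 2) := by
    have h := QuadraticMap.map_add q (b • u) (-((2 * (ε : R)) • v))
    rw [← sub_eq_add_neg, QuadraticMap.map_neg, QuadraticMap.map_smul, QuadraticMap.map_smul,
      hu, hv, polar_neg_right, polar_smul_right, polar_smul_left] at h
    rw [h]
    simp only [smul_eq_mul]
    ring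
  rw [h5, map_mul] at h4
  have h6 := nonneg_of_mul_nonneg_right h4 hε
  refine hne (hτ ?_)
  simp only [map_sub, map_mul, map_pow, map_ofNat] at h6 ⊢
  linarith

/-- The number of unit values of a positive definite form, no two of which are attained on the same
line, is bounded by the rank. -/
theorem card_le_finrank_of_units_represented [Nontrivial R] [Module.Finite R M]
    {ι : Type*} [Fintype ι] {ε : ι → Rˣ} (hτ : Function.Injective τ)
    (hq : ∀ x, x ≠ 0 → 0 < τ (q x)) (hf : ∀ x, x ≠ 0 → f x ≠ 0) (hε : ∀ i, 0 < τ (ε i))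
    (hfin : ∀ i, {x | q x = ε i}.Finite) (hrep : ∀ i, ∃ x, q x = ε i)
    (hne : ∀ i j, i ≠ j → ∀ b : R, b ^ 2 ≠ 4 * ε i * ε j) :
    Fintype.card ι ≤ Module.finrank R M := by
  have hmin : ∀ i, ∃ v, (q v = ε i ∧ 0 < f v) ∧ ∀ x, q x = ε i → 0 < f x → f v ≤ f x := by
    intro i
    have hsub : {x | q x = ε i ∧ 0 < f x}.Finite := (hfin i).subset fun x hx => hx.1
    have hnon : {x | q x = ε i ∧ 0 < f x}.Nonempty := by
      obtain ⟨x, hx⟩ := hrep i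
      have hx0 : x ≠ 0 := by
        rintro rfl
        have := hε i
        rw [← hx, map_zero, map_zero] at this
        exact this.false
      rcases lt_or_gt_of_ne (hf x hx0) with h | h
      · exact ⟨-x, by rw [QuadraticMap.map_neg, hx], by rw [map_neg]; linarith⟩
      · exact ⟨x, hx, h⟩
    obtain ⟨v, hv, hvmin⟩ := hsub.exists_minimalFor f _ hnon
    refine ⟨v, hv, fun x hx hfx => ?_⟩
    rcases le_total (f v) (f x) with h | h
    · exact h
    · exact hvmin ⟨hx, hfx⟩ h
  choose v hv hvmin using hmin
  refine (linearIndependent_of_polar_nonpos hτ hq (fun i => (hv i).2)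
    fun i j hij => ?_).fintype_card_le_finrank
  exact polar_nonpos_of_minimal hτ hq hf (hε i) (hε j) (hv i).1 (hv j).1 (hv i).2 (hv j).2
    (hvmin i) (hvmin j) (hne i j hij _)

end Obtuse

/-- A ring of algebraic numbers embedded into `ℝ` admits semilinear maps `Rⁿ → ℝ` without
nontrivial zeros. -/
theorem exists_semilinear_ne_zero {R : Type*} [CommRing R] [IsDomain R] [Algebra.IsAlgebraic ℤ R]
    (τ : R →+* ℝ) (n : ℕ) :
    ∃ f : (Fin n → R) →ₛₗ[τ] ℝ, ∀ x, x ≠ 0 → f x ≠ 0 := by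
  set t := liouvilleNumber ((2 : ℕ) : ℝ)
  have ht : Transcendental ℤ t := transcendental_liouvilleNumber le_rfl
  let := τ.toAlgebra
  refine ⟨{ toFun := fun x => ∑ i, τ (x i) * t ^ (i : ℕ)
            map_add' := fun x y => by simp [add_mul, Finset.sum_add_distrib]
            map_smul' := fun c x => by simp [Finset.mul_sum, mul_assoc] }, fun x hx h0 => ?_⟩
  refine ht (IsAlgebraic.restrictScalars (S := R) ℤ
    ⟨∑ i, C (x i) * X ^ (i : ℕ), fun hp => hx ?_, ?_⟩)
  · ext i
    have := congrArg (fun p => p.coeff (i : ℕ)) hp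
    simpa [coeff_C_mul, coeff_X_pow, Fin.val_inj] using this
  · simpa [RingHom.algebraMap_toAlgebra] using h0

section TotallyReal

variable {K : Type*} [Field K] [NumberField K]

/-- Finitely many real functions on the real embeddings of a number field have a common upper
bound. -/
theorem exists_forall_realEmbedding_le {ι : Type*} [Finite ι] (g : ι → (K →+* ℝ) → ℝ) :
    ∃ B : ℝ, ∀ i σ, g i σ ≤ B := by
  have : Finite (K →+* ℝ) := Finite.of_injective (fun σ => Complex.ofRealHom.comp σ)
    fun σ τ h => (RingHom.cancel_left Complex.ofReal_injective).1 h
  obtain ⟨B, hB⟩ := (Set.finite_range fun p : ι × (K →+* ℝ) => g p.1 p.2).bddAbove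
  exact ⟨B, fun i σ => hB ⟨(i, σ), rfl⟩⟩

/-- A totally positive definite form over a totally real number field attains each value at only
finitely many integral vectors. -/
theorem finite_integral_level_set [IsTotallyReal K] {ι : Type*} [Finite ι]
    (q : QuadraticForm K (ι → K)) (hq : ∀ y, y ≠ 0 → ∀ σ : K →+* ℝ, 0 < σ (q y)) (ε : K) :
    {x : ι → 𝓞 K | q (fun i => (x i : K)) = ε}.Finite := by
  classical
  have : Fintype ι := Fintype.ofFinite ι
  have : Invertible (2 : K) := invertibleOfNonzero two_ne_zero
  obtain ⟨w, ⟨e⟩⟩ := QuadraticForm.equivalent_weightedSumSquares q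
  have hw : ∀ i, ∀ σ : K →+* ℝ, 0 < σ (w i) := by
    intro i σ
    have hne : e.symm (Pi.single i 1) ≠ 0 := fun h => by
      have h' := congrArg e h
      simp at h'
    have := hq _ hne σ
    rw [e.symm.map_app, QuadraticMap.weightedSumSquares_apply] at this
    simpa [Pi.single_apply] using this
  obtain ⟨B, hB⟩ := exists_forall_realEmbedding_le
    fun i (σ : K →+* ℝ) => σ ε / σ (w i) + 1
  obtain ⟨D, hD⟩ := exists_forall_realEmbedding_le
    fun k (σ : K →+* ℝ) => ∑ i, |σ (e.symm (Pi.single i 1) k)| * B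
  have hfin : {a : 𝓞 K | IsIntegral ℤ (a : K) ∧ ∀ φ : K →+* ℂ, ‖φ a‖ ≤ D}.Finite :=
    (Embeddings.finite_of_norm_le K ℂ D).preimage RingOfIntegers.coe_injective.injOn
  refine (Set.Finite.pi' fun _ : ι => hfin).subset fun x hx k => ⟨(x k).isIntegral_coe, fun φ => ?_⟩
  set σ : K →+* ℝ := (IsTotallyReal.complexEmbedding_isReal φ).embedding with hσ
  have hφ : ‖φ (x k)‖ = |σ (x k)| := by
    rw [← ComplexEmbedding.IsReal.coe_embedding_apply (IsTotallyReal.complexEmbedding_isReal φ),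
      Complex.norm_real, Real.norm_eq_abs]
  set y := e (fun i => (x i : K)) with hy
  have hsum : σ ε = ∑ i, σ (w i) * (σ (y i) * σ (y i)) := by
    rw [← (show _ = ε from hx), ← e.map_app, QuadraticMap.weightedSumSquares_apply]
    simp [hy]
  have hyB : ∀ i, |σ (y i)| ≤ B := by
    intro i
    have h1 : σ (w i) * (σ (y i) * σ (y i)) ≤ σ ε := by
      rw [hsum]
      exact Finset.single_le_sum (f := fun i => σ (w i) * (σ (y i) * σ (y i)))
        (fun j _ => mul_nonneg (hw j σ).le (mul_self_nonneg _)) (Finset.mem_univ i)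
    have h2 : σ (y i) * σ (y i) ≤ σ ε / σ (w i) := by
      rw [le_div_iff₀ (hw i σ)]
      linarith
    have h3 := hB i σ
    refine le_trans ?_ h3
    rw [← abs_mul_abs_self (σ (y i))] at h2
    nlinarith [sq_nonneg (|σ (y i)| - 1), abs_nonneg (σ (y i))]
  have hxk : (x k : K) = ∑ i, y i * e.symm (Pi.single i 1) k := by
    have h1 : e.symm y = fun i => (x i : K) :=
      e.toLinearEquiv.symm_apply_apply _
    have h2 : e.symm y = ∑ i, y i • e.symm (Pi.single i 1) := by
      conv_lhs => rw [pi_eq_sum_univ' y]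
      simp only [map_sum, map_smul]
    have := congrFun (h1.symm.trans h2) k
    simpa using this
  rw [hφ, hxk, map_sum]
  refine (Finset.abs_sum_le_sum_abs _ _).trans (le_trans (Finset.sum_le_sum fun i _ => ?_) (hD k σ))
  rw [map_mul, abs_mul, mul_comm]
  exact mul_le_mul_of_nonneg_left (hyB i) (abs_nonneg _)

/-- If `4 * ε * δ` is a square in `𝓞 K` for units `ε` and `δ`, then `ε / δ` is the square of a unit. -/
theorem exists_unit_eq_mul_sq {ε δ b : 𝓞 K} (hε : IsUnit ε) (hδ : IsUnit δ)
    (h : b ^ 2 = 4 * ε * δ) : ∃ u : 𝓞 K, IsUnit u ∧ ε = δ * u ^ 2 := by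
  obtain ⟨δ, rfl⟩ := hδ
  have hδ0 : ((δ : 𝓞 K) : K) ≠ 0 := RingOfIntegers.coe_ne_zero_iff.2 δ.ne_zero
  have hinv : ((δ : 𝓞 K) : K) * ((↑δ⁻¹ : 𝓞 K) : K) = 1 := by
    rw [← map_mul, Units.mul_inv, map_one]
  have hK : (b : K) ^ 2 = 4 * ε * (δ : 𝓞 K) := by
    have := congrArg (algebraMap (𝓞 K) K) h
    simpa only [map_mul, map_pow, map_ofNat] using this
  have hsq : ((b : K) / (2 * (δ : 𝓞 K))) ^ 2 = algebraMap (𝓞 K) K (ε * ↑δ⁻¹) := by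
    rw [map_mul, div_pow, hK, div_eq_iff (pow_ne_zero 2 (mul_ne_zero two_ne_zero hδ0))]
    linear_combination (-4 * (ε : K) * (δ : 𝓞 K)) * hinv
  have hint : IsIntegral ℤ ((b : K) / (2 * (δ : 𝓞 K))) :=
    IsIntegral.of_pow two_pos (hsq ▸ RingOfIntegers.isIntegral_coe _)
  obtain ⟨u, hu⟩ : ∃ u : 𝓞 K, (u : K) = (b : K) / (2 * (δ : 𝓞 K)) := ⟨⟨_, hint⟩, rfl⟩
  have hu2 : u ^ 2 = ε * ↑δ⁻¹ := by
    apply RingOfIntegers.coe_injective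
    exact (map_pow _ _ _).trans ((congrArg (· ^ 2) hu).trans hsq)
  refine ⟨u, ?_, ?_⟩
  · rw [← isUnit_pow_iff two_ne_zero, hu2]
    exact hε.mul (Units.isUnit _)
  · rw [hu2]
    linear_combination (-ε) * δ.mul_inv

/-- A totally positive definite `n`-ary quadratic form over a totally real number field represents
at most `n` square classes of totally positive units. -/
theorem card_le_of_units_represented [IsTotallyReal K] {n : ℕ} {Q : MvPolynomial (Fin n) (𝓞 K)}
    (hQ : Q.IsHomogeneous 2)
    (hpos : ∀ x, x ≠ 0 → ∀ σ : K →+* ℝ, 0 < σ (MvPolynomial.eval x Q : 𝓞 K))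
    {ι : Type*} [Fintype ι] {ε : ι → 𝓞 K} (hunit : ∀ i, IsUnit (ε i))
    (hε : ∀ i, ∀ σ : K →+* ℝ, 0 < σ (ε i)) (hrep : ∀ i, ∃ x, MvPolynomial.eval x Q = ε i)
    (hne : ∀ i j, i ≠ j → ∀ u : 𝓞 K, IsUnit u → ε i ≠ ε j * u ^ 2) : Fintype.card ι ≤ n := by
  obtain ⟨q, hq⟩ := hQ.exists_quadraticForm
  obtain ⟨qK, hqK⟩ := (hQ.map (algebraMap (𝓞 K) K)).exists_quadraticForm
  have hcoe : ∀ x : Fin n → 𝓞 K, qK (fun i => (x i : K)) = (q x : K) := by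
    intro x
    rw [hqK, hq, MvPolynomial.eval_map, MvPolynomial.eval]
    exact (MvPolynomial.eval₂_comp_left (algebraMap (𝓞 K) K) (RingHom.id _) x Q).symm
  have hposK : ∀ y, y ≠ 0 → ∀ σ : K →+* ℝ, 0 < σ (qK y) := by
    intro y hy σ
    obtain ⟨d, hd⟩ := IsLocalization.exist_integer_multiples_of_finite (nonZeroDivisors (𝓞 K)) y
    choose x hx using hd
    have hd0 : ((d : 𝓞 K) : K) ≠ 0 :=
      RingOfIntegers.coe_ne_zero_iff.2 (nonZeroDivisors.ne_zero d.2)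
    have hxy : (fun i => (x i : K)) = ((d : 𝓞 K) : K) • y := by
      ext i
      simpa [Algebra.smul_def] using hx i
    have hx0 : x ≠ 0 := by
      rintro rfl
      refine hy ((smul_eq_zero_iff_right hd0).1 (hxy.symm.trans ?_))
      ext i
      simp
    have h := hpos x hx0 σ
    rw [← hq, ← hcoe, hxy, QuadraticMap.map_smul, smul_eq_mul, map_mul, map_mul] at h
    exact pos_of_mul_pos_right h (mul_self_nonneg _)
  set σ : K →+* ℝ := (IsTotallyReal.complexEmbedding_isReal
    (Classical.arbitrary (K →+* ℂ))).embedding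
  set τ : 𝓞 K →+* ℝ := σ.comp (algebraMap (𝓞 K) K)
  have hτ : Function.Injective τ := σ.injective.comp RingOfIntegers.coe_injective
  obtain ⟨f, hf⟩ := exists_semilinear_ne_zero τ n
  have hcard := card_le_finrank_of_units_represented (q := q) (f := f)
    (ε := fun i => (hunit i).unit) hτ (fun x hx => hq x ▸ hpos x hx σ) hf (fun i => hε i σ)
    (fun i => (finite_integral_level_set qK hposK (ε i)).subset fun x hx => by
      rw [Set.mem_ofPred_eq, hcoe, show q x = ε i from hx])
    (fun i => by simpa only [hq, IsUnit.unit_spec] using hrep i)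
    (fun i j hij b hb => by
      obtain ⟨u, hu, h⟩ := exists_unit_eq_mul_sq (hunit i) (hunit j) hb
      exact hne i j hij u hu h)
  simpa using hcard

end TotallyReal

/-- The conjugates of an element of a number field `K ⊆ ℂ` are its images under the embeddings
of `K`. -/
theorem aeval_minpoly_coe_eq_zero_iff (K : Subfield ℂ) [FiniteDimensional ℚ K] (x : K) (w : ℂ) :
    aeval w (minpoly ℚ (x : ℂ)) = 0 ↔ ∃ φ : K →+* ℂ, φ x = w := by
  have : NumberField K := ⟨⟩
  have hmin : minpoly ℚ (x : ℂ) = minpoly ℚ x :=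
    minpoly.algHom_eq (K.subtype.toRatAlgHom) K.subtype.injective x
  have hx : minpoly ℚ x ≠ 0 := minpoly.ne_zero (Algebra.IsIntegral.isIntegral x)
  have := Set.ext_iff.1 (Embeddings.range_eval_eq_rootSet_minpoly K ℂ x) w
  rw [mem_rootSet_of_ne hx, Set.mem_range] at this
  rw [hmin, this]

theorem isTotallyPositive_coe_iff (K : Subfield ℂ) [FiniteDimensional ℚ K] [IsTotallyReal K]
    (x : K) : IsTotallyPositive x ↔ ∀ σ : K →+* ℝ, 0 < σ x := by
  have : NumberField K := ⟨⟩
  constructor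
  · intro h σ
    simpa using (h.2 _ ((aeval_minpoly_coe_eq_zero_iff K x _).2
      ⟨Complex.ofRealHom.comp σ, rfl⟩)).1
  · intro h
    refine ⟨(Algebra.IsAlgebraic.isAlgebraic x).algHom K.subtype.toRatAlgHom, fun w hw => ?_⟩
    obtain ⟨φ, rfl⟩ := (aeval_minpoly_coe_eq_zero_iff K x w).1 hw
    have hφ := IsTotallyReal.complexEmbedding_isReal φ
    rw [← hφ.coe_embedding_apply]
    exact ⟨h hφ.embedding, Complex.ofReal_im _⟩

/-- Let `K` be a totally real number field whose group `𝓞_K^{×,+}/𝓞_K^{×2}` has more than `4`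
elements (i.e. there are `5` totally positive units that are pairwise inequivalent modulo
squares of units). Then there is no universal quadratic form in `3` variables over `K`:
no homogeneous quadratic polynomial in `𝓞_K[X₁,X₂,X₃]` that is positive definite and
represents every totally positive element of `𝓞_K`. -/
theorem stmt_9 (K : Subfield ℂ) (hK : ∀ x : ↥K, IsTotallyRealNum ↑x)
    [FiniteDimensional ℚ ↥K]
    (h5 : ∃ ε : Fin 5 → 𝓞 ↥K,
      (∀ i, IsUnit (ε i) ∧ IsTotallyPositive ((ε i : ↥K) : ℂ)) ∧
      ∀ i j, i ≠ j → ∀ u : 𝓞 ↥K, IsUnit u → ε i ≠ ε j * u ^ 2) :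
    ¬ ∃ Q : MvPolynomial (Fin 3) (𝓞 ↥K), Q.IsHomogeneous 2 ∧
      (∀ x : Fin 3 → 𝓞 ↥K, x ≠ 0 → IsTotallyPositive ((MvPolynomial.eval x Q : ↥K) : ℂ)) ∧
      (∀ α : 𝓞 ↥K, IsTotallyPositive ((α : ↥K) : ℂ) →
        ∃ x : Fin 3 → 𝓞 ↥K, MvPolynomial.eval x Q = α) := by
  rintro ⟨Q, hQ, hpos, huniv⟩
  obtain ⟨ε, hε, hne⟩ := h5
  have : NumberField K := ⟨⟩
  have : IsTotallyReal K := by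
    refine ⟨fun w => InfinitePlace.isReal_iff.2 (RingHom.ext fun x => ?_)⟩
    exact Complex.conj_eq_iff_im.2
      ((hK x).2 _ ((aeval_minpoly_coe_eq_zero_iff K x _).2 ⟨w.embedding, rfl⟩))
  have hcard := card_le_of_units_represented hQ
    (fun x hx => (isTotallyPositive_coe_iff K _).1 (hpos x hx)) (fun i => (hε i).1)
    (fun i => (isTotallyPositive_coe_iff K _).1 (hε i).2) (fun i => huniv _ (hε i).2) hne
  simp at hcard

end
end

section
/- Let K be a totally real field such that the group O_K^{×,+}/O_K^{×2} is infinite. Then there is no universal quadratic lattice over K; in particular, there is no universal quadratic form over K in any number of variables. -/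
open Polynomial NumberField

set_option synthInstance.maxHeartbeats 400000
set_option maxHeartbeats 400000

noncomputable section

/-- The normalized trace of algebraic elements of a field extension extends to a linear functional
on the whole extension. -/
theorem exists_normalizedTrace_extension (F A : Type*) [Field F] [CharZero F] [Field A]
    [Algebra F A] : ∃ E : A →ₗ[F] F, ∀ x : A, IsAlgebraic F x →
      E x = ((minpoly F x).natDegree : F)⁻¹ * -(minpoly F x).nextCoeff := by
  have : Algebra.IsIntegral F (algebraicClosure F A) :=
    Algebra.isAlgebraic_iff_isIntegral.1 (algebraicClosure.isAlgebraic F A)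
  obtain ⟨E, hE⟩ := LinearMap.exists_extend (p := Subalgebra.toSubmodule
    (algebraicClosure F A).toSubalgebra) (Algebra.normalizedTrace F (algebraicClosure F A))
  refine ⟨E, fun x hx => ?_⟩
  have hx' : x ∈ algebraicClosure F A := mem_algebraicClosure_iff.2 hx
  have h1 : E x = Algebra.normalizedTrace F (algebraicClosure F A) ⟨x, hx'⟩ :=
    LinearMap.congr_fun hE ⟨x, hx'⟩
  rw [h1, Algebra.normalizedTrace_minpoly, smul_eq_mul,
    IntermediateField.minpoly_eq (⟨x, hx'⟩ : algebraicClosure F A)]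

/-- A choice of a linear extension of the normalized trace to `ℂ`. -/
def meanTrace : ℂ →ₗ[ℚ] ℚ := (exists_normalizedTrace_extension ℚ ℂ).choose

theorem meanTrace_eq {x : ℂ} (hx : IsAlgebraic ℚ x) :
    meanTrace x = ((minpoly ℚ x).natDegree : ℚ)⁻¹ * -(minpoly ℚ x).nextCoeff :=
  (exists_normalizedTrace_extension ℚ ℂ).choose_spec x hx

theorem meanTrace_ratCast (q : ℚ) : meanTrace (q : ℂ) = q := by
  have h := minpoly.eq_X_sub_C ℂ q
  rw [eq_ratCast] at h
  rw [meanTrace_eq (by simpa using isAlgebraic_algebraMap (A := ℂ) q), h]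
  simp

theorem nextCoeff_expand {R : Type*} [CommRing R] [Nontrivial R] {p : ℕ} (hp : 1 < p) (f : R[X])
    (hf : 0 < f.natDegree) : (expand R p f).nextCoeff = 0 := by
  have h0 : 0 < f.natDegree * p := by positivity
  rw [nextCoeff_of_natDegree_pos (by rwa [natDegree_expand]), natDegree_expand,
    coeff_expand (by omega), if_neg]
  intro h
  obtain ⟨k, hk⟩ := h
  have : f.natDegree * p = p * k + 1 := by omega
  have h2 : p ∣ 1 := (Nat.dvd_add_right (Dvd.intro k rfl)).1 (this ▸ Dvd.intro_left _ rfl)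
  exact absurd (Nat.dvd_one.1 h2) (by omega)

theorem abs_nextCoeff_cyclotomic_le_one {n : ℕ} (hn : n ≠ 0) :
    |(cyclotomic n ℚ).nextCoeff| ≤ 1 := by
  induction n using induction_on_primes with
  | zero => exact absurd rfl hn
  | one =>
    have : (X - 1 : ℚ[X]) = X - C 1 := by simp
    rw [cyclotomic_one, this, nextCoeff_X_sub_C]
    norm_num
  | prime_mul p n hp ih =>
    have hn0 : n ≠ 0 := by rintro rfl; simp at hn
    have hdeg : 0 < (cyclotomic n ℚ).natDegree := by
      rw [natDegree_cyclotomic]; exact Nat.totient_pos.2 (Nat.pos_of_ne_zero hn0)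
    have h0 := nextCoeff_expand (R := ℚ) hp.one_lt _ hdeg
    by_cases hd : p ∣ n
    · rw [cyclotomic_expand_eq_cyclotomic hp hd, mul_comm] at h0
      rw [h0]; simp
    · rw [cyclotomic_expand_eq_cyclotomic_mul hp hd,
        Monic.nextCoeff_mul (cyclotomic.monic _ _) (cyclotomic.monic _ _), mul_comm n p] at h0
      rw [eq_neg_of_add_eq_zero_left h0, abs_neg]
      exact ih hn0

theorem minpoly_rootOfUnity {z : ℂ} (hz : IsOfFinOrder z) :
    minpoly ℚ z = cyclotomic (orderOf z) ℚ :=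
  (cyclotomic_eq_minpoly_rat (IsPrimitiveRoot.orderOf z) hz.orderOf_pos).symm

theorem isAlgebraic_of_isOfFinOrder {z : ℂ} (hz : IsOfFinOrder z) : IsAlgebraic ℚ z :=
  ((IsPrimitiveRoot.orderOf z).isIntegral hz.orderOf_pos).tower_top.isAlgebraic

theorem abs_meanTrace_le {z : ℂ} (hz : IsOfFinOrder z) :
    |meanTrace z| ≤ ((Nat.totient (orderOf z) : ℚ))⁻¹ := by
  rw [meanTrace_eq (isAlgebraic_of_isOfFinOrder hz), minpoly_rootOfUnity hz, natDegree_cyclotomic,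
    abs_mul, abs_neg, abs_of_nonneg (by positivity)]
  exact mul_le_of_le_one_right (by positivity)
    (abs_nextCoeff_cyclotomic_le_one hz.orderOf_pos.ne')

theorem meanTrace_le_half {z : ℂ} (hz : IsOfFinOrder z) (h1 : z ≠ 1) :
    meanTrace z ≤ 1 / 2 := by
  by_cases h2 : 2 ≤ Nat.totient (orderOf z)
  · refine (le_abs_self _).trans ((abs_meanTrace_le hz).trans ?_)
    rw [one_div]
    exact inv_anti₀ (by norm_num) (by exact_mod_cast h2)
  · have h3 : Nat.totient (orderOf z) = 1 := by
      have := Nat.totient_pos.2 hz.orderOf_pos; omega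
    rcases Nat.totient_eq_one_iff.1 h3 with h | h
    · exact absurd (orderOf_eq_one_iff.1 h) h1
    · have hz2 : z ^ 2 = 1 := h ▸ pow_orderOf_eq_one z
      have : z = ((-1 : ℚ) : ℂ) := by
        rcases mul_self_eq_one_iff.1 ((sq z) ▸ hz2) with h | h
        · exact absurd h h1
        · simpa using h
      rw [this, meanTrace_ratCast]; norm_num

/-- A multiple of all orders `d` with `φ(d) ≤ 6`. -/
def smallOrderBound : ℕ := Nat.factorial 12

theorem dvd_smallOrderBound {d : ℕ} (hd : d ≠ 0) (h : Nat.totient d ≤ 6) :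
    d ∣ smallOrderBound := by
  refine (Nat.factorization_prime_le_iff_dvd hd (Nat.factorial_ne_zero 12)).1 fun p hp => ?_
  rcases Nat.eq_zero_or_pos (d.factorization p) with h0 | h0
  · rw [h0]; exact Nat.zero_le _
  refine (hp.pow_dvd_iff_le_factorization (Nat.factorial_ne_zero 12)).1 ?_
  refine Nat.dvd_factorial (pow_pos hp.pos _) ?_
  have h1 := Nat.le_of_dvd (Nat.totient_pos.2 (Nat.pos_of_ne_zero hd))
    (Nat.totient_dvd_of_dvd (Nat.ordProj_dvd d p))
  rw [Nat.totient_prime_pow hp h0] at h1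
  have h2 : p ^ d.factorization p = p ^ (d.factorization p - 1) * p := by
    rw [← pow_succ]; congr 1; omega
  have h3 : p ≤ 2 * (p - 1) := by have := hp.two_le; omega
  rw [h2]
  calc _ ≤ p ^ (d.factorization p - 1) * (2 * (p - 1)) := Nat.mul_le_mul_left _ h3
    _ = 2 * (p ^ (d.factorization p - 1) * (p - 1)) := by ring
    _ ≤ 12 := by omega

theorem abs_meanTrace_le_of_pow_ne_one {z : ℂ} (hz : IsOfFinOrder z)
    (h : z ^ smallOrderBound ≠ 1) : |meanTrace z| ≤ 1 / 7 := by
  have h7 : 7 ≤ Nat.totient (orderOf z) := by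
    by_contra hlt
    exact h (orderOf_dvd_iff_pow_eq_one.1 (dvd_smallOrderBound hz.orderOf_pos.ne' (by omega)))
  refine (abs_meanTrace_le hz).trans ?_
  rw [one_div]
  exact inv_anti₀ (by norm_num) (by exact_mod_cast h7)

/-- The normalized trace of a totally positive algebraic integer is at least `1`. -/
theorem one_le_meanTrace {z : ℂ} (hz : IsIntegral ℤ z) (hp : IsTotallyPositive z) :
    1 ≤ meanTrace z := by
  set f := minpoly ℚ z with hf
  have hzQ : IsIntegral ℚ z := hz.tower_top
  have hmon : f.Monic := minpoly.monic hzQ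
  have hdeg : 0 < f.natDegree := minpoly.natDegree_pos hzQ
  set g := f.map (algebraMap ℚ ℂ) with hg
  have hgm : g.Monic := hmon.map _
  have hgs : g.Splits := IsAlgClosed.splits g
  have hroot : ∀ w ∈ g.roots, 0 < w.re ∧ w.im = 0 := fun w hw => hp.2 w (by
    have := (mem_roots hgm.ne_zero).1 hw
    rwa [IsRoot.def, hg, eval_map_algebraMap] at this)
  set R : Multiset ℝ := g.roots.map Complex.re with hR
  have hRr : R.map (fun x : ℝ => (x : ℂ)) = g.roots := by
    rw [hR, Multiset.map_map]
    conv_rhs => rw [← Multiset.map_id g.roots]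
    refine Multiset.map_congr rfl fun w hw => ?_
    apply Complex.ext <;> simp [(hroot w hw).2]
  have hRpos : ∀ x ∈ R, 0 < x := by
    intro x hx
    obtain ⟨w, hw, rfl⟩ := Multiset.mem_map.1 hx
    exact (hroot w hw).1
  have hcard : R.card = f.natDegree := by
    rw [hR, Multiset.card_map, ← hgs.natDegree_eq_card_roots, hg, natDegree_map]
  have hsum : R.sum = ((-f.nextCoeff : ℚ) : ℝ) := by
    have h1 := hgs.nextCoeff_eq_neg_sum_roots_of_monic hgm
    rw [hg, nextCoeff_map (algebraMap ℚ ℂ).injective, ← hg, ← hRr] at h1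
    have h2 : ((R.sum : ℝ) : ℂ) = (R.map (fun x : ℝ => (x : ℂ))).sum :=
      map_multiset_sum Complex.ofRealHom R
    rw [← h2] at h1
    have : ((R.sum : ℝ) : ℂ) = (((-f.nextCoeff : ℚ) : ℝ) : ℂ) := by
      rw [eq_ratCast] at h1
      push_cast
      rw [h1]; ring
    exact_mod_cast this
  have hprod : 1 ≤ R.prod := by
    have h1 := hgs.coeff_zero_eq_prod_roots_of_monic hgm
    have hint : f = (minpoly ℤ z).map (algebraMap ℤ ℚ) :=
      minpoly.isIntegrallyClosed_eq_field_fractions' ℚ hz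
    have h2 : ((R.prod : ℝ) : ℂ) = (R.map (fun x : ℝ => (x : ℂ))).prod :=
      map_multiset_prod Complex.ofRealHom R
    rw [← hRr, ← h2] at h1
    have h3 : g.coeff 0 = (((minpoly ℤ z).coeff 0 : ℤ) : ℂ) := by
      rw [hg, coeff_map, hint, coeff_map]; simp
    have h4 : R.prod = (((-1) ^ g.natDegree * (minpoly ℤ z).coeff 0 : ℤ) : ℝ) := by
      have : ((R.prod : ℝ) : ℂ) =
          (((((-1) ^ g.natDegree * (minpoly ℤ z).coeff 0 : ℤ)) : ℝ) : ℂ) := by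
        push_cast
        rw [← h3, h1, ← mul_assoc, ← pow_add, ← two_mul, pow_mul]; simp
      exact_mod_cast this
    have h5 : 0 < R.prod := Multiset.prod_pos hRpos
    rw [h4] at h5 ⊢
    have h6 : 0 < (-1) ^ g.natDegree * (minpoly ℤ z).coeff 0 := Int.cast_pos.1 h5
    exact Int.cast_one_le_of_pos h6
  have key : ∀ S : Multiset ℝ, (∀ x ∈ S, 0 < x) →
      (S.card : ℝ) + Real.log S.prod ≤ S.sum := by
    intro S
    induction S using Multiset.induction_on with
    | empty => simp
    | cons a S ih =>
      intro h
      have ha := h a (Multiset.mem_cons_self a S)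
      have hS := fun x hx => h x (Multiset.mem_cons_of_mem hx)
      have h0 : 0 < S.prod := Multiset.prod_pos hS
      rw [Multiset.card_cons, Multiset.prod_cons, Multiset.sum_cons,
        Real.log_mul ha.ne' h0.ne']
      have := Real.log_le_sub_one_of_pos ha
      have := ih hS
      push_cast
      linarith
  have h1 := key R hRpos
  have h2 := Real.log_nonneg hprod
  rw [hcard, hsum] at h1
  have h3 : (f.natDegree : ℚ) ≤ -f.nextCoeff := by
    have : (f.natDegree : ℝ) ≤ ((-f.nextCoeff : ℚ) : ℝ) := by linarith
    exact_mod_cast this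
  rw [meanTrace_eq hp.1, ← hf, inv_mul_eq_div, le_div_iff₀ (by exact_mod_cast hdeg)]
  linarith

theorem isOfFinOrder_complex_inv {z : ℂ} (hz : IsOfFinOrder z) : IsOfFinOrder z⁻¹ := by
  obtain ⟨n, hn, h⟩ := isOfFinOrder_iff_pow_eq_one.1 hz
  exact isOfFinOrder_iff_pow_eq_one.2 ⟨n, hn, by rw [inv_pow, h, inv_one]⟩

/-- Kronecker: an algebraic integer all of whose conjugates lie in `[0, 4]` has the form
`2 + z + z⁻¹` with `z` a root of unity. -/
theorem exists_isOfFinOrder_eq_two_add {c : ℂ} (hc : IsIntegral ℤ c)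
    (h : ∀ w : ℂ, aeval w (minpoly ℚ c) = 0 → w.im = 0 ∧ 0 ≤ w.re ∧ w.re ≤ 4) :
    ∃ z : ℂ, IsOfFinOrder z ∧ c = 2 + z + z⁻¹ := by
  obtain ⟨s, hs⟩ := IsAlgClosed.exists_pow_nat_eq (c ^ 2 - 4 * c) (n := 2) (by norm_num)
  obtain ⟨z, hz⟩ : ∃ z, z = ((c - 2) + s) / 2 := ⟨_, rfl⟩
  have hq : z ^ 2 - (c - 2) * z + 1 = 0 := by rw [hz]; linear_combination hs / 4
  have hz0 : z ≠ 0 := by rintro rfl; norm_num at hq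
  have hcz : c = 2 + z + z⁻¹ := by field_simp; linear_combination -hq
  have hzi : IsIntegral ℤ z := by
    let c' : integralClosure ℤ ℂ := ⟨c, hc⟩
    have : IsIntegral (integralClosure ℤ ℂ) z := by
      refine ⟨X ^ 2 - (C c' - C 2) * X + 1, ?_, ?_⟩
      · monicity!
      · have h2 : algebraMap (integralClosure ℤ ℂ) ℂ c' = c := rfl
        simp only [eval₂_add, eval₂_sub, eval₂_mul, eval₂_pow, eval₂_X, eval₂_C, eval₂_one, h2]
        exact hq
    exact isIntegral_trans z this
  have : FiniteDimensional ℚ (IntermediateField.adjoin ℚ {z}) :=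
    IntermediateField.adjoin.finiteDimensional hzi.tower_top
  have : NumberField (IntermediateField.adjoin ℚ {z}) := { }
  let x : IntermediateField.adjoin ℚ {z} := IntermediateField.AdjoinSimple.gen ℚ z
  have hxz : (algebraMap (IntermediateField.adjoin ℚ {z}) ℂ) x = z :=
    IntermediateField.AdjoinSimple.algebraMap_gen ℚ z
  have hxi : IsIntegral ℤ x :=
    (isIntegral_algebraMap_iff (algebraMap (IntermediateField.adjoin ℚ {z}) ℂ).injective).1
      (by rwa [hxz])
  have hx0 : x ≠ 0 := by rintro h0; rw [h0, map_zero] at hxz; exact hz0 hxz.symm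
  obtain ⟨n, hn, hxn⟩ := NumberField.Embeddings.pow_eq_one_of_norm_eq_one _ ℂ hxi (fun φ => by
    have hconj : aeval (φ (2 + x + x⁻¹)) (minpoly ℚ c) = 0 := by
      have h1 : aeval (2 + x + x⁻¹) (minpoly ℚ c) = 0 := by
        apply (algebraMap (IntermediateField.adjoin ℚ {z}) ℂ).injective
        rw [← aeval_algebraMap_apply, map_add, map_add, map_inv₀, map_ofNat, hxz, ← hcz,
          minpoly.aeval, map_zero]
      have h2 := aeval_algHom_apply φ.toRatAlgHom (2 + x + x⁻¹) (minpoly ℚ c)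
      rw [h1, map_zero] at h2
      exact h2
    obtain ⟨him, h0, h4⟩ := h _ hconj
    have hy0 : φ x ≠ 0 := (map_ne_zero φ).2 hx0
    have hy : (φ x) ^ 2 - (φ (2 + x + x⁻¹) - 2) * φ x + 1 = 0 := by
      simp only [map_add, map_inv₀, map_ofNat]
      field_simp
      ring
    generalize φ x = y at hy hy0
    generalize φ (2 + x + x⁻¹) = t at him h0 h4 hy
    have hre := congrArg Complex.re hy
    have him' := congrArg Complex.im hy
    simp [pow_two, him] at hre him'
    have hns : Complex.normSq y = 1 := by
      rw [Complex.normSq_apply]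
      by_cases hv : y.im = 0
      · rw [hv] at hre ⊢
        have h5 : (2 * y.re - (t.re - 2)) ^ 2 = 0 := by
          refine le_antisymm ?_ (sq_nonneg _)
          nlinarith
        have h6 := pow_eq_zero_iff (two_ne_zero) |>.1 h5
        nlinarith
      · have : t.re - 2 = 2 * y.re := by
          apply mul_right_cancel₀ hv; linarith
        rw [this] at hre
        nlinarith
    rw [Complex.norm_def, hns, Real.sqrt_one])
  refine ⟨z, isOfFinOrder_iff_pow_eq_one.2 ⟨n, hn, ?_⟩, hcz⟩
  rw [← hxz, ← map_pow, hxn, map_one]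

/-- The units `z` for which `z + z⁻¹` and `(z - z⁻¹) (a - a⁻¹)` both lie in `K`. -/
def realPartSubgroup (K : Subfield ℂ) (a : ℂ) (ha : a + a⁻¹ ∈ K) (ha2 : (a - a⁻¹) ^ 2 ≠ 0)
    (ha0 : a ≠ 0) : Subgroup ℂˣ where
  carrier := {z | (z : ℂ) + (z : ℂ)⁻¹ ∈ K ∧ ((z : ℂ) - (z : ℂ)⁻¹) * (a - a⁻¹) ∈ K}
  one_mem' := by
    constructor
    · simp only [Units.val_one, inv_one]; exact add_mem (one_mem K) (one_mem K)
    · simp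
  inv_mem' := by
    rintro z ⟨h1, h2⟩
    constructor
    · simpa [add_comm] using h1
    · have := neg_mem h2
      rw [← neg_mul, neg_sub] at this
      simpa using this
  mul_mem' := by
    rintro z w ⟨hz1, hz2⟩ ⟨hw1, hw2⟩
    have h2 : (2 : ℂ)⁻¹ ∈ K := inv_mem (ofNat_mem K 2)
    have hD : (a - a⁻¹) ^ 2 ∈ K := by
      have : (a - a⁻¹) ^ 2 = (a + a⁻¹) ^ 2 - 4 := by field_simp; ring
      rw [this]
      exact sub_mem (pow_mem ha 2) (ofNat_mem K 4)
    constructor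
    · have := mul_mem h2 (add_mem (mul_mem hz1 hw1) (mul_mem (mul_mem hz2 hw2) (inv_mem hD)))
      convert this using 1
      have hz := z.ne_zero
      have hw := w.ne_zero
      rw [Units.val_mul, mul_inv]
      generalize (a - a⁻¹) = d at ha2 ⊢
      have hd : d ≠ 0 := fun h => ha2 (by rw [h]; norm_num)
      field_simp
      ring
    · have := mul_mem h2 (add_mem (mul_mem hz1 hw2) (mul_mem hz2 hw1))
      convert this using 1
      rw [Units.val_mul, mul_inv]
      ring

theorem exists_mem_sq_eq_of_mul_eq_one (K : Subfield ℂ) {a b c : ℂ} (ha : IsOfFinOrder a)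
    (hb : IsOfFinOrder b) (habc : a * b * c = 1) (haK : a + a⁻¹ ∈ K) (hbK : b + b⁻¹ ∈ K)
    (hcK : c + c⁻¹ ∈ K) (ha2 : a ^ 2 ≠ 1) :
    ∃ d ∈ K, 2 + a + a⁻¹ = d ^ 2 ∨ 2 + b + b⁻¹ = d ^ 2 ∨ 2 + c + c⁻¹ = d ^ 2 := by
  have ha0 : a ≠ 0 := by rintro rfl; simp at habc
  have hb0 : b ≠ 0 := by rintro rfl; simp at habc
  have hce : c = a⁻¹ * b⁻¹ := by field_simp; linear_combination habc
  have hD : (a - a⁻¹) ^ 2 ≠ 0 := by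
    intro h
    apply ha2
    have h' := pow_eq_zero_iff (two_ne_zero) |>.1 h
    field_simp at h'
    linear_combination h'
  have hDK : (a - a⁻¹) ^ 2 ∈ K := by
    have : (a - a⁻¹) ^ 2 = (a + a⁻¹) ^ 2 - 4 := by field_simp; ring
    rw [this]
    exact sub_mem (pow_mem haK 2) (ofNat_mem K 4)
  let H := realPartSubgroup K a haK hD ha0
  let m := orderOf a * orderOf b
  have : NeZero m := ⟨Nat.mul_ne_zero ha.orderOf_pos.ne' hb.orderOf_pos.ne'⟩
  have hfin : Finite (H ⊓ rootsOfUnity m ℂ : Subgroup ℂˣ) :=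
    Finite.of_injective (Subgroup.inclusion (inf_le_right : H ⊓ rootsOfUnity m ℂ ≤ _))
      (Subgroup.inclusion_injective _)
  have hua : Units.mk0 a ha0 ∈ H ⊓ rootsOfUnity m ℂ := by
    refine ⟨⟨haK, ?_⟩, ?_⟩
    · have : (a - a⁻¹) * (a - a⁻¹) = (a - a⁻¹) ^ 2 := by ring
      simpa only [Units.val_mk0, this] using hDK
    · refine (mem_rootsOfUnity _ _).2 ?_
      ext
      simp [m, pow_mul, pow_orderOf_eq_one]
  have hub : Units.mk0 b hb0 ∈ H ⊓ rootsOfUnity m ℂ := by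
    refine ⟨⟨hbK, ?_⟩, ?_⟩
    · have : (b - b⁻¹) * (a - a⁻¹) = 2 * (c + c⁻¹) - (a + a⁻¹) * (b + b⁻¹) := by
        rw [hce]; field_simp; ring
      rw [Units.val_mk0, this]
      exact sub_mem (mul_mem (ofNat_mem K 2) hcK) (mul_mem haK hbK)
    · refine (mem_rootsOfUnity _ _).2 ?_
      ext
      simp only [m, Units.val_pow_eq_pow_val, Units.val_mk0, Units.val_one]
      rw [mul_comm, pow_mul, pow_orderOf_eq_one, one_pow]
  obtain ⟨r, hr⟩ := IsCyclic.exists_generator (α := (H ⊓ rootsOfUnity m ℂ : Subgroup ℂˣ))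
  obtain ⟨i, hi⟩ := Subgroup.mem_zpowers_iff.1 (hr ⟨_, hua⟩)
  obtain ⟨j, hj⟩ := Subgroup.mem_zpowers_iff.1 (hr ⟨_, hub⟩)
  obtain ⟨t, ht⟩ : ∃ t : ℂ, t = ((r : ℂˣ) : ℂ) := ⟨_, rfl⟩
  have ht0 : t ≠ 0 := ht ▸ (r : ℂˣ).ne_zero
  have hai : a = t ^ i := by
    have := congrArg (fun u : (H ⊓ rootsOfUnity m ℂ : Subgroup ℂˣ) => ((u : ℂˣ) : ℂ)) hi
    simpa [ht] using this.symm
  have hbj : b = t ^ j := by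
    have := congrArg (fun u : (H ⊓ rootsOfUnity m ℂ : Subgroup ℂˣ) => ((u : ℂˣ) : ℂ)) hj
    simpa [ht] using this.symm
  have hK : ∀ k : ℤ, t ^ k + (t ^ k)⁻¹ ∈ K := by
    intro k
    have : ((r ^ k : (H ⊓ rootsOfUnity m ℂ : Subgroup ℂˣ)) : ℂˣ) ∈ H := (r ^ k).2.1
    have := this.1
    simpa [ht] using this
  have hsq : ∀ k : ℤ, 2 + t ^ (k + k) + (t ^ (k + k))⁻¹ = (t ^ k + (t ^ k)⁻¹) ^ 2 := by
    intro k
    have := zpow_ne_zero k ht0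
    rw [zpow_add₀ ht0]
    field_simp
    ring
  rcases Int.even_or_odd i with ⟨k, rfl⟩ | ⟨k, rfl⟩
  · exact ⟨_, hK k, Or.inl (hai ▸ hsq k)⟩
  rcases Int.even_or_odd j with ⟨l, rfl⟩ | ⟨l, rfl⟩
  · exact ⟨_, hK l, Or.inr (Or.inl (hbj ▸ hsq l))⟩
  refine ⟨_, hK (-(k + l + 1)), Or.inr (Or.inr ?_)⟩
  rw [← hsq, hce, hai, hbj, ← zpow_neg, ← zpow_neg, ← zpow_add₀ ht0]
  ring_nf

theorem meanTrace_add_inv_le {z : ℂ} (hz : IsOfFinOrder z) (h1 : z ≠ 1) :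
    meanTrace z + meanTrace z⁻¹ ≤ 1 := by
  have := meanTrace_le_half hz h1
  have := meanTrace_le_half (isOfFinOrder_complex_inv hz) (inv_ne_one.2 h1)
  linarith

theorem abs_meanTrace_add_inv_le {z : ℂ} (hz : IsOfFinOrder z)
    (h : z ^ smallOrderBound ≠ 1) : |meanTrace z + meanTrace z⁻¹| ≤ 2 / 7 := by
  have h1 := abs_meanTrace_le_of_pow_ne_one hz h
  have h2 := abs_meanTrace_le_of_pow_ne_one (isOfFinOrder_complex_inv hz) (by rwa [inv_pow, inv_ne_one])
  exact (abs_add_le _ _).trans (by linarith)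

/-- There is no non-planar triple of unit vectors whose pairwise angles are all rational of
large denominator. -/
theorem not_isTotallyPositive_gram {x y z : ℂ} (hx : IsOfFinOrder x) (hy : IsOfFinOrder y)
    (hz : IsOfFinOrder z) (hx' : (x ^ 2) ^ smallOrderBound ≠ 1)
    (hy' : (y ^ 2) ^ smallOrderBound ≠ 1) (hz' : (z ^ 2) ^ smallOrderBound ≠ 1)
    (h0 : x * y * z ≠ 1) (h1 : x⁻¹ * y * z ≠ 1) (h2 : x * y⁻¹ * z ≠ 1) (h3 : x * y * z⁻¹ ≠ 1)
    {g : ℂ} (hg : g = 4 + (x + x⁻¹) * (y + y⁻¹) * (z + z⁻¹) - (2 + x ^ 2 + (x ^ 2)⁻¹) -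
      (2 + y ^ 2 + (y ^ 2)⁻¹) - (2 + z ^ 2 + (z ^ 2)⁻¹)) (hgi : IsIntegral ℤ g)
    (hgp : IsTotallyPositive g) : False := by
  have hm := one_le_meanTrace hgi hgp
  have hx0 : x ≠ 0 := by rintro rfl; simpa using hx.orderOf_pos
  have hy0 : y ≠ 0 := by rintro rfl; simpa using hy.orderOf_pos
  have hz0 : z ≠ 0 := by rintro rfl; simpa using hz.orderOf_pos
  have f0 : IsOfFinOrder (x * y * z) := (hx.mul hy).mul hz
  have f1 : IsOfFinOrder (x⁻¹ * y * z) := ((isOfFinOrder_complex_inv hx).mul hy).mul hz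
  have f2 : IsOfFinOrder (x * y⁻¹ * z) := (hx.mul (isOfFinOrder_complex_inv hy)).mul hz
  have f3 : IsOfFinOrder (x * y * z⁻¹) := (hx.mul hy).mul (isOfFinOrder_complex_inv hz)
  have hg2 : g = ((-2 : ℚ) : ℂ) + (x * y * z + (x * y * z)⁻¹)
      + (x⁻¹ * y * z + (x⁻¹ * y * z)⁻¹) + (x * y⁻¹ * z + (x * y⁻¹ * z)⁻¹)
      + (x * y * z⁻¹ + (x * y * z⁻¹)⁻¹) - (x ^ 2 + (x ^ 2)⁻¹) - (y ^ 2 + (y ^ 2)⁻¹)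
      - (z ^ 2 + (z ^ 2)⁻¹) := by
    rw [hg]
    push_cast
    field_simp
    ring
  rw [hg2] at hm
  simp only [map_add, map_sub, meanTrace_ratCast] at hm
  have ax := abs_le.1 (abs_meanTrace_add_inv_le (hx.pow (n := 2)) hx')
  have ay := abs_le.1 (abs_meanTrace_add_inv_le (hy.pow (n := 2)) hy')
  have az := abs_le.1 (abs_meanTrace_add_inv_le (hz.pow (n := 2)) hz')
  have bound : ∀ s : ℂ, IsOfFinOrder s → s ≠ 1 → meanTrace s + meanTrace s⁻¹ ≤ 1 ∧
      (meanTrace s + meanTrace s⁻¹ ≤ 2 / 7 ∨ s ^ smallOrderBound = 1) := by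
    intro s hs hs1
    refine ⟨meanTrace_add_inv_le hs hs1, ?_⟩
    by_cases h : s ^ smallOrderBound = 1
    · exact Or.inr h
    · exact Or.inl (abs_le.1 (abs_meanTrace_add_inv_le hs h)).2
  have mulp : ∀ s t u : ℂ, u ^ smallOrderBound ≠ 1 → s * t = u →
      s ^ smallOrderBound = 1 → t ^ smallOrderBound = 1 → False := by
    intro s t u hu hst hs ht
    apply hu
    rw [← hst, mul_pow, hs, ht, one_mul]
  have divp : ∀ s t u : ℂ, u ^ smallOrderBound ≠ 1 → s = u * t →
      s ^ smallOrderBound = 1 → t ^ smallOrderBound = 1 → False := by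
    intro s t u hu hst hs ht
    apply hu
    rw [hst, mul_pow, ht, mul_one] at hs
    exact hs
  have d01 := divp (x * y * z) (x⁻¹ * y * z) _ hx' (by field_simp)
  have d02 := divp (x * y * z) (x * y⁻¹ * z) _ hy' (by field_simp)
  have d03 := divp (x * y * z) (x * y * z⁻¹) _ hz' (by field_simp)
  have d12 := mulp (x⁻¹ * y * z) (x * y⁻¹ * z) _ hz' (by field_simp)
  have d13 := mulp (x⁻¹ * y * z) (x * y * z⁻¹) _ hy' (by field_simp)
  have d23 := mulp (x * y⁻¹ * z) (x * y * z⁻¹) _ hx' (by field_simp)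
  obtain ⟨b0, c0⟩ := bound _ f0 h0
  obtain ⟨b1, c1⟩ := bound _ f1 h1
  obtain ⟨b2, c2⟩ := bound _ f2 h2
  obtain ⟨b3, c3⟩ := bound _ f3 h3
  rcases c0 with c0 | c0 <;> rcases c1 with c1 | c1 <;> rcases c2 with c2 | c2 <;>
    rcases c3 with c3 | c3 <;>
    first
      | exact d01 c0 c1
      | exact d02 c0 c2
      | exact d03 c0 c3
      | exact d12 c1 c2
      | exact d13 c1 c3
      | exact d23 c2 c3
      | linarith [ax.1, ay.1, az.1]

/-- The numbers `2 + z + z⁻¹` where `z` runs over roots of unity of order dividing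
`smallOrderBound`. -/
def smallCosines : Finset ℂ :=
  (nthRootsFinset smallOrderBound (1 : ℂ)).image fun z => 2 + z + z⁻¹

theorem card_smallCosines_le : smallCosines.card ≤ smallOrderBound := by
  refine Finset.card_image_le.trans ?_
  exact (Multiset.toFinset_card_le _).trans (card_nthRoots _ _)

theorem exists_sqrt_of_notMem_smallCosines {X : ℂ}
    (hX : ∃ z, IsOfFinOrder z ∧ X = 2 + z + z⁻¹) (hS : X ∉ smallCosines) :
    ∃ x, IsOfFinOrder x ∧ X = 2 + x ^ 2 + (x ^ 2)⁻¹ ∧ (x ^ 2) ^ smallOrderBound ≠ 1 := by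
  obtain ⟨z, hz, rfl⟩ := hX
  obtain ⟨x, hx⟩ := IsAlgClosed.exists_pow_nat_eq z (n := 2) (by norm_num)
  subst hx
  refine ⟨x, hz.of_pow two_ne_zero, rfl, fun h => hS ?_⟩
  exact Finset.mem_image.2 ⟨_, (mem_nthRootsFinset (Nat.factorial_pos 12) _).2 h, rfl⟩

theorem sq_sq_ne_one {K : Subfield ℂ} {x : ℂ}
    (h : ∀ d ∈ K, 2 + x ^ 2 + (x ^ 2)⁻¹ ≠ d ^ 2) : (x ^ 2) ^ 2 ≠ 1 := by
  intro h1
  rcases mul_self_eq_one_iff.1 ((sq (x ^ 2)) ▸ h1) with h2 | h2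
  · exact h 2 (ofNat_mem K 2) (by rw [h2]; norm_num)
  · exact h 0 (zero_mem K) (by rw [h2]; norm_num)

theorem no_triple_of_notMem_smallCosines {K : Subfield ℂ} {X Y Z T : ℂ}
    (hXK : X ∈ K) (hYK : Y ∈ K) (hZK : Z ∈ K)
    (hX : ∃ z, IsOfFinOrder z ∧ X = 2 + z + z⁻¹) (hY : ∃ z, IsOfFinOrder z ∧ Y = 2 + z + z⁻¹)
    (hZ : ∃ z, IsOfFinOrder z ∧ Z = 2 + z + z⁻¹)
    (hXS : X ∉ smallCosines) (hYS : Y ∉ smallCosines) (hZS : Z ∉ smallCosines)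
    (hXsq : ∀ d ∈ K, X ≠ d ^ 2) (hYsq : ∀ d ∈ K, Y ≠ d ^ 2) (hZsq : ∀ d ∈ K, Z ≠ d ^ 2)
    (hT : T ^ 2 = X * Y * Z) (hi : IsIntegral ℤ (4 + T - X - Y - Z))
    (hp : 4 + T - X - Y - Z = 0 ∨ IsTotallyPositive (4 + T - X - Y - Z)) : False := by
  obtain ⟨x, hx, rfl, hxs⟩ := exists_sqrt_of_notMem_smallCosines hX hXS
  obtain ⟨y, hy, rfl, hys⟩ := exists_sqrt_of_notMem_smallCosines hY hYS
  obtain ⟨z', hz', rfl, hzs'⟩ := exists_sqrt_of_notMem_smallCosines hZ hZS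
  have hx0 : x ≠ 0 := by rintro rfl; simpa using hx.orderOf_pos
  have hy0 : y ≠ 0 := by rintro rfl; simpa using hy.orderOf_pos
  have hz0' : z' ≠ 0 := by rintro rfl; simpa using hz'.orderOf_pos
  obtain ⟨z, hz, hzz, hTz⟩ : ∃ z, IsOfFinOrder z ∧ z ^ 2 = z' ^ 2 ∧
      T = (x + x⁻¹) * (y + y⁻¹) * (z + z⁻¹) := by
    have hsq : T ^ 2 = ((x + x⁻¹) * (y + y⁻¹) * (z' + z'⁻¹)) ^ 2 := by
      rw [hT]; field_simp; ring
    rcases sq_eq_sq_iff_eq_or_eq_neg.1 hsq with h | h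
    · exact ⟨z', hz', rfl, h⟩
    · refine ⟨-z', (hz'.pow (n := 2)).of_pow (n := 2) two_ne_zero |> fun _ => ?_, by ring, ?_⟩
      · refine IsOfFinOrder.of_pow (n := 2) ?_ two_ne_zero
        rw [neg_sq]
        exact hz'.pow
      · rw [h, inv_neg]; ring
  rw [← hzz] at hzs' hi hp hZK hZsq
  have hz0 : z ≠ 0 := by rintro rfl; simpa using hz.orderOf_pos
  clear hzz hz0' hT hZ hZS hz'
  by_cases hg : (x * y * z - 1) * (x⁻¹ * y * z - 1) * (x * y⁻¹ * z - 1) * (x * y * z⁻¹ - 1) = 0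
  · have tr : ∀ a : ℂ, 2 + a + a⁻¹ ∈ K → a + a⁻¹ ∈ K := by
      intro a ha
      have := sub_mem ha (ofNat_mem K 2)
      convert this using 1
      ring
    have tx := tr _ hXK
    have ty := tr _ hYK
    have tz := tr _ hZK
    have sx := sq_sq_ne_one hXsq
    have sy := sq_sq_ne_one hYsq
    have sz := sq_sq_ne_one hZsq
    have fx : IsOfFinOrder (x ^ 2) := hx.pow
    have fy : IsOfFinOrder (y ^ 2) := hy.pow
    have fz : IsOfFinOrder (z ^ 2) := hz.pow
    simp only [mul_eq_zero, sub_eq_zero] at hg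
    have swap : ∀ a : ℂ, 2 + a⁻¹ + a = 2 + a + a⁻¹ := fun a => by ring
    rcases hg with ((h | h) | h) | h
    · have h' : x ^ 2 * y ^ 2 * z ^ 2 = 1 := by rw [← mul_pow, ← mul_pow, h, one_pow]
      obtain ⟨d, hd, h1 | h1 | h1⟩ := exists_mem_sq_eq_of_mul_eq_one K fx fy h' tx ty tz sx
      exacts [hXsq d hd h1, hYsq d hd h1, hZsq d hd h1]
    · have h' : y ^ 2 * z ^ 2 * (x ^ 2)⁻¹ = 1 := by
        rw [← inv_pow, ← mul_pow, ← mul_pow, ← one_pow 2, ← h]; ring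
      obtain ⟨d, hd, h1 | h1 | h1⟩ := exists_mem_sq_eq_of_mul_eq_one K fy fz h' ty tz
        (by rwa [inv_inv, add_comm]) sy
      exacts [hYsq d hd h1, hZsq d hd h1, hXsq d hd (by rwa [inv_inv, swap] at h1)]
    · have h' : x ^ 2 * z ^ 2 * (y ^ 2)⁻¹ = 1 := by
        rw [← inv_pow, ← mul_pow, ← mul_pow, ← one_pow 2, ← h]; ring
      obtain ⟨d, hd, h1 | h1 | h1⟩ := exists_mem_sq_eq_of_mul_eq_one K fx fz h' tx tz
        (by rwa [inv_inv, add_comm]) sx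
      exacts [hXsq d hd h1, hZsq d hd h1, hYsq d hd (by rwa [inv_inv, swap] at h1)]
    · have h' : x ^ 2 * y ^ 2 * (z ^ 2)⁻¹ = 1 := by
        rw [← inv_pow, ← mul_pow, ← mul_pow, ← one_pow 2, ← h]
      obtain ⟨d, hd, h1 | h1 | h1⟩ := exists_mem_sq_eq_of_mul_eq_one K fx fy h' tx ty
        (by rwa [inv_inv, add_comm]) sx
      exacts [hXsq d hd h1, hYsq d hd h1, hZsq d hd (by rwa [inv_inv, swap] at h1)]
  · rcases hp with hp | hp
    · apply hg
      have : (x * y * z - 1) * (x⁻¹ * y * z - 1) * (x * y⁻¹ * z - 1) * (x * y * z⁻¹ - 1) =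
          x * y * z * (4 + T - (2 + x ^ 2 + (x ^ 2)⁻¹) - (2 + y ^ 2 + (y ^ 2)⁻¹) -
            (2 + z ^ 2 + (z ^ 2)⁻¹)) := by
        rw [hTz]; field_simp; ring
      rw [this, hp, mul_zero]
    · simp only [mul_eq_zero, sub_eq_zero, not_or] at hg
      obtain ⟨⟨⟨h0, h1⟩, h2⟩, h3⟩ := hg
      exact not_isTotallyPositive_gram hx hy hz hxs hys hzs' h0 h1 h2 h3 (by rw [hTz]) hi hp

theorem add_eq_four_of_notMem_smallCosines {X Y : ℂ}
    (hX : ∃ z, IsOfFinOrder z ∧ X = 2 + z + z⁻¹) (hY : ∃ z, IsOfFinOrder z ∧ Y = 2 + z + z⁻¹)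
    (hXS : X ∉ smallCosines) (hYS : Y ∉ smallCosines) (hi : IsIntegral ℤ (4 - X - Y))
    (hp : 4 - X - Y = 0 ∨ IsTotallyPositive (4 - X - Y)) : Y = 4 - X := by
  rcases hp with hp | hp
  · linear_combination -hp
  exfalso
  obtain ⟨x, hx, rfl, hxs⟩ := exists_sqrt_of_notMem_smallCosines hX hXS
  obtain ⟨y, hy, rfl, hys⟩ := exists_sqrt_of_notMem_smallCosines hY hYS
  have hm := one_le_meanTrace hi hp
  have hg : 4 - (2 + x ^ 2 + (x ^ 2)⁻¹) - (2 + y ^ 2 + (y ^ 2)⁻¹) =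
      -(x ^ 2 + (x ^ 2)⁻¹) - (y ^ 2 + (y ^ 2)⁻¹) := by ring
  rw [hg] at hm
  simp only [map_add, map_sub, map_neg] at hm
  have ax := abs_le.1 (abs_meanTrace_add_inv_le (hx.pow (n := 2)) hxs)
  have ay := abs_le.1 (abs_meanTrace_add_inv_le (hy.pow (n := 2)) hys)
  linarith [ax.1, ay.1]

/-- In a system of unit vectors with pairwise distinct square classes, each vector is orthogonal
to all but a bounded number of the others. -/
theorem card_filter_ne_zero_le {ι : Type*} [Fintype ι] [DecidableEq ι] {K : Subfield ℂ}
    (c : ι → ι → ℂ) (T : ι → ι → ι → ℂ) (hcK : ∀ i j, c i j ∈ K)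
    (hroot : ∀ i j, i ≠ j → ∃ z, IsOfFinOrder z ∧ c i j = 2 + z + z⁻¹)
    (hsq : ∀ i j, i ≠ j → ∀ d ∈ K, c i j = d ^ 2 → c i j = 0)
    (hinj : ∀ p i j, i ≠ j → c p i = c p j → c p i = 0)
    (hT : ∀ p q r, T p q r ^ 2 = c p q * c p r * c q r)
    (hTi : ∀ p q r, IsIntegral ℤ (4 + T p q r - c p q - c p r - c q r))
    (hTp : ∀ p q r, p ≠ q → p ≠ r → q ≠ r → 4 + T p q r - c p q - c p r - c q r = 0 ∨
      IsTotallyPositive (4 + T p q r - c p q - c p r - c q r)) (p : ι) :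
    (Finset.univ.filter fun i => i ≠ p ∧ c p i ≠ 0).card ≤ 2 * smallOrderBound + 2 := by
  classical
  have hsmall : ∀ q, ∀ A : Finset ι, (∀ i ∈ A, c q i ≠ 0 ∧ c q i ∈ smallCosines) →
      A.card ≤ smallOrderBound := by
    intro q A hA
    refine (Finset.card_le_card_of_injOn (c q) (fun i hi => (hA i hi).2) ?_).trans
      card_smallCosines_le
    intro i hi j hj hij
    by_contra hne
    exact (hA i hi).1 (hinj q i j hne hij)
  set N := Finset.univ.filter fun i => i ≠ p ∧ c p i ≠ 0 with hN
  have hmemN : ∀ i, i ∈ N ↔ i ≠ p ∧ c p i ≠ 0 := by simp [hN]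
  set B := N.filter fun i => c p i ∉ smallCosines with hB
  have hmemB : ∀ i, i ∈ B ↔ (i ≠ p ∧ c p i ≠ 0) ∧ c p i ∉ smallCosines := by
    intro i; rw [hB, Finset.mem_filter, hmemN]
  have hA := hsmall p (N.filter fun i => c p i ∈ smallCosines) (fun i hi => by
    rw [Finset.mem_filter, hmemN] at hi
    exact ⟨hi.1.2, hi.2⟩)
  have hAB : (N.filter fun i => c p i ∈ smallCosines).card + B.card = N.card := by
    rw [hB]
    convert Finset.card_filter_add_card_filter_not (s := N) (fun i => c p i ∈ smallCosines)
  suffices B.card ≤ smallOrderBound + 2 by omega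
  rcases B.eq_empty_or_nonempty with h0 | ⟨q, hq⟩
  · rw [h0]; simp
  have hq' := (hmemB q).1 hq
  have hZ : ((B.erase q).filter fun j => c q j = 0).card ≤ 1 := by
    refine Finset.card_le_one.2 fun i hi j hj => ?_
    have key : ∀ k, k ∈ (B.erase q).filter (fun j => c q j = 0) →
        c p k = 4 - c p q ∧ c p k ≠ 0 := by
      intro k hk
      rw [Finset.mem_filter, Finset.mem_erase, hmemB] at hk
      obtain ⟨⟨hkq, ⟨hkp, hk0⟩, hkS⟩, hk⟩ := hk
      have hT0 : T p q k = 0 := by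
        have := hT p q k
        rw [hk, mul_zero] at this
        exact pow_eq_zero_iff two_ne_zero |>.1 this
      have hi := hTi p q k
      have hp := hTp p q k hq'.1.1.symm hkp.symm hkq.symm
      rw [hT0, hk, add_zero, sub_zero] at hi hp
      exact ⟨add_eq_four_of_notMem_smallCosines (hroot p q hq'.1.1.symm) (hroot p k hkp.symm)
        hq'.2 hkS hi hp, hk0⟩
    by_contra hne
    exact (key i hi).2 (hinj p i j hne ((key i hi).1.trans (key j hj).1.symm))
  have hS := hsmall q ((B.erase q).filter fun j => ¬ c q j = 0) (fun j hj => by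
    rw [Finset.mem_filter, Finset.mem_erase, hmemB] at hj
    obtain ⟨⟨hjq, ⟨hjp, hj0⟩, hjS⟩, hj⟩ := hj
    refine ⟨hj, ?_⟩
    by_contra hS
    have hqp := hq'.1.1
    exact no_triple_of_notMem_smallCosines (hcK p q) (hcK p j) (hcK q j) (hroot p q hqp.symm)
      (hroot p j hjp.symm) (hroot q j hjq.symm) hq'.2 hjS hS
      (fun d hd h => hq'.1.2 (hsq p q hqp.symm d hd h)) (fun d hd h => hj0 (hsq p j hjp.symm d hd h))
      (fun d hd h => hj (hsq q j hjq.symm d hd h)) (hT p q j) (hTi p q j)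
      (hTp p q j hqp.symm hjp.symm hjq.symm))
  have hsplit := Finset.card_filter_add_card_filter_not (s := B.erase q) (fun j => c q j = 0)
  have := Finset.card_erase_add_one hq
  omega

/-- A finite graph whose degrees are at most `D` has an independent set containing at least a
`1 / (D + 1)` fraction of the vertices. -/
theorem exists_independent_card_le {ι : Type*} [Fintype ι] [DecidableEq ι] (R : ι → ι → Prop)
    [DecidableRel R] (hsymm : ∀ i j, R i j → R j i) (D : ℕ)
    (hD : ∀ p, (Finset.univ.filter fun i => i ≠ p ∧ R p i).card ≤ D) :
    ∃ P : Finset ι, (∀ i ∈ P, ∀ j ∈ P, i ≠ j → ¬ R i j) ∧ Fintype.card ι ≤ P.card * (D + 1) := by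
  classical
  obtain ⟨P, hP, hmax⟩ := Finset.exists_max_image
    (Finset.univ.filter fun P : Finset ι => ∀ i ∈ P, ∀ j ∈ P, i ≠ j → ¬ R i j) Finset.card
    ⟨∅, by simp⟩
  have hP' := (Finset.mem_filter.1 hP).2
  refine ⟨P, hP', ?_⟩
  have hcov : (Finset.univ : Finset ι) ⊆
      P.biUnion fun p => insert p (Finset.univ.filter fun i => i ≠ p ∧ R p i) := by
    intro i _
    by_contra hi
    simp only [Finset.mem_biUnion, Finset.mem_insert, Finset.mem_filter, Finset.mem_univ,
      true_and, not_exists, not_and, not_or] at hi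
    have hiP : i ∉ P := fun h => (hi i h).1 rfl
    have hins := hmax (insert i P) (by
      refine Finset.mem_filter.2 ⟨Finset.mem_univ _, ?_⟩
      intro a ha b hb hab
      rcases Finset.mem_insert.1 ha with rfl | ha' <;>
        rcases Finset.mem_insert.1 hb with rfl | hb'
      · exact absurd rfl hab
      · exact fun h => (hi b hb').2 (hi b hb').1 (hsymm _ _ h)
      · exact fun h => (hi a ha').2 (hi a ha').1 h
      · exact hP' a ha' b hb' hab)
    rw [Finset.card_insert_of_notMem hiP] at hins
    omega
  calc Fintype.card ι = (Finset.univ : Finset ι).card := rfl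
    _ ≤ _ := Finset.card_le_card hcov
    _ ≤ P.card * (D + 1) := Finset.card_biUnion_le_card_mul _ _ _ fun p _ =>
        (Finset.card_insert_le _ _).trans (Nat.succ_le_succ (hD p))

theorem IsTotallyPositive.ne_zero {z : ℂ} (hz : IsTotallyPositive z) : z ≠ 0 := by
  rintro rfl
  simpa using (hz.2 0 (by simp)).1

/-- The conjugates of an element of a totally real field are its images under the real
embeddings. -/
theorem root_minpoly_iff_exists_embedding {K : Subfield ℂ} (hK : ∀ x : K, IsTotallyRealNum ↑x)
    (x : K) {w : ℂ} :
    aeval w (minpoly ℚ (x : ℂ)) = 0 ↔ ∃ ρ : K →+* ℝ, ((ρ x : ℝ) : ℂ) = w := by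
  let f : K →ₐ[ℚ] ℂ := K.subtype.toRatAlgHom
  have hf : ∀ y : K, minpoly ℚ (y : ℂ) = minpoly ℚ y := fun y =>
    minpoly.algHom_eq f K.subtype.injective y
  have halg : Algebra.IsAlgebraic ℚ K := ⟨fun y =>
    (isAlgebraic_algHom_iff f K.subtype.injective).1 (hK y).1⟩
  have hrange : ∀ (y : K) (u : ℂ),
      aeval u (minpoly ℚ (y : ℂ)) = 0 ↔ ∃ σ : K →ₐ[ℚ] ℂ, σ y = u := by
    intro y u
    have h := Set.ext_iff.1
      (Algebra.IsAlgebraic.range_eval_eq_rootSet_minpoly (F := ℚ) (K := K) ℂ y) u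
    rw [Polynomial.mem_rootSet_of_ne
      (minpoly.ne_zero (Algebra.IsIntegral.isIntegral y)), ← hf] at h
    exact h.symm
  rw [hrange]
  constructor
  · rintro ⟨σ, rfl⟩
    have him : ∀ y : K, (σ y).im = 0 := fun y => (hK y).2 _ ((hrange y _).2 ⟨σ, rfl⟩)
    have hre : ∀ y : K, (((σ y).re : ℝ) : ℂ) = σ y := fun y =>
      Complex.ext (by simp) (by simp [him y])
    refine ⟨{ toFun := fun y => (σ y).re
              map_one' := by simp
              map_zero' := by simp
              map_mul' := fun y z => by simp [him]
              map_add' := fun y z => by simp }, hre x⟩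
  · rintro ⟨ρ, rfl⟩
    exact ⟨(Complex.ofRealHom.comp ρ).toRatAlgHom, rfl⟩

theorem isTotallyPositive_iff_forall_embedding {K : Subfield ℂ}
    (hK : ∀ x : K, IsTotallyRealNum ↑x) (x : K) :
    IsTotallyPositive (x : ℂ) ↔ ∀ ρ : K →+* ℝ, 0 < ρ x := by
  constructor
  · intro h ρ
    simpa using (h.2 (ρ x) ((root_minpoly_iff_exists_embedding hK x).2 ⟨ρ, rfl⟩)).1
  · refine fun h => ⟨(hK x).1, fun w hw => ?_⟩
    obtain ⟨ρ, rfl⟩ := (root_minpoly_iff_exists_embedding hK x).1 hw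
    simpa using h ρ

/-- An integral element of a totally real field all of whose conjugates lie in `[0, 4]` has the
form `2 + z + z⁻¹` for a root of unity `z`. -/
theorem exists_isOfFinOrder_of_forall_embedding {K : Subfield ℂ}
    (hK : ∀ x : K, IsTotallyRealNum ↑x) (x : K) (hx : IsIntegral ℤ x)
    (h : ∀ ρ : K →+* ℝ, 0 ≤ ρ x ∧ ρ x ≤ 4) :
    ∃ z : ℂ, IsOfFinOrder z ∧ (x : ℂ) = 2 + z + z⁻¹ := by
  refine exists_isOfFinOrder_eq_two_add (hx.map K.subtype.toIntAlgHom) fun w hw => ?_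
  obtain ⟨ρ, rfl⟩ := (root_minpoly_iff_exists_embedding hK x).1 hw
  simpa using h ρ

theorem quadraticMap_add_smul {R M : Type*} [CommRing R] [AddCommGroup M] [Module R M]
    (Q : QuadraticMap R M R) (a b : R) (v w : M) :
    Q (a • v + b • w) = a ^ 2 * Q v + a * b * QuadraticMap.polar Q v w + b ^ 2 * Q w := by
  rw [QuadraticMap.map_add (⇑Q), QuadraticMap.map_smul, QuadraticMap.map_smul,
    QuadraticMap.polar_smul_left, QuadraticMap.polar_smul_right]
  simp only [smul_eq_mul]
  ring

theorem quadraticMap_add_smul_add_smul {R M : Type*} [CommRing R] [AddCommGroup M] [Module R M]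
    (Q : QuadraticMap R M R) (a b c : R) (u v w : M) :
    Q (a • u + b • v + c • w) = a ^ 2 * Q u + b ^ 2 * Q v + c ^ 2 * Q w +
      a * b * QuadraticMap.polar Q u v + a * c * QuadraticMap.polar Q u w +
      b * c * QuadraticMap.polar Q v w := by
  rw [QuadraticMap.map_add (⇑Q), quadraticMap_add_smul, QuadraticMap.map_smul,
    QuadraticMap.polar_add_left, QuadraticMap.polar_smul_left, QuadraticMap.polar_smul_left,
    QuadraticMap.polar_smul_right, QuadraticMap.polar_smul_right]
  simp only [smul_eq_mul]
  ring

theorem gram_pair_eq_zero_or_pos {R I L : Type*} [CommRing R] [IsDomain R] [Nonempty I]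
    (φ : I → R →+* ℝ) [AddCommGroup L] [Module R L] (Q : QuadraticMap R L R)
    (hQ : ∀ v : L, v ≠ 0 → ∀ i, 0 < φ i (Q v)) (v w : L) (hv : v ≠ 0) :
    4 * Q v * Q w - QuadraticMap.polar Q v w ^ 2 = 0 ∨
      ∀ i, 0 < φ i (4 * Q v * Q w - QuadraticMap.polar Q v w ^ 2) := by
  have hval : Q (QuadraticMap.polar Q v w • v + (-2 * Q v) • w) =
      Q v * (4 * Q v * Q w - QuadraticMap.polar Q v w ^ 2) := by
    rw [quadraticMap_add_smul]; ring
  by_cases h0 : QuadraticMap.polar Q v w • v + (-2 * Q v) • w = 0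
  · rw [h0, QuadraticMap.map_zero] at hval
    refine Or.inl ((mul_eq_zero.1 hval.symm).resolve_left fun hv0 => ?_)
    obtain ⟨i⟩ := ‹Nonempty I›
    simpa [hv0] using hQ v hv i
  · refine Or.inr fun i => ?_
    have h1 := hQ _ h0 i
    rw [hval, map_mul] at h1
    exact (mul_pos_iff_of_pos_left (hQ v hv i)).1 h1

theorem gram_triple_eq_zero_or_pos {R I L : Type*} [CommRing R] [IsDomain R]
    (φ : I → R →+* ℝ) [AddCommGroup L] [Module R L] (Q : QuadraticMap R L R)
    (hQ : ∀ v : L, v ≠ 0 → ∀ i, 0 < φ i (Q v)) (u v w : L)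
    (h0 : 4 * Q u * Q v - QuadraticMap.polar Q u v ^ 2 ≠ 0)
    (hpos : ∀ i, 0 < φ i (4 * Q u * Q v - QuadraticMap.polar Q u v ^ 2)) :
    4 * Q u * Q v * Q w
        + QuadraticMap.polar Q u v * QuadraticMap.polar Q u w * QuadraticMap.polar Q v w
        - Q w * QuadraticMap.polar Q u v ^ 2 - Q v * QuadraticMap.polar Q u w ^ 2
        - Q u * QuadraticMap.polar Q v w ^ 2 = 0 ∨
      ∀ i, 0 < φ i (4 * Q u * Q v * Q w
        + QuadraticMap.polar Q u v * QuadraticMap.polar Q u w * QuadraticMap.polar Q v w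
        - Q w * QuadraticMap.polar Q u v ^ 2 - Q v * QuadraticMap.polar Q u w ^ 2
        - Q u * QuadraticMap.polar Q v w ^ 2) := by
  set a := QuadraticMap.polar Q u v with ha
  set b := QuadraticMap.polar Q u w with hb
  set c := QuadraticMap.polar Q v w with hc
  set x := (a * c - 2 * Q v * b) • u + (a * b - 2 * Q u * c) • v + (4 * Q u * Q v - a ^ 2) • w
    with hx
  have hval : Q x = (4 * Q u * Q v - a ^ 2) * (4 * Q u * Q v * Q w + a * b * c
      - Q w * a ^ 2 - Q v * b ^ 2 - Q u * c ^ 2) := by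
    rw [hx, quadraticMap_add_smul_add_smul, ← ha, ← hb, ← hc]; ring
  by_cases hx0 : x = 0
  · rw [hx0, QuadraticMap.map_zero] at hval
    exact Or.inl ((mul_eq_zero.1 hval.symm).resolve_left h0)
  · refine Or.inr fun i => ?_
    have h1 := hQ _ hx0 i
    rw [hval, map_mul] at h1
    exact (mul_pos_iff_of_pos_left (hpos i)).1 h1

/-- In a finitely generated module carrying an anisotropic quadratic form, the size of an
orthogonal family of nonzero vectors is bounded. -/
theorem card_le_of_pairwise_polar_eq_zero {R L ι : Type*} [CommRing R] [IsDomain R] [CharZero R]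
    [AddCommGroup L] [Module R L] (Q : QuadraticMap R L R) (s : Finset L)
    (hs : Submodule.span R (s : Set L) = ⊤) (v : ι → L) (P : Finset ι)
    (hv : ∀ i ∈ P, Q (v i) ≠ 0)
    (horth : ∀ i ∈ P, ∀ j ∈ P, i ≠ j → QuadraticMap.polar Q (v i) (v j) = 0) :
    P.card ≤ s.card := by
  classical
  have hli : LinearIndependent R fun i : P => v i := by
    rw [Fintype.linearIndependent_iff]
    intro g hg j
    have h1 : QuadraticMap.polarBilin Q (∑ i : P, g i • v i) (v j) = 0 := by
      rw [hg, map_zero, LinearMap.zero_apply]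
    rw [map_sum, LinearMap.sum_apply, Finset.sum_eq_single j] at h1
    · rw [map_smul, LinearMap.smul_apply, QuadraticMap.polarBilin_apply_apply,
        QuadraticMap.polar_self, smul_eq_mul] at h1
      refine (mul_eq_zero.1 h1).resolve_right ?_
      simpa using hv j j.2
    · intro i _ hij
      rw [map_smul, LinearMap.smul_apply, QuadraticMap.polarBilin_apply_apply,
        horth i i.2 j j.2 (fun h => hij (Subtype.ext h)), smul_zero]
    · simp
  simpa using linearIndependent_le_span_finset _ hli s hs

/-- Units that are inequivalent modulo squares of units are inequivalent modulo squares of field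
elements. -/
theorem ne_mul_sq_of_unit {K : Type*} [Field K] {a b : 𝓞 K} (ha : IsUnit a) (hb : IsUnit b)
    (h : ∀ u : 𝓞 K, IsUnit u → a ≠ b * u ^ 2) (y : K) :
    algebraMap (𝓞 K) K a ≠ algebraMap (𝓞 K) K b * y ^ 2 := by
  intro hy
  obtain ⟨t, ht⟩ := hb.exists_right_inv
  have hy2 : y ^ 2 = algebraMap (𝓞 K) K (a * t) := by
    have ht' := congrArg (algebraMap (𝓞 K) K) ht
    rw [map_mul, map_one] at ht'
    rw [map_mul, hy]
    linear_combination (-y ^ 2) * ht'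
  have hint : IsIntegral ℤ y := by
    refine IsIntegral.of_pow (n := 2) two_pos ?_
    rw [hy2]
    exact RingOfIntegers.isIntegral_coe _
  obtain ⟨Y, hY⟩ : ∃ Y : 𝓞 K, algebraMap (𝓞 K) K Y = y := ⟨⟨y, hint⟩, rfl⟩
  have hab : a = b * Y ^ 2 := by
    apply RingOfIntegers.coe_injective
    rw [map_mul, map_pow, hY, hy]
  refine h Y ?_ hab
  rw [hab] at ha
  exact (isUnit_pow_iff two_ne_zero).1 (isUnit_of_mul_isUnit_right ha)

open scoped Classical in
/-- Among vectors taking unit values in distinct square classes, each one is orthogonal to all but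
a bounded number of the others. -/
theorem card_polar_ne_zero_le {K : Subfield ℂ} (hK : ∀ x : K, IsTotallyRealNum ↑x)
    {L : Type*} [AddCommGroup L] [Module (𝓞 K) L] (Q : QuadraticMap (𝓞 K) L (𝓞 K))
    (hQ : ∀ v : L, v ≠ 0 → IsTotallyPositive ((Q v : K) : ℂ)) {ι : Type*} [Fintype ι]
    (v : ι → L) (hv : ∀ i, IsUnit (Q (v i)))
    (hns : ∀ i j, i ≠ j → ∀ u : 𝓞 K, IsUnit u → Q (v i) ≠ Q (v j) * u ^ 2) (p : ι) :
    (Finset.univ.filter fun i => i ≠ p ∧ QuadraticMap.polar Q (v p) (v i) ≠ 0).card ≤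
      2 * smallOrderBound + 2 := by
  let φ : (K →+* ℝ) → 𝓞 K →+* ℝ := fun ρ => ρ.comp (algebraMap (𝓞 K) K)
  have hφ : ∀ x : 𝓞 K, IsTotallyPositive ((x : K) : ℂ) ↔ ∀ ρ, 0 < φ ρ x := fun x =>
    isTotallyPositive_iff_forall_embedding hK _
  have hQ' : ∀ v : L, v ≠ 0 → ∀ ρ, 0 < φ ρ (Q v) := fun v hv => (hφ _).1 (hQ v hv)
  have hne : Nonempty (K →+* ℝ) := by
    obtain ⟨ρ, -⟩ := (root_minpoly_iff_exists_embedding hK 1).1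
      (minpoly.aeval ℚ ((1 : K) : ℂ))
    exact ⟨ρ⟩
  have hv0 : ∀ i, v i ≠ 0 := fun i h => by
    have := hv i
    rw [h, QuadraticMap.map_zero] at this
    exact not_isUnit_zero this
  let e : ι → K := fun i => algebraMap (𝓞 K) K (Q (v i))
  let b : ι → ι → K := fun i j => algebraMap (𝓞 K) K (QuadraticMap.polar Q (v i) (v j))
  have he0 : ∀ i, e i ≠ 0 := fun i h => (hv i).ne_zero (RingOfIntegers.coe_eq_zero_iff.1 h)
  have hb0 : ∀ i j, b i j = 0 ↔ QuadraticMap.polar Q (v i) (v j) = 0 := fun i j =>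
    RingOfIntegers.coe_eq_zero_iff
  have hepos : ∀ i, ∀ ρ : K →+* ℝ, 0 < ρ (e i) := fun i ρ => hQ' _ (hv0 i) ρ
  have hsq : ∀ i j, i ≠ j → ∀ y : K, e i ≠ e j * y ^ 2 := fun i j hij y =>
    ne_mul_sq_of_unit (hv i) (hv j) (hns i j hij) y
  have hinv : ∀ i, IsIntegral ℤ (e i)⁻¹ := fun i => by
    obtain ⟨t, ht⟩ := (hv i).exists_right_inv
    have ht' := congrArg (algebraMap (𝓞 K) K) ht
    rw [map_mul, map_one] at ht'
    rw [inv_eq_of_mul_eq_one_right ht']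
    exact RingOfIntegers.isIntegral_coe _
  have hbint : ∀ i j, IsIntegral ℤ (b i j) := fun i j => RingOfIntegers.isIntegral_coe _
  let c : ι → ι → K := fun i j => b i j ^ 2 * ((e i)⁻¹ * (e j)⁻¹)
  let T : ι → ι → ι → K := fun i j k =>
    b i j * b i k * b j k * ((e i)⁻¹ * (e j)⁻¹ * (e k)⁻¹)
  have hc0 : ∀ i j, c i j = 0 ↔ QuadraticMap.polar Q (v i) (v j) = 0 := fun i j => by
    rw [← hb0]
    simp [c, he0]
  have hcint : ∀ i j, IsIntegral ℤ (c i j) := fun i j =>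
    ((hbint i j).pow 2).mul ((hinv i).mul (hinv j))
  have hTint : ∀ i j k, IsIntegral ℤ (T i j k) := fun i j k =>
    (((hbint i j).mul (hbint i k)).mul (hbint j k)).mul (((hinv i).mul (hinv j)).mul (hinv k))
  have hpair0 : ∀ i j, i ≠ j →
      4 * Q (v i) * Q (v j) - QuadraticMap.polar Q (v i) (v j) ^ 2 ≠ 0 := by
    intro i j hij h
    have h' := congrArg (algebraMap (𝓞 K) K) h
    simp only [map_sub, map_mul, map_pow, map_ofNat, map_zero] at h'
    refine hsq i j hij (b i j / (2 * e j)) ?_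
    have := he0 j
    field_simp
    linear_combination h'
  have hpair : ∀ i j, i ≠ j → ∀ ρ,
      0 < φ ρ (4 * Q (v i) * Q (v j) - QuadraticMap.polar Q (v i) (v j) ^ 2) := fun i j hij =>
    (gram_pair_eq_zero_or_pos φ Q hQ' (v i) (v j) (hv0 i)).resolve_left (hpair0 i j hij)
  have hroot : ∀ i j, i ≠ j → ∃ z : ℂ, IsOfFinOrder z ∧ (c i j : ℂ) = 2 + z + z⁻¹ := by
    intro i j hij
    refine exists_isOfFinOrder_of_forall_embedding hK _ (hcint i j) fun ρ => ?_
    have h1 : 0 < 4 * ρ (e i) * ρ (e j) - ρ (b i j) ^ 2 := by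
      have := hpair i j hij ρ
      simp only [map_sub, map_mul, map_pow, map_ofNat] at this
      exact this
    have hi := hepos i ρ
    have hj := hepos j ρ
    have h2 : ρ (c i j) = ρ (b i j) ^ 2 / (ρ (e i) * ρ (e j)) := by
      simp only [c, map_mul, map_pow, map_inv₀]
      field_simp
    rw [h2]
    refine ⟨by positivity, ?_⟩
    rw [div_le_iff₀ (by positivity)]
    linarith
  have hmain := card_filter_ne_zero_le (K := K) (fun i j => (c i j : ℂ))
    (fun i j k => (T i j k : ℂ)) (fun i j => (c i j).2) hroot ?_ ?_ ?_ ?_ ?_ p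
  · convert hmain using 4 with i
    simp [hc0]
  · intro i j hij d hd h
    have h' : c i j = (⟨d, hd⟩ : K) ^ 2 := Subtype.ext h
    have hi := he0 i
    have hj := he0 j
    by_contra hne
    have hd0 : (⟨d, hd⟩ : K) ≠ 0 := by
      intro h0
      rw [h0, zero_pow two_ne_zero] at h'
      exact hne (by simp [h'])
    refine hsq i j hij (b i j / (⟨d, hd⟩ * e j)) ?_
    have h2 : b i j ^ 2 = (⟨d, hd⟩ : K) ^ 2 * (e i * e j) := by
      rw [← h']
      simp only [c]
      field_simp
    rw [div_pow, h2]
    field_simp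
  · intro q i j hij h
    have h' : c q i = c q j := Subtype.ext h
    have hi := he0 i
    have hj := he0 j
    have hq := he0 q
    by_contra hne
    have hb : b q j ≠ 0 := by
      intro hb
      refine hne ?_
      rw [h]
      simp [c, hb]
    refine hsq i j hij (b q i / b q j) ?_
    simp only [c] at h'
    field_simp at h' ⊢
    linear_combination (-1 : K) * h'
  · intro i j k
    norm_cast
    simp only [T, c]
    ring
  · intro i j k
    have h4 : IsIntegral ℤ (4 : K) := by
      simpa using isIntegral_algebraMap (R := ℤ) (A := K) (x := 4)
    have := (((((h4.add (hTint i j k)).sub (hcint i j)).sub (hcint i k)).sub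
      (hcint j k))).map K.subtype.toIntAlgHom
    exact_mod_cast this
  · intro i j k hij hik hjk
    have hi := he0 i
    have hj := he0 j
    have hk := he0 k
    have hval : (4 + T i j k - c i j - c i k - c j k) * (e i * e j * e k) =
        4 * e i * e j * e k + b i j * b i k * b j k - e k * b i j ^ 2 - e j * b i k ^ 2
          - e i * b j k ^ 2 := by
      simp only [T, c]
      field_simp
    have hcast : (4 + T i j k - c i j - c i k - c j k : ℂ) =
        ((4 + T i j k - c i j - c i k - c j k : K) : ℂ) := by push_cast; rfl
    rw [hcast]
    rcases gram_triple_eq_zero_or_pos φ Q hQ' (v i) (v j) (v k) (hpair0 i j hij)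
      (hpair i j hij) with h | h
    · left
      have h' := congrArg (algebraMap (𝓞 K) K) h
      simp only [map_sub, map_add, map_mul, map_pow, map_ofNat, map_zero] at h'
      have h2 := hval.trans h'
      rw [(mul_eq_zero.1 h2).resolve_right (by simp [hi, hj, hk])]
      rfl
    · right
      rw [isTotallyPositive_iff_forall_embedding hK]
      intro ρ
      have h' := h ρ
      have h2 : 0 < ρ ((4 + T i j k - c i j - c i k - c j k) * (e i * e j * e k)) := by
        rw [hval]
        simp only [map_sub, map_add, map_mul, map_pow, map_ofNat] at h' ⊢
        exact h'
      rw [map_mul] at h2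
      refine (mul_pos_iff_of_pos_right ?_).1 h2
      rw [map_mul, map_mul]
      exact mul_pos (mul_pos (hepos i ρ) (hepos j ρ)) (hepos k ρ)

/-- A homogeneous polynomial of degree two defines a quadratic map. -/
theorem exists_quadraticMap_eq_eval {R σ : Type*} [CommRing R] (p : MvPolynomial σ R)
    (hp : p.IsHomogeneous 2) :
    ∃ Q : QuadraticMap R (σ → R) R, ∀ x, Q x = MvPolynomial.eval x p := by
  have hmon : ∀ d : σ →₀ ℕ, ∃ Q : QuadraticMap R (σ → R) R,
      d ∈ p.support → ∀ x : σ → R, Q x = ∏ i ∈ d.support, x i ^ d i := by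
    intro d
    by_cases hd : d ∈ p.support
    · have h2 : Multiset.card (Finsupp.toMultiset d) = 2 := by
        rw [Finsupp.card_toMultiset]
        have := hp (MvPolynomial.mem_support_iff.1 hd)
        rwa [Finsupp.weight_apply, Finsupp.sum_congr (g2 := fun _ n => n) (by simp)] at this
      obtain ⟨i, j, hij⟩ := Multiset.card_eq_two.1 h2
      refine ⟨QuadraticMap.linMulLin (LinearMap.proj i) (LinearMap.proj j), fun _ x => ?_⟩
      have h3 : ((Finsupp.toMultiset d).map x).prod = ∏ i ∈ d.support, x i ^ d i := by
        rw [Finsupp.toMultiset_map, Finsupp.prod_toMultiset]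
        rw [Finsupp.prod_mapDomain_index (by simp) (by intros; rw [pow_add])]
        rfl
      rw [← h3, hij]
      simp
    · exact ⟨0, fun h => absurd h hd⟩
  choose q hq using hmon
  refine ⟨∑ d ∈ p.support, p.coeff d • q d, fun x => ?_⟩
  rw [MvPolynomial.eval_eq, sum_apply]
  refine Finset.sum_congr rfl fun d hd => ?_
  rw [smul_apply, hq d hd, smul_eq_mul]

theorem not_universal_quadraticMap (K : Subfield ℂ) (hK : ∀ x : ↥K, IsTotallyRealNum ↑x)
    (hinf : ∀ N : ℕ, ∃ ε : Fin N → 𝓞 ↥K,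
      (∀ i, IsUnit (ε i) ∧ IsTotallyPositive ((ε i : ↥K) : ℂ)) ∧
      ∀ i j, i ≠ j → ∀ u : 𝓞 ↥K, IsUnit u → ε i ≠ ε j * u ^ 2)
    {L : Type*} [AddCommGroup L] [Module (𝓞 ↥K) L] [Module.Finite (𝓞 ↥K) L]
    (Q : QuadraticMap (𝓞 ↥K) L (𝓞 ↥K))
    (hQ : ∀ v : L, v ≠ 0 → IsTotallyPositive ((Q v : ↥K) : ℂ)) :
    ¬ ∀ α : 𝓞 ↥K, IsTotallyPositive ((α : ↥K) : ℂ) → ∃ v : L, Q v = α := by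
  classical
  intro huniv
  obtain ⟨s, hs⟩ := Module.Finite.fg_top (R := 𝓞 K) (M := L)
  obtain ⟨ε, hε, hns⟩ := hinf (s.card * (2 * smallOrderBound + 2 + 1) + 1)
  choose v hv using fun i => huniv (ε i) (hε i).2
  obtain ⟨P, hP, hcard⟩ := exists_independent_card_le
    (fun i j => QuadraticMap.polar Q (v i) (v j) ≠ 0)
    (fun i j h => by rwa [QuadraticMap.polar_comm]) (2 * smallOrderBound + 2) fun p => by
      convert card_polar_ne_zero_le hK Q hQ v (fun i => by rw [hv]; exact (hε i).1)
        (fun i j hij u hu => by rw [hv, hv]; exact hns i j hij u hu) p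
  have hle := card_le_of_pairwise_polar_eq_zero Q s hs v P
    (fun i _ => by rw [hv]; exact (hε i).1.ne_zero) fun i hi j hj hij => not_not.1 (hP i hi j hj hij)
  rw [Fintype.card_fin] at hcard
  have := Nat.mul_le_mul_right (2 * smallOrderBound + 2 + 1) hle
  omega

/-- Let `K` be a totally real field for which `𝓞_K^{×,+}/𝓞_K^{×2}` is infinite (for every `N`
there exist `N` totally positive units pairwise inequivalent modulo squares of units). Then
there is no universal quadratic lattice over `K`, and in particular no universal quadratic
form over `K` in any number of variables. -/
theorem stmt_10 (K : Subfield ℂ) (hK : ∀ x : ↥K, IsTotallyRealNum ↑x)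
    (hinf : ∀ N : ℕ, ∃ ε : Fin N → 𝓞 ↥K,
      (∀ i, IsUnit (ε i) ∧ IsTotallyPositive ((ε i : ↥K) : ℂ)) ∧
      ∀ i j, i ≠ j → ∀ u : 𝓞 ↥K, IsUnit u → ε i ≠ ε j * u ^ 2) :
    (∀ (L : Type) [AddCommGroup L] [Module (𝓞 ↥K) L] [Module.Finite (𝓞 ↥K) L]
      [NoZeroSMulDivisors (𝓞 ↥K) L] (Q : QuadraticMap (𝓞 ↥K) L (𝓞 ↥K)),
      ¬ ((∀ v : L, v ≠ 0 → IsTotallyPositive ((Q v : ↥K) : ℂ)) ∧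
        (∀ α : 𝓞 ↥K, IsTotallyPositive ((α : ↥K) : ℂ) → ∃ v : L, Q v = α))) ∧
    (∀ (n : ℕ) (Q : MvPolynomial (Fin n) (𝓞 ↥K)), Q.IsHomogeneous 2 →
      ¬ ((∀ x : Fin n → 𝓞 ↥K, x ≠ 0 →
            IsTotallyPositive ((MvPolynomial.eval x Q : ↥K) : ℂ)) ∧
        (∀ α : 𝓞 ↥K, IsTotallyPositive ((α : ↥K) : ℂ) →
          ∃ x : Fin n → 𝓞 ↥K, MvPolynomial.eval x Q = α))) := by
  refine ⟨fun L _ _ _ _ Q h => not_universal_quadraticMap K hK hinf Q h.1 h.2, ?_⟩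
  intro n p hp h
  obtain ⟨Q, hQ⟩ := exists_quadraticMap_eq_eval p hp
  simp only [← hQ] at h
  exact not_universal_quadraticMap K hK hinf Q h.1 h.2

end
end
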